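/- Let G be a graph with no isolated vertices such that S/J_G is Gorenstein, J_G is generated in degree 2, and reg(J_G) = 3 (i.e., J_G is extremal Gorenstein). Then G = 2K_2 (two disjoint edges) or G = P_3 (the path on 3 vertices). -/

import Mathlib

open MvPolynomial

noncomputable section

variable {K : Type} [Field K] {σ : Type}

/-- `p` is homogeneous of degree `z : ℤ` (the zero polynomial is homogeneous of any degree). -/
def IsHomZ (p : MvPolynomial σ K) (z : ℤ) : Prop :=
  ∀ d ∈ p.support, (d.sum fun _ e => (e : ℤ)) = z

/-- Homogeneous elements of degree `z` of the polynomial ring, as an additive subgroup. -/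
def polyGr (K : Type) [Field K] (σ : Type) (z : ℤ) :
    AddSubgroup (MvPolynomial σ K) where
  carrier := {p | IsHomZ p z}
  zero_mem' := by intro d hd; simp at hd
  add_mem' := by
    classical
    intro p q hp hq d hd
    rcases Finset.mem_union.mp (MvPolynomial.support_add hd) with h | h
    · exact hp d h
    · exact hq d h
  neg_mem' := by
    intro p hp d hd
    exact hp d (by simpa using hd)

/-- An element of a graded free module `B →₀ S`, with generator `b` in degree `dg b`,
is homogeneous of degree `z`. -/
def FinsuppHomog {B : Type} (dg : B → ℤ) (x : B →₀ MvPolynomial σ K) (z : ℤ) : Prop :=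
  ∀ b, IsHomZ (x b) (z - dg b)

/-- A graded free resolution of a module `M` over the polynomial ring,
with degree-`0` (i.e. graded) differentials; the grading of `M` is recorded by
the family of additive subgroups `gr`. -/
structure GradedFreeResolution {M : Type} [AddCommGroup M]
    [Module (MvPolynomial σ K) M] (gr : ℤ → AddSubgroup M) where
  B : ℕ → Type
  dg : ∀ i, B i → ℤ
  φ : ∀ i, (B (i + 1) →₀ MvPolynomial σ K) →ₗ[MvPolynomial σ K]
        (B i →₀ MvPolynomial σ K)
  π : (B 0 →₀ MvPolynomial σ K) →ₗ[MvPolynomial σ K] M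
  φ_graded : ∀ i b, FinsuppHomog (dg i) (φ i (Finsupp.single b 1)) (dg (i + 1) b)
  π_graded : ∀ b, π (Finsupp.single b 1) ∈ gr (dg 0 b)
  π_surj : Function.Surjective π
  exact0 : Function.Exact (φ 0) π
  exact : ∀ i, Function.Exact (φ (i + 1)) (φ i)

/-- Castelnuovo–Mumford regularity of a graded module, defined as the infimum over
all graded free resolutions of the largest twist: `reg M = min_F max {deg b - i}`;
the minimal free resolution realizes this infimum. -/
def moduleReg (K : Type) [Field K] (σ : Type) {M : Type} [AddCommGroup M]
    [Module (MvPolynomial σ K) M] (gr : ℤ → AddSubgroup M) : ℤ :=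
  sInf {r : ℤ | ∃ F : GradedFreeResolution (K := K) (σ := σ) gr,
    ∀ i b, F.dg i b ≤ r + i}

/-- Grading on (the underlying module of) a homogeneous ideal. -/
def idealGr (I : Ideal (MvPolynomial σ K)) (z : ℤ) : AddSubgroup I where
  carrier := {x | IsHomZ (x : MvPolynomial σ K) z}
  zero_mem' := by intro d hd; simp at hd
  add_mem' := by
    classical
    intro p q hp hq d hd
    rcases Finset.mem_union.mp (MvPolynomial.support_add hd) with h | h
    · exact hp d h
    · exact hq d h
  neg_mem' := by
    intro p hp d hd
    exact hp d (by simpa using hd)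

/-- Grading on the quotient `S/I` of the polynomial ring by a homogeneous ideal. -/
def quotGr (I : Ideal (MvPolynomial σ K)) (z : ℤ) :
    AddSubgroup (MvPolynomial σ K ⧸ I) :=
  (polyGr K σ z).map (Ideal.Quotient.mk I).toAddMonoidHom

/-- The Castelnuovo–Mumford regularity `reg I` of a homogeneous ideal. -/
def idealReg (I : Ideal (MvPolynomial σ K)) : ℤ :=
  moduleReg K σ (idealGr I)

/-- The Castelnuovo–Mumford regularity `reg S/I`. -/
def quotReg (I : Ideal (MvPolynomial σ K)) : ℤ :=
  moduleReg K σ (quotGr I)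

/-- The binomial edge ideal of a graph `G` on `[n]`, in
`S = K[x_1, …, x_n, y_1, …, y_n]` where `x_i = X (inl i)` and `y_i = X (inr i)`. -/
def beIdeal (K : Type) [Field K] {n : ℕ} (G : SimpleGraph (Fin n)) :
    Ideal (MvPolynomial (Fin n ⊕ Fin n) K) :=
  Ideal.span {f | ∃ i j, G.Adj i j ∧
    f = X (Sum.inl i) * X (Sum.inr j) - X (Sum.inl j) * X (Sum.inr i)}

/-- The initial ideal of `I` with respect to a monomial order `m`: the ideal generated
by the leading monomials of the nonzero elements of `I`. -/
def initialIdeal (m : MonomialOrder σ) (I : Ideal (MvPolynomial σ K)) :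
    Ideal (MvPolynomial σ K) :=
  Ideal.span {g | ∃ f ∈ I, ∃ d ∈ f.support,
    (∀ d' ∈ f.support, m.toSyn d' ≤ m.toSyn d) ∧ g = monomial d (1 : K)}

/-- A finite injective resolution `0 → M → I⁰ → I¹ → ⋯ → Iⁿ → 0`. -/
structure FiniteInjectiveResolution (R : Type) [CommRing R] (M : Type) [AddCommGroup M]
    [Module R M] where
  n : ℕ
  I : ℕ → Type
  acg : ∀ i, AddCommGroup (I i)
  mod : ∀ i, @Module R (I i) _ (acg i).toAddCommMonoid
  inj : ∀ i, @Module.Injective R _ (I i) (acg i) (mod i)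
  ι : @LinearMap R R _ _ (RingHom.id R) M (I 0) _ (acg 0).toAddCommMonoid _ (mod 0)
  d : ∀ i, @LinearMap R R _ _ (RingHom.id R) (I i) (I (i + 1))
        (acg i).toAddCommMonoid (acg (i + 1)).toAddCommMonoid (mod i) (mod (i + 1))
  ι_inj : Function.Injective ι
  ex0 : Function.Exact ι (d 0)
  ex : ∀ i, Function.Exact (d i) (d (i + 1))
  bounded : ∀ i > n, ∀ x : I i, x = 0

/-- A (finite-dimensional) Noetherian ring is Gorenstein iff it has finite injective
dimension over itself. -/
def IsGorensteinRing (R : Type) [CommRing R] : Prop :=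
  IsNoetherianRing R ∧ Nonempty (FiniteInjectiveResolution R R)

end

namespace BEI
section A
variable {S : Type} [CommRing S]

def Killed (I : Ideal S) (N : Type) [AddCommGroup N] [Module S N] : Prop :=
  ∀ a ∈ I, ∀ m : N, a • m = 0

def InjRel (I : Ideal S) (N : Type) [AddCommGroup N] [Module S N] : Prop :=
  Killed I N ∧ ∀ (Y : Type) [AddCommGroup Y] [Module S Y] (X : Submodule S Y), Killed I Y →
    ∀ g : X →ₗ[S] N, ∃ G : Y →ₗ[S] N, ∀ x : X, G x = g x

def FIDI (I : Ideal S) : ℕ → ∀ (N : Type) [AddCommGroup N] [Module S N], Prop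
  | 0, N, _, _ => InjRel I N
  | k + 1, N, _, _ => ∃ (E C : Type) (_ : AddCommGroup E) (_ : Module S E)
      (_ : AddCommGroup C) (_ : Module S C) (f : N →ₗ[S] E) (h : E →ₗ[S] C),
      InjRel I E ∧ Function.Injective f ∧ Function.Exact f h ∧ Function.Surjective h ∧
      FIDI I k C

def FI (I : Ideal S) : Prop := ∃ k, FIDI I k (S ⧸ I)

theorem killed_quot (I : Ideal S) : Killed I (S ⧸ I) := by
  intro a ha m
  obtain ⟨m, rfl⟩ := Ideal.Quotient.mk_surjective m
  rw [← Ideal.Quotient.mk_eq_mk, ← Submodule.Quotient.mk_smul, Submodule.Quotient.mk_eq_zero]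
  exact I.mul_mem_right _ ha

/-- factorization through a surjection -/
theorem exists_factor {A B D : Type} [AddCommGroup A] [AddCommGroup B] [AddCommGroup D]
    [Module S A] [Module S B] [Module S D] (p : A →ₗ[S] B) (q : A →ₗ[S] D)
    (hp : Function.Surjective p) (h : ∀ a, p a = 0 → q a = 0) :
    ∃ l : B →ₗ[S] D, ∀ a, l (p a) = q a := by
  let e := p.quotKerEquivOfSurjective hp
  refine ⟨((LinearMap.ker p).liftQ q (fun a ha => h a ha)) ∘ₗ e.symm.toLinearMap, fun a => ?_⟩
  have : e.symm (p a) = (LinearMap.ker p).mkQ a := by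
    rw [LinearEquiv.symm_apply_eq]; rfl
  rw [LinearMap.comp_apply]
  simp only [LinearEquiv.coe_coe, this]
  rfl

/-- extension along an injective map -/
theorem InjRel.extend {I : Ideal S} {N : Type} [AddCommGroup N] [Module S N] (hN : InjRel I N)
    {X Y : Type} [AddCommGroup X] [Module S X] [AddCommGroup Y] [Module S Y] (hY : Killed I Y)
    (i : X →ₗ[S] Y) (hi : Function.Injective i) (g : X →ₗ[S] N) :
    ∃ G : Y →ₗ[S] N, ∀ x, G (i x) = g x := by
  let e := LinearEquiv.ofInjective i hi
  obtain ⟨G, hG⟩ := hN.2 Y (LinearMap.range i) hY (g ∘ₗ e.symm.toLinearMap)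
  refine ⟨G, fun x => ?_⟩
  have := hG (e x)
  simpa [e] using this

theorem InjRel.retract {I : Ideal S} {N M : Type} [AddCommGroup N] [Module S N]
    [AddCommGroup M] [Module S M] (hN : InjRel I N) (s : M →ₗ[S] N) (r : N →ₗ[S] M)
    (h : ∀ m, r (s m) = m) : InjRel I M := by
  refine ⟨fun a ha m => ?_, fun Y _ _ X hY g => ?_⟩
  · rw [← h m, ← map_smul, hN.1 a ha, map_zero]
  · obtain ⟨G, hG⟩ := hN.2 Y X hY (s ∘ₗ g)
    exact ⟨r ∘ₗ G, fun x => by simp [hG, h]⟩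

theorem FIDI.killed {I : Ideal S} : ∀ {k : ℕ} {N : Type} [AddCommGroup N] [Module S N],
    FIDI I k N → Killed I N
  | 0, _, _, _, h => h.1
  | k + 1, N, _, _, ⟨E, C, _, _, _, _, f, g, hE, hf, _⟩ => fun a ha m => hf (by
      rw [map_smul, hE.1 a ha, map_zero])

theorem FIDI.congr {I : Ideal S} : ∀ {k : ℕ} {N M : Type} [AddCommGroup N] [Module S N]
    [AddCommGroup M] [Module S M], FIDI I k N → (N ≃ₗ[S] M) → FIDI I k M
  | 0, _, _, _, _, _, _, h, e => InjRel.retract h e.symm.toLinearMap e.toLinearMap (by simp)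
  | k + 1, N, M, _, _, _, _, ⟨E, C, _, _, _, _, f, g, hE, hf, hx, hs, hC⟩, e =>
    ⟨E, C, _, _, _, _, f ∘ₗ e.symm.toLinearMap, g, hE, by
      simpa using hf, by
      intro y
      rw [hx y]
      constructor
      · rintro ⟨n, rfl⟩; exact ⟨e n, by simp⟩
      · rintro ⟨n, rfl⟩; exact ⟨e.symm n, by simp⟩, hs, hC⟩

section quot
variable {I : Ideal S} {x : S}

theorem mem_sup_span {I : Ideal S} {x a : S} (h : a ∈ I ⊔ Ideal.span {x}) :
    ∃ b ∈ I, ∃ c, a = b + c * x := by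
  obtain ⟨b, hb, d, hd, rfl⟩ := Submodule.mem_sup.1 h
  obtain ⟨c, rfl⟩ := Ideal.mem_span_singleton'.1 hd
  exact ⟨b, hb, c, rfl⟩

theorem killed_sup {N : Type} [AddCommGroup N] [Module S N] (h : Killed I N)
    (hx : ∀ m : N, x • m = 0) : Killed (I ⊔ Ideal.span {x}) N := by
  intro a ha m
  obtain ⟨b, hb, c, rfl⟩ := mem_sup_span ha
  rw [add_smul, h b hb, mul_smul, hx, smul_zero, add_zero]

theorem InjRel.torsion {E : Type} [AddCommGroup E] [Module S E] (hE : InjRel I E) :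
    InjRel (I ⊔ Ideal.span {x}) (Submodule.torsionBy S E x) := by
  refine ⟨killed_sup (fun a ha m => Subtype.ext (by simpa using hE.1 a ha m.1)) (fun m => ?_), ?_⟩
  · exact Subtype.ext (by simpa using m.2)
  · intro Y _ _ X hY g
    obtain ⟨G, hG⟩ := hE.2 Y X (fun a ha => hY a (Ideal.mem_sup_left ha))
      ((Submodule.torsionBy S E x).subtype ∘ₗ g)
    refine ⟨G.codRestrict _ fun y => ?_, fun z => Subtype.ext (by simp [hG])⟩
    rw [Submodule.mem_torsionBy_iff, ← map_smul, hY x (Ideal.mem_sup_right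
      (Ideal.mem_span_singleton_self x)), map_zero]

theorem InjRel.divisible (hx : ∀ f, x * f ∈ I → f ∈ I) {E : Type} [AddCommGroup E] [Module S E]
    (hE : InjRel I E) (e : E) : ∃ e' : E, x • e' = e := by
  obtain ⟨l, hl⟩ := exists_factor (I.mkQ) (LinearMap.toSpanSingleton S E e) I.mkQ_surjective
    (fun a ha => by
      have : a ∈ I := (Submodule.Quotient.mk_eq_zero _).1 ha
      simpa using hE.1 a this e)
  obtain ⟨G, hG⟩ := hE.extend (killed_quot I) (LinearMap.lsmul S (S ⧸ I) x) (by
      rw [← LinearMap.ker_eq_bot, LinearMap.ker_eq_bot']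
      intro m hm
      obtain ⟨m, rfl⟩ := Ideal.Quotient.mk_surjective m
      rw [← Ideal.Quotient.mk_eq_mk, LinearMap.lsmul_apply, ← Submodule.Quotient.mk_smul,
        Submodule.Quotient.mk_eq_zero] at hm
      exact (Submodule.Quotient.mk_eq_zero _).2 (hx _ hm)) l
  refine ⟨G (I.mkQ 1), ?_⟩
  have := hG (I.mkQ 1)
  rw [hl] at this
  rw [← map_smul]
  simpa using this

theorem FIDI.torsion (hx : ∀ f, x * f ∈ I → f ∈ I) : ∀ {k : ℕ} {N : Type} [AddCommGroup N]
    [Module S N], FIDI I k N → (∀ m : N, ∃ m', x • m' = m) →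
    FIDI (I ⊔ Ideal.span {x}) k (Submodule.torsionBy S N x)
  | 0, _, _, _, h, _ => InjRel.torsion h
  | k + 1, N, _, _, ⟨E, C, _, _, _, _, f, g, hE, hf, hex, hs, hC⟩, hd => by
    have hCd : ∀ m : C, ∃ m', x • m' = m := fun m => by
      obtain ⟨e, rfl⟩ := hs m
      obtain ⟨e', rfl⟩ := hE.divisible hx e
      exact ⟨g e', by simp⟩
    refine ⟨_, _, _, _, _, _, (f.restrict (p := Submodule.torsionBy S N x)
      (q := Submodule.torsionBy S E x) ?_), (g.restrict (p := Submodule.torsionBy S E x)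
      (q := Submodule.torsionBy S C x) ?_), hE.torsion, ?_, ?_, ?_, FIDI.torsion hx hC hCd⟩
    · intro m hm
      rw [Submodule.mem_torsionBy_iff] at *
      rw [← map_smul, hm, map_zero]
    · intro m hm
      rw [Submodule.mem_torsionBy_iff] at *
      rw [← map_smul, hm, map_zero]
    · intro a b hab
      exact Subtype.ext (hf (congrArg Subtype.val hab))
    · intro e
      constructor
      · intro he
        obtain ⟨m, hm⟩ := (hex e.1).1 (congrArg Subtype.val he)
        refine ⟨⟨m, ?_⟩, Subtype.ext hm⟩
        rw [Submodule.mem_torsionBy_iff]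
        apply hf
        rw [map_smul, hm, map_zero]
        exact e.2
      · rintro ⟨m, rfl⟩
        exact Subtype.ext ((hex _).2 ⟨m.1, rfl⟩)
    · intro c
      obtain ⟨e, he⟩ := hs c.1
      have h0 : g (x • e) = 0 := by rw [map_smul, he]; exact c.2
      obtain ⟨m, hm⟩ := (hex _).1 h0
      obtain ⟨m', rfl⟩ := hd m
      refine ⟨⟨e - f m', ?_⟩, Subtype.ext ?_⟩
      · rw [Submodule.mem_torsionBy_iff, smul_sub, ← map_smul, hm, sub_self]
      · have : g (f m') = 0 := (hex _).2 ⟨m', rfl⟩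
        simp [he, this]

/-- the quotient of an injective by an injective -/
theorem InjRel.quot {I : Ideal S} {E C M : Type} [AddCommGroup E] [Module S E] [AddCommGroup C]
    [Module S C] [AddCommGroup M] [Module S M] (hE : InjRel I E) (hC : InjRel I C)
    (i : E →ₗ[S] C) (p : C →ₗ[S] M) (hi : Function.Injective i) (hip : Function.Exact i p)
    (hp : Function.Surjective p) : InjRel I M := by
  obtain ⟨r, hr⟩ := hE.extend hC.1 i hi LinearMap.id
  obtain ⟨s, hs⟩ := exists_factor p (LinearMap.id - i ∘ₗ r) hp (fun c hc => by
    obtain ⟨e, rfl⟩ := (hip c).1 hc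
    simp [hr])
  refine hC.retract s p fun m => ?_
  obtain ⟨c, rfl⟩ := hp m
  rw [hs]
  have : p (i (r c)) = 0 := (hip _).2 ⟨_, rfl⟩
  simp [this]

theorem FIDI.quot {I : Ideal S} {E : Type} [AddCommGroup E] [Module S E] (hE : InjRel I E) :
    ∀ {k : ℕ} {C M : Type} [AddCommGroup C]
    [Module S C] [AddCommGroup M] [Module S M] (_ : FIDI I k C)
    (i : E →ₗ[S] C) (p : C →ₗ[S] M) (_ : Function.Injective i) (_ : Function.Exact i p)
    (_ : Function.Surjective p), FIDI I k M
  | 0, _, _, _, _, _, _, hC, i, p, hi, hip, hp => InjRel.quot hE hC i p hi hip hp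
  | k + 1, C, M, _, _, _, _, ⟨D, Q, _, _, _, _, f, g, hD, hf, hex, hs, hQ⟩, i, p, hi, hip, hp => by
    obtain ⟨F, hF⟩ := exists_factor p ((LinearMap.range (f ∘ₗ i)).mkQ ∘ₗ f) hp (fun c hc => by
      obtain ⟨e, rfl⟩ := (hip c).1 hc
      simp)
    obtain ⟨H, hH⟩ := exists_factor (LinearMap.range (f ∘ₗ i)).mkQ g
      (Submodule.mkQ_surjective _) (fun d hd => by
      obtain ⟨e, rfl⟩ := (Submodule.Quotient.mk_eq_zero _).1 hd
      exact (hex _).2 ⟨i e, rfl⟩)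
    refine ⟨D ⧸ LinearMap.range (f ∘ₗ i), Q, _, _, _, _, F, H, ?_, ?_, ?_, ?_, hQ⟩
    · refine hE.quot hD (f ∘ₗ i) (Submodule.mkQ _) (hf.comp hi) ?_ (Submodule.mkQ_surjective _)
      rw [LinearMap.exact_iff, Submodule.ker_mkQ]
    · rw [← LinearMap.ker_eq_bot, LinearMap.ker_eq_bot']
      intro m hm
      obtain ⟨c, rfl⟩ := hp m
      rw [hF] at hm
      obtain ⟨e, he⟩ := (Submodule.Quotient.mk_eq_zero _).1 hm
      rw [← hf he]
      exact (hip _).2 ⟨_, rfl⟩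
    · intro d
      obtain ⟨d, rfl⟩ := Submodule.mkQ_surjective _ d
      rw [hH, hex]
      constructor
      · rintro ⟨c, rfl⟩; exact ⟨p c, hF c⟩
      · rintro ⟨m, hm⟩
        obtain ⟨c, rfl⟩ := hp m
        rw [hF] at hm
        have := (Submodule.Quotient.eq _).1 hm
        obtain ⟨e, he⟩ := this
        refine ⟨c - i e, ?_⟩
        rw [map_sub]
        have he' : f (i e) = f c - d := he
        rw [he']; abel
    · intro q
      obtain ⟨d, rfl⟩ := hs q
      exact ⟨_, hH d⟩

theorem FIDI.mod (hx : ∀ f, x * f ∈ I → f ∈ I) : ∀ {k : ℕ} {M M' : Type} [AddCommGroup M]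
    [Module S M] [AddCommGroup M'] [Module S M'] (_ : FIDI I k M) (q : M →ₗ[S] M')
    (_ : Function.Surjective q) (_ : ∀ m, q m = 0 ↔ ∃ m', m = x • m')
    (_ : ∀ m : M, x • m = 0 → m = 0), ∃ k', FIDI (I ⊔ Ideal.span {x}) k' M'
  | 0, M, M', _, _, _, _, h, q, hq, hk, ht => by
    have hz : ∀ m : M', m = 0 := fun m => by
      obtain ⟨m, rfl⟩ := hq m
      obtain ⟨m', rfl⟩ := InjRel.divisible hx h m
      exact (hk _).2 ⟨m', rfl⟩
    exact ⟨0, fun _ _ _ => hz _, fun Y _ _ X hY g => ⟨0, fun y => by rw [hz (g y)]; simp⟩⟩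
  | k + 1, M, M', _, _, _, _, ⟨E, C, _, _, _, _, f, g, hE, hf, hex, hs, hC⟩, q, hq, hk, ht => by
    have hCd : ∀ m : C, ∃ m', x • m' = m := fun m => by
      obtain ⟨e, rfl⟩ := hs m
      obtain ⟨e', rfl⟩ := hE.divisible hx e
      exact ⟨g e', by simp⟩
    have hT := FIDI.torsion hx hC hCd
    have hET : InjRel (I ⊔ Ideal.span {x}) (Submodule.torsionBy S E x) := hE.torsion
    -- the submodule of e with x e in the range of f
    let Ex : Submodule S E := (LinearMap.range f).comap (LinearMap.lsmul S E x)
    let ei := LinearEquiv.ofInjective f hf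
    let μ : Ex →ₗ[S] M' := q ∘ₗ ei.symm.toLinearMap ∘ₗ
      ((LinearMap.lsmul S E x).restrict (p := Ex) (q := LinearMap.range f) (fun e he => he))
    have hμ : ∀ (e : Ex) (m : M), x • e.1 = f m → μ e = q m := by
      intro e m hm
      have : ((LinearMap.lsmul S E x).restrict (p := Ex) (q := LinearMap.range f)
        (fun e he => he)) e = ei m := Subtype.ext hm
      simp only [μ, LinearMap.comp_apply, this]
      simp
    let γ : Ex →ₗ[S] Submodule.torsionBy S C x := g.restrict (p := Ex) (fun e he => by
      rw [Submodule.mem_torsionBy_iff, ← map_smul]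
      exact (hex _).2 he)
    have hγ : Function.Surjective γ := by
      intro c
      obtain ⟨e, he⟩ := hs c.1
      refine ⟨⟨e, (hex _).1 ?_⟩, Subtype.ext he⟩
      rw [LinearMap.lsmul_apply, map_smul, he]; exact c.2
    have hγ0 : ∀ e : Ex, γ e = 0 → ∃ m, e.1 = f m := fun e he => by
      obtain ⟨m, hm⟩ := (hex e.1).1 (congrArg Subtype.val he)
      exact ⟨m, hm.symm⟩
    obtain ⟨p, hp⟩ := exists_factor γ μ hγ (fun e he => by
      obtain ⟨m, hm⟩ := hγ0 e he
      rw [hμ e (x • m) (by rw [hm, map_smul])]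
      exact (hk _).2 ⟨m, rfl⟩)
    let i : Submodule.torsionBy S E x →ₗ[S] Submodule.torsionBy S C x := g.restrict (fun e he => by
      rw [Submodule.mem_torsionBy_iff] at *
      rw [← map_smul, he, map_zero])
    have hQ : FIDI (I ⊔ Ideal.span {x}) k M' := by
      refine FIDI.quot hET hT i p ?_ ?_ ?_
      · rw [← LinearMap.ker_eq_bot, LinearMap.ker_eq_bot']
        intro e he
        obtain ⟨m, hm⟩ := (hex e.1).1 (congrArg Subtype.val he)
        have : m = 0 := ht m (hf (by rw [map_smul, hm, map_zero]; exact e.2))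
        subst this
        exact Subtype.ext (by rw [← hm, map_zero]; rfl)
      · intro c
        obtain ⟨e, rfl⟩ := hγ c
        rw [hp]
        obtain ⟨m, hm⟩ := e.2
        rw [hμ e m hm.symm, hk]
        constructor
        · rintro ⟨m', rfl⟩
          refine ⟨⟨e.1 - f m', ?_⟩, Subtype.ext ?_⟩
          · rw [Submodule.mem_torsionBy_iff, smul_sub, ← map_smul, hm]
            simp
          · have : g (f m') = 0 := (hex _).2 ⟨m', rfl⟩
            show g (e.1 - f m') = g e.1
            simp [this]
        · rintro ⟨e', he'⟩
          have h1 : g (e.1 - e'.1) = 0 := by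
            have : g e'.1 = g e.1 := congrArg Subtype.val he'
            rw [map_sub, this, sub_self]
          obtain ⟨m', hm'⟩ := (hex _).1 h1
          refine ⟨m', hf ?_⟩
          rw [map_smul, hm', smul_sub, hm]
          have : x • e'.1 = 0 := e'.2
          simp [this]
      · intro m'
        obtain ⟨m, rfl⟩ := hq m'
        obtain ⟨e, he⟩ := hE.divisible hx (f m)
        refine ⟨γ ⟨e, ⟨m, he.symm⟩⟩, ?_⟩
        rw [hp]
        exact hμ _ m he
    exact ⟨k, hQ⟩

theorem FI.mod (hI : FI I) (hx : ∀ f, x * f ∈ I → f ∈ I) : FI (I ⊔ Ideal.span {x}) := by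
  obtain ⟨k, hk⟩ := hI
  obtain ⟨q, hq⟩ := exists_factor I.mkQ (I ⊔ Ideal.span {x}).mkQ (Submodule.mkQ_surjective _)
    (fun a ha => (Submodule.Quotient.mk_eq_zero _).2
      (Ideal.mem_sup_left ((Submodule.Quotient.mk_eq_zero _).1 ha)))
  refine FIDI.mod hx hk q ?_ ?_ ?_
  · intro m
    obtain ⟨m, rfl⟩ := Submodule.mkQ_surjective _ m
    exact ⟨_, hq m⟩
  · intro m
    obtain ⟨m, rfl⟩ := Submodule.mkQ_surjective _ m
    rw [hq]
    constructor
    · intro h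
      obtain ⟨b, hb, c, rfl⟩ := mem_sup_span ((Submodule.Quotient.mk_eq_zero _).1 h)
      refine ⟨I.mkQ c, ?_⟩
      rw [← map_smul, ← sub_eq_zero, ← map_sub]
      refine (Submodule.Quotient.mk_eq_zero _).2 ?_
      rw [smul_eq_mul, mul_comm x c, add_sub_cancel_right]
      exact hb
    · rintro ⟨m', hm⟩
      obtain ⟨m', rfl⟩ := Submodule.mkQ_surjective _ m'
      rw [← map_smul, ← sub_eq_zero, ← map_sub] at hm
      have := (Submodule.Quotient.mk_eq_zero _).1 hm
      refine (Submodule.Quotient.mk_eq_zero _).2 ?_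
      have h2 : m = (m - x • m') + m' * x := by rw [smul_eq_mul]; ring
      rw [h2]
      exact add_mem (Ideal.mem_sup_left this)
        (Ideal.mul_mem_left _ _ (Ideal.mem_sup_right (Ideal.mem_span_singleton_self x)))
  · intro m hm
    obtain ⟨m, rfl⟩ := Submodule.mkQ_surjective _ m
    rw [← map_smul] at hm
    exact (Submodule.Quotient.mk_eq_zero _).2 (hx _ ((Submodule.Quotient.mk_eq_zero _).1 hm))

end quot
end A
end BEI

namespace BEI
section A2
variable {S : Type} [CommRing S] {J : Ideal S}

theorem injRel_of_injective (N : Type) [AddCommGroup N] [Module (S ⧸ J) N] [Module S N]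
    [IsScalarTower S (S ⧸ J) N] (h : Module.Injective (S ⧸ J) N) : InjRel J N := by
  constructor
  · intro a ha m
    have h1 : a • ((1 : S ⧸ J) • m) = (a • (1 : S ⧸ J)) • m := (smul_assoc _ _ _).symm
    rw [one_smul] at h1
    rw [h1, killed_quot J a ha, zero_smul]
  · intro Y _ _ X hY g
    have ht : Module.IsTorsionBySet S Y J := fun m a => hY a.1 a.2 m
    let : Module (S ⧸ J) Y := ht.module
    have : IsScalarTower S (S ⧸ J) Y := ht.isScalarTower
    have hsurj : Function.Surjective (algebraMap S (S ⧸ J)) := Ideal.Quotient.mk_surjective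
    have htX : Module.IsTorsionBySet S X J := fun m a => Subtype.ext (hY a.1 a.2 m.1)
    let : Module (S ⧸ J) X := htX.module
    have : IsScalarTower S (S ⧸ J) X := htX.isScalarTower
    obtain ⟨G, hG⟩ := h.out (LinearMap.extendScalarsOfSurjective hsurj X.subtype)
      (fun a b hab => Subtype.ext hab) (LinearMap.extendScalarsOfSurjective hsurj g)
    exact ⟨G.restrictScalars S, fun x => hG x⟩

theorem fidi_of_res : ∀ (n : ℕ) (N : Type) [AddCommGroup N] [Module (S ⧸ J) N] [Module S N]
    [IsScalarTower S (S ⧸ J) N] (F : FiniteInjectiveResolution (S ⧸ J) N), F.n = n →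
    ∃ k, FIDI J k N
  | 0, N, _, _, _, _, F, hF => by
    let := F.acg
    let := F.mod
    let : Module S (F.I 0) := Module.compHom _ (Ideal.Quotient.mk J)
    have : IsScalarTower S (S ⧸ J) (F.I 0) := ⟨fun a b m => by
      obtain ⟨b, rfl⟩ := Ideal.Quotient.mk_surjective b
      show (Ideal.Quotient.mk J (a * b)) • m = (Ideal.Quotient.mk J a) • (_ : F.I 0)
      rw [map_mul, mul_smul]⟩
    have h0 := injRel_of_injective (F.I 0) (F.inj 0)
    let e : N ≃ₗ[S ⧸ J] F.I 0 := LinearEquiv.ofBijective F.ι ⟨F.ι_inj, fun y =>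
      (F.ex0 y).1 (F.bounded 1 (by omega) _)⟩
    exact ⟨0, h0.retract (e.toLinearMap.restrictScalars S) (e.symm.toLinearMap.restrictScalars S)
      (fun m => by simp)⟩
  | n + 1, N, _, _, _, _, F, hF => by
    let := F.acg
    let := F.mod
    let : ∀ i, Module S (F.I i) := fun i => Module.compHom _ (Ideal.Quotient.mk J)
    have : ∀ i, IsScalarTower S (S ⧸ J) (F.I i) := fun i => ⟨fun a b m => by
      obtain ⟨b, rfl⟩ := Ideal.Quotient.mk_surjective b
      show (Ideal.Quotient.mk J (a * b)) • m = (Ideal.Quotient.mk J a) • (_ : F.I i)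
      rw [map_mul, mul_smul]⟩
    have h0 := injRel_of_injective (F.I 0) (F.inj 0)
    obtain ⟨k, hk⟩ := fidi_of_res n (LinearMap.range (F.d 0))
      { n := n
        I := fun i => F.I (i + 1)
        acg := fun i => F.acg (i + 1)
        mod := fun i => F.mod (i + 1)
        inj := fun i => F.inj (i + 1)
        ι := (LinearMap.range (F.d 0)).subtype
        d := fun i => F.d (i + 1)
        ι_inj := Subtype.val_injective
        ex0 := by
          intro y
          rw [F.ex 0 y]
          simp
        ex := fun i => F.ex (i + 1)
        bounded := fun i hi x => F.bounded (i + 1) (by omega) x } rfl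
    refine ⟨k + 1, F.I 0, LinearMap.range (F.d 0), _, _, _, _, F.ι.restrictScalars S,
      ((F.d 0).rangeRestrict).restrictScalars S, h0, F.ι_inj, ?_, ?_, hk⟩
    · intro y
      refine Iff.trans ?_ (F.ex0 y)
      exact ⟨fun h => congrArg Subtype.val h, fun h => Subtype.ext h⟩
    · exact LinearMap.surjective_rangeRestrict _

theorem FI_of_gor (h : IsGorensteinRing (S ⧸ J)) : FI J := by
  obtain ⟨F⟩ := h.2
  exact fidi_of_res F.n (S ⧸ J) F rfl
end A2
end BEI

namespace BEI
section A3
set_option linter.unusedSectionVars false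
variable {S : Type} [CommRing S] {I 𝔪 : Ideal S}
variable {α β : Type} [Fintype α] [Fintype β] [DecidableEq α] [DecidableEq β]

def comb (a : α → S) : (α → S) →ₗ[S] S := Fintype.linearCombination S a

theorem comb_apply (a : α → S) (c : α → S) : comb a c = ∑ i, c i * a i := by
  simp [comb, Fintype.linearCombination_apply]

theorem comb_single (a : α → S) (i : α) (s : S) : comb a (Pi.single i s) = s * a i := by
  rw [comb_apply, Finset.sum_eq_single i] <;> simp +contextual

def Rel (I : Ideal S) (a : α → S) : Submodule S (α → S) := Submodule.comap (comb a) I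

theorem mem_Rel {a : α → S} {c : α → S} : c ∈ Rel I a ↔ comb a c ∈ I := Iff.rfl

def E1 (I : Ideal S) (a : α → S) (N : Type) [AddCommGroup N] [Module S N] : Prop :=
  ∀ g : Rel I a →ₗ[S] N, (∀ c : Rel I a, (∀ i, c.1 i ∈ I) → g c = 0) →
    ∃ n : α → N, ∀ c : Rel I a, g c = ∑ i, c.1 i • n i

theorem E1_base {N : Type} [AddCommGroup N] [Module S N] (a : α → S) (hN : InjRel I N) :
    E1 I a N := by
  intro g hg
  let P : (α → S) →ₗ[S] (α → S ⧸ I) := LinearMap.pi fun i => I.mkQ ∘ₗ LinearMap.proj i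
  have hP : ∀ c i, P c i = I.mkQ (c i) := fun c i => rfl
  obtain ⟨l, hl⟩ := exists_factor (P ∘ₗ (Rel I a).subtype).rangeRestrict g
    (LinearMap.surjective_rangeRestrict _) (fun c hc => by
      refine hg c fun i => ?_
      have := congrFun (congrArg Subtype.val hc) i
      exact (Submodule.Quotient.mk_eq_zero _).1 this)
  obtain ⟨G, hG⟩ := hN.2 (α → S ⧸ I) _ (fun s hs m => by
    funext i; exact killed_quot I s hs (m i)) l
  refine ⟨fun i => G (P (Pi.single i 1)), fun c => ?_⟩
  rw [← hl, ← hG]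
  change G (P c.1) = _
  conv_lhs => rw [pi_eq_sum_univ' c.1]
  simp only [map_sum, map_smul]

theorem E1_step {N E C : Type} [AddCommGroup N] [Module S N] [AddCommGroup E] [Module S E]
    [AddCommGroup C] [Module S C] (f : N →ₗ[S] E) (h : E →ₗ[S] C) (hE : InjRel I E)
    (hf : Function.Injective f) (hex : Function.Exact f h) (hs : Function.Surjective h)
    (a : α → S) (b : β → S) (i0 : α) (ha : E1 I a C) (hbm : ∀ j, b j ∈ 𝔪)
    (hab : ∀ i j, a i * b j ∈ I)
    (h1 : ∀ c, comb a c ∈ I → ∀ i, c i ∈ 𝔪)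
    (pr : 𝔪 →ₗ[S] S ⧸ I) (prI : ∀ s : 𝔪, s.1 ∈ I → pr s = 0)
    (prs : ∀ s, pr s ∈ Submodule.span S (Set.range fun j => I.mkQ (b j)))
    (prb : ∀ j, pr ⟨b j, hbm j⟩ = I.mkQ (b j)) : E1 I b N := by
  intro g hg
  obtain ⟨e, he⟩ := E1_base b hE (f ∘ₗ g) (fun c hc => by simp [hg c hc])
  -- the hom on the span
  let B : (β → S) →ₗ[S] S ⧸ I := I.mkQ ∘ₗ comb b
  have hB : ∀ s, pr s ∈ LinearMap.range B := by
    intro s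
    refine Submodule.span_le.2 ?_ (prs s)
    rintro _ ⟨j, rfl⟩
    exact ⟨Pi.single j 1, by simp [B, comb_single]⟩
  obtain ⟨θ, hθ⟩ := exists_factor B.rangeRestrict (Fintype.linearCombination S fun j => h (e j))
    (LinearMap.surjective_rangeRestrict _) (fun c hc => by
      have hc' : comb b c ∈ I := (Submodule.Quotient.mk_eq_zero _).1 (congrArg Subtype.val hc)
      have h2 := he ⟨c, hc'⟩
      rw [Fintype.linearCombination_apply]
      have h3 : h (f (g ⟨c, hc'⟩)) = 0 := (hex _).2 ⟨_, rfl⟩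
      rw [LinearMap.comp_apply] at h2
      rw [h2] at h3
      simpa using h3)
  let g' : Rel I a →ₗ[S] C := θ ∘ₗ (pr.codRestrict _ hB) ∘ₗ
    (((LinearMap.proj i0 : (α → S) →ₗ[S] S) ∘ₗ (Rel I a).subtype).codRestrict 𝔪
      (fun c => h1 c.1 c.2 i0))
  have hg' : ∀ (c : Rel I a) (d : β → S) (hm : c.1 i0 ∈ 𝔪), pr ⟨c.1 i0, hm⟩ = B d →
      g' c = ∑ j, d j • h (e j) := by
    intro c d hm hd
    have : (pr.codRestrict _ hB) ⟨c.1 i0, hm⟩ = B.rangeRestrict d := Subtype.ext hd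
    change θ ((pr.codRestrict _ hB) ⟨c.1 i0, hm⟩) = _
    rw [this, hθ, Fintype.linearCombination_apply]
  obtain ⟨m, hm⟩ := ha g' (fun c hc => by
    rw [hg' c 0 (h1 c.1 c.2 i0) (by rw [prI _ (hc i0), map_zero])]
    simp)
  obtain ⟨ê, hê⟩ := hs (m i0)
  have key : ∀ j, ∃ n, f n = e j - b j • ê := by
    intro j
    have hc : Pi.single i0 (b j) ∈ Rel I a := by
      rw [mem_Rel, comb_single, mul_comm]; exact hab _ _
    have h2 := hg' ⟨_, hc⟩ (Pi.single j 1) (by simpa using hbm j) (by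
      simp only [Pi.single_eq_same]
      rw [prb]; simp [B, comb_single])
    rw [hm] at h2
    have e1 : ∑ i, (Pi.single i0 (b j) : α → S) i • m i = b j • m i0 := by
      rw [Finset.sum_eq_single i0] <;> simp +contextual
    have e2 : ∑ k, (Pi.single j 1 : β → S) k • h (e k) = h (e j) := by
      rw [Finset.sum_eq_single j] <;> simp +contextual
    simp only [e1, e2] at h2
    apply (hex _).1
    rw [map_sub, map_smul, hê, h2, sub_self]
  choose n hn using key
  refine ⟨n, fun c => hf ?_⟩
  have h3 := he c
  rw [LinearMap.comp_apply] at h3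
  rw [h3, map_sum]
  simp only [map_smul, hn, smul_sub, Finset.sum_sub_distrib]
  simp only [← mul_smul, ← Finset.sum_smul]
  rw [← comb_apply, hE.1 _ c.2, sub_zero]

theorem lemmaF (hFI : FI I) (h𝔪 : 𝔪 ≠ ⊤) (a : α → S) (b : β → S) (i0 : α) (j0 : β)
    (ham : ∀ i, a i ∈ 𝔪) (hbm : ∀ j, b j ∈ 𝔪) (hab : ∀ i j, a i * b j ∈ I)
    (h1 : ∀ c, comb a c ∈ I → ∀ i, c i ∈ 𝔪) (h2 : ∀ c, comb b c ∈ I → ∀ i, c i ∈ 𝔪)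
    (pra prb : 𝔪 →ₗ[S] S ⧸ I) (praI : ∀ s : 𝔪, s.1 ∈ I → pra s = 0)
    (prbI : ∀ s : 𝔪, s.1 ∈ I → prb s = 0)
    (pras : ∀ s, pra s ∈ Submodule.span S (Set.range fun j => I.mkQ (a j)))
    (prbs : ∀ s, prb s ∈ Submodule.span S (Set.range fun j => I.mkQ (b j)))
    (praa : ∀ j, pra ⟨a j, ham j⟩ = I.mkQ (a j))
    (prbb : ∀ j, prb ⟨b j, hbm j⟩ = I.mkQ (b j))
    (prba : ∀ j, prb ⟨a j, ham j⟩ = 0)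
    (hcase : a i0 * a i0 ∈ I ∨ ∃ i1, i1 ≠ i0) : False := by
  have hba : ∀ j i, b j * a i ∈ I := fun j i => by rw [mul_comm]; exact hab i j
  have main : ∀ (k : ℕ) (N : Type) [AddCommGroup N] [Module S N], FIDI I k N →
      E1 I a N ∧ E1 I b N := by
    intro k
    induction k with
    | zero => intro N _ _ h; exact ⟨E1_base a h, E1_base b h⟩
    | succ k ih =>
      rintro N _ _ ⟨E, C, _, _, _, _, f, h, hE, hf, hex, hs, hC⟩
      obtain ⟨ia, ib⟩ := ih C hC
      exact ⟨E1_step f h hE hf hex hs b a j0 ib ham hba h2 pra praI pras praa,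
        E1_step f h hE hf hex hs a b i0 ia hbm hab h1 prb prbI prbs prbb⟩
  obtain ⟨k, hk⟩ := hFI
  let g : Rel I a →ₗ[S] S ⧸ I := prb ∘ₗ
    (((LinearMap.proj i0 : (α → S) →ₗ[S] S) ∘ₗ (Rel I a).subtype).codRestrict 𝔪
      (fun c => h1 c.1 c.2 i0))
  have hg : ∀ (c : Rel I a), g c = prb ⟨c.1 i0, h1 c.1 c.2 i0⟩ := fun c => rfl
  obtain ⟨m, hm⟩ := (main k _ hk).1 g (fun c hc => by rw [hg, prbI _ (hc i0)])
  have hm' : ∀ c : Rel I a, prb ⟨c.1 i0, h1 c.1 c.2 i0⟩ = ∑ i, c.1 i • m i := fun c => by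
    rw [← hm, hg]
  have hr : ∀ i, ∃ r, I.mkQ r = m i := fun i => Submodule.mkQ_surjective _ _
  choose r hr using hr
  have hm2 : ∀ c : Rel I a, prb ⟨c.1 i0, h1 c.1 c.2 i0⟩ = I.mkQ (∑ i, c.1 i * r i) := fun c => by
    rw [hm' c, map_sum]; simp only [← smul_eq_mul, map_smul, hr]
  have A1 : 1 - r i0 ∈ 𝔪 := by
    have hc : Pi.single i0 (b j0) ∈ Rel I a := by
      rw [mem_Rel, comb_single, mul_comm]; exact hab _ _
    have h3 := hm2 ⟨_, hc⟩
    have e1 : ∑ i, (Pi.single i0 (b j0) : α → S) i * r i = b j0 * r i0 := by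
      rw [Finset.sum_eq_single i0] <;> simp +contextual
    simp only [e1, Pi.single_eq_same] at h3
    rw [prbb, ← sub_eq_zero, ← map_sub] at h3
    have h4 := (Submodule.Quotient.mk_eq_zero _).1 h3
    have := h2 (Pi.single j0 (1 - r i0)) (by
      rw [comb_single]; convert h4 using 1; ring) j0
    simpa using this
  have A2 : r i0 ∈ 𝔪 := by
    rcases hcase with hcase | ⟨i1, hi⟩
    · have hc : Pi.single i0 (a i0) ∈ Rel I a := by
        rw [mem_Rel, comb_single]; exact hcase
      have h3 := hm2 ⟨_, hc⟩
      have e1 : ∑ i, (Pi.single i0 (a i0) : α → S) i * r i = a i0 * r i0 := by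
        rw [Finset.sum_eq_single i0] <;> simp +contextual
      simp only [e1, Pi.single_eq_same] at h3
      rw [prba] at h3
      have h4 := (Submodule.Quotient.mk_eq_zero _).1 h3.symm
      have := h1 (Pi.single i0 (r i0)) (by
        rw [comb_single]; convert h4 using 1; ring) i0
      simpa using this
    · have hc : Pi.single i0 (a i1) - Pi.single i1 (a i0) ∈ Rel I a := by
        rw [mem_Rel, map_sub, comb_single, comb_single]; ring_nf; exact I.zero_mem
      have h3 := hm2 ⟨_, hc⟩
      have e1 : ∑ i, (Pi.single i0 (a i1) - Pi.single i1 (a i0) : α → S) i * r i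
          = a i1 * r i0 - a i0 * r i1 := by
        simp only [Pi.sub_apply, sub_mul, Finset.sum_sub_distrib]
        congr 1
        · rw [Finset.sum_eq_single i0] <;> simp +contextual
        · rw [Finset.sum_eq_single i1] <;> simp +contextual
      have e2 : (Pi.single i0 (a i1) - Pi.single i1 (a i0) : α → S) i0 = a i1 := by
        simp [Pi.single_eq_of_ne hi.symm]
      simp only [e1, e2] at h3
      rw [prba] at h3
      have h4 := (Submodule.Quotient.mk_eq_zero _).1 h3.symm
      have := h1 (Pi.single i1 (r i0) - Pi.single i0 (r i1)) (by
        rw [map_sub, comb_single, comb_single]; convert h4 using 1; ring) i1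
      simpa [Pi.single_eq_of_ne hi] using this
  apply h𝔪
  rw [Ideal.eq_top_iff_one]
  have := 𝔪.add_mem A1 A2
  simpa using this
end A3
end BEI

namespace BEI
section A4
open MvPolynomial
open scoped Pointwise
variable {K : Type} [Field K] {σ : Type}

theorem framework {I : Ideal (MvPolynomial σ K)} (hFI : FI I)
    {α β : Type} [Fintype α] [Fintype β]
    (a : α → MvPolynomial σ K) (b : β → MvPolynomial σ K) (i0 : α) (j0 : β)
    (ev : MvPolynomial σ K →ₐ[K] K)
    (eva : ∀ i, ev (a i) = 0) (evb : ∀ j, ev (b j) = 0) (hab : ∀ i j, a i * b j ∈ I)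
    (Ta : α → (MvPolynomial σ K →ₐ[K] DualNumber K))
    (Taf : ∀ i f, (Ta i f).fst = ev f) (TaI : ∀ i, ∀ f ∈ I, Ta i f = 0)
    (Tai : ∀ i, Ta i (a i) = DualNumber.eps) (Tan : ∀ i j, i ≠ j → Ta i (a j) = 0)
    (Tb : β → (MvPolynomial σ K →ₐ[K] DualNumber K))
    (Tbf : ∀ i f, (Tb i f).fst = ev f) (TbI : ∀ i, ∀ f ∈ I, Tb i f = 0)
    (Tbi : ∀ i, Tb i (b i) = DualNumber.eps) (Tbn : ∀ i j, i ≠ j → Tb i (b j) = 0)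
    (ρ : MvPolynomial σ K →ₐ[K] (MvPolynomial σ K ⧸ I)) (ρI : ∀ f ∈ I, ρ f = 0)
    (ρa : ∀ i, ρ (a i) = 0) (ρb : ∀ j, ρ (b j) = Ideal.Quotient.mk I (b j))
    (ρX : ∀ v, ρ (X v) - Ideal.Quotient.mk I (X v) ∈
      Ideal.span (Set.range fun i => Ideal.Quotient.mk I (a i)))
    (ρY : ∀ v, ρ (X v) - algebraMap K _ (ev (X v)) ∈
      Ideal.span (Set.range fun i => Ideal.Quotient.mk I (b i)))
    (hcase : a i0 * a i0 ∈ I ∨ (∃ i1, i1 ≠ i0) ∨ ∃ j1, j1 ≠ j0) : False := by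
  classical
  have hX : ∀ f, ρ f - Ideal.Quotient.mk I f ∈
      Ideal.span (Set.range fun i => Ideal.Quotient.mk I (a i)) := by
    intro f
    have h : (Ideal.Quotient.mkₐ K (Ideal.span (Set.range fun i => Ideal.Quotient.mk I (a i)))).comp ρ
      = (Ideal.Quotient.mkₐ K _).comp (Ideal.Quotient.mkₐ K I) := by
      apply MvPolynomial.algHom_ext
      intro v
      exact Ideal.Quotient.eq.2 (ρX v)
    exact Ideal.Quotient.eq.1 (DFunLike.congr_fun h f)
  have hY : ∀ f, ρ f - algebraMap K _ (ev f) ∈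
      Ideal.span (Set.range fun i => Ideal.Quotient.mk I (b i)) := by
    intro f
    have h : (Ideal.Quotient.mkₐ K (Ideal.span (Set.range fun i => Ideal.Quotient.mk I (b i)))).comp ρ
      = (Ideal.Quotient.mkₐ K _).comp ((Algebra.ofId K _).comp ev) := by
      apply MvPolynomial.algHom_ext
      intro v
      exact Ideal.Quotient.eq.2 (ρY v)
    exact Ideal.Quotient.eq.1 (DFunLike.congr_fun h f)
  let 𝔪 : Ideal (MvPolynomial σ K) := RingHom.ker ev
  have mm : ∀ f, f ∈ 𝔪 ↔ ev f = 0 := fun f => Iff.rfl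
  have hmul : ∀ u ∈ Ideal.span (Set.range fun i => Ideal.Quotient.mk I (a i)),
      ∀ w ∈ Ideal.span (Set.range fun i => Ideal.Quotient.mk I (b i)), u * w = 0 := by
    intro u hu w hw
    have h1 := Ideal.mul_mem_mul hu hw
    rw [Ideal.span_mul_span'] at h1
    have h2 : Ideal.span ((Set.range fun i => Ideal.Quotient.mk I (a i)) *
      (Set.range fun i => Ideal.Quotient.mk I (b i))) ≤ ⊥ := by
      rw [Ideal.span_le]
      rintro _ ⟨_, ⟨i, rfl⟩, _, ⟨j, rfl⟩, rfl⟩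
      simp only [SetLike.mem_coe, Ideal.mem_bot]
      rw [← map_mul]
      exact Ideal.Quotient.eq_zero_iff_mem.2 (hab i j)
    simpa using h2 h1
  have hYm : ∀ f, ev f = 0 → ρ f ∈ Ideal.span (Set.range fun i => Ideal.Quotient.mk I (b i)) := by
    intro f hf
    have := hY f
    rwa [hf, map_zero, sub_zero] at this
  let prb : 𝔪 →ₗ[MvPolynomial σ K] MvPolynomial σ K ⧸ I :=
    { toFun := fun s => ρ s.1
      map_add' := fun s t => by simp
      map_smul' := fun r s => by
        have h1 := hmul _ (hX r) _ (hYm s.1 s.2)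
        rw [sub_mul, sub_eq_zero] at h1
        simp only [SetLike.val_smul, smul_eq_mul, map_mul, RingHom.id_apply]
        rw [h1]
        obtain ⟨t, ht⟩ := Ideal.Quotient.mk_surjective (ρ s.1)
        rw [← ht]
        rfl }
  let pra : 𝔪 →ₗ[MvPolynomial σ K] MvPolynomial σ K ⧸ I := I.mkQ ∘ₗ 𝔪.subtype - prb
  have hsp : ∀ (T : Set (MvPolynomial σ K ⧸ I)) u, u ∈ Ideal.span T →
      u ∈ Submodule.span (MvPolynomial σ K) T := by
    intro T u hu
    rw [← Submodule.restrictScalars_span (MvPolynomial σ K) (MvPolynomial σ K ⧸ I)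
      (Ideal.Quotient.mk_surjective)]
    exact hu
  have tang : ∀ {γ : Type} [Fintype γ] (c0 : γ → MvPolynomial σ K)
    (T : γ → (MvPolynomial σ K →ₐ[K] DualNumber K))
    (Tf : ∀ i f, (T i f).fst = ev f) (TI : ∀ i, ∀ f ∈ I, T i f = 0)
    (Ti : ∀ i, T i (c0 i) = DualNumber.eps) (Tn : ∀ i j, i ≠ j → T i (c0 j) = 0),
      ∀ c, comb c0 c ∈ I → ∀ i, c i ∈ 𝔪 := by
    intro γ _ c0 T Tf TI Ti Tn c hc i
    have h1 := TI i _ hc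
    rw [comb_apply, map_sum, Finset.sum_eq_single i] at h1
    · rw [map_mul, Ti] at h1
      have := congrArg TrivSqZeroExt.snd h1
      simp [Tf] at this
      exact this
    · intro j _ hj
      rw [map_mul, Tn i j hj.symm, mul_zero]
    · simp
  have p1 : ∀ s : 𝔪, s.1 ∈ I → pra s = 0 := by
    intro s hs
    change Ideal.Quotient.mk I s.1 - ρ s.1 = 0
    rw [ρI _ hs, Ideal.Quotient.eq_zero_iff_mem.2 hs, sub_zero]
  have p2 : ∀ s : 𝔪, s.1 ∈ I → prb s = 0 := by
    intro s hs
    exact ρI _ hs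
  have p3 : ∀ s, pra s ∈ Submodule.span (MvPolynomial σ K) (Set.range fun j => I.mkQ (a j)) := by
    intro s
    apply hsp
    have := Ideal.neg_mem_iff _ |>.2 (hX s.1)
    rw [neg_sub] at this
    exact this
  have p4 : ∀ s, prb s ∈ Submodule.span (MvPolynomial σ K) (Set.range fun j => I.mkQ (b j)) := by
    intro s
    exact hsp _ _ (hYm s.1 s.2)
  have p5 : ∀ j, pra ⟨a j, eva j⟩ = I.mkQ (a j) := by
    intro j
    change Ideal.Quotient.mk I (a j) - ρ (a j) = _
    rw [ρa, sub_zero]; rfl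
  have p6 : ∀ j, prb ⟨b j, evb j⟩ = I.mkQ (b j) := by
    intro j
    exact ρb j
  have p7 : ∀ j, prb ⟨a j, eva j⟩ = 0 := by
    intro j
    exact ρa j
  have p8 : ∀ j, pra ⟨b j, evb j⟩ = 0 := by
    intro j
    change Ideal.Quotient.mk I (b j) - ρ (b j) = _
    rw [ρb, sub_self]
  rcases hcase with hc | hc | hc
  · exact lemmaF (𝔪 := 𝔪) hFI (RingHom.ker_ne_top _) a b i0 j0 eva evb hab
      (tang a Ta Taf TaI Tai Tan) (tang b Tb Tbf TbI Tbi Tbn) pra prb p1 p2 p3 p4 p5 p6 p7 (Or.inl hc)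
  · exact lemmaF (𝔪 := 𝔪) hFI (RingHom.ker_ne_top _) a b i0 j0 eva evb hab
      (tang a Ta Taf TaI Tai Tan) (tang b Tb Tbf TbI Tbi Tbn) pra prb p1 p2 p3 p4 p5 p6 p7 (Or.inr hc)
  · exact lemmaF (𝔪 := 𝔪) hFI (RingHom.ker_ne_top _) b a j0 i0 evb eva
      (fun i j => by rw [mul_comm]; exact hab j i)
      (tang b Tb Tbf TbI Tbi Tbn) (tang a Ta Taf TaI Tai Tan) prb pra p2 p1 p4 p3 p6 p5 p8 (Or.inr hc)
end A4
end BEI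

namespace BEI
section B
open MvPolynomial
variable {K : Type} [Field K] {σ : Type}

noncomputable def grade (K : Type) [Field K] {σ : Type} (w : σ → ℕ) :
    MvPolynomial σ K →ₐ[K] Polynomial (MvPolynomial σ K) :=
  aeval fun v => Polynomial.C (X v) * Polynomial.X ^ (w v)

theorem grade_X (w : σ → ℕ) (v : σ) :
    grade K w (X v) = Polynomial.C (X v) * Polynomial.X ^ (w v) := by simp [grade]

theorem eval_grade (w : σ → ℕ) (f : MvPolynomial σ K) :
    Polynomial.eval 1 (grade K w f) = f := by
  have : ((Polynomial.aeval (R := MvPolynomial σ K) (1 : MvPolynomial σ K)).restrictScalars K).comp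
      (grade K w) = AlgHom.id K _ := by
    apply MvPolynomial.algHom_ext
    intro v
    simp [grade_X]
  have h := DFunLike.congr_fun this f
  simpa [Polynomial.aeval_def, Polynomial.eval₂_eq_eval_map] using h

/-- a variable of weight one minus one is a non-zero-divisor -/
theorem nzd_of_grade (w : σ → ℕ) (A : Set (MvPolynomial σ K)) (z : MvPolynomial σ K)
    (hA : ∀ g ∈ A, ∃ m, grade K w g = Polynomial.C g * Polynomial.X ^ m)
    (hz : grade K w z = Polynomial.C z * Polynomial.X) :
    ∀ f, (z - 1) * f ∈ Ideal.span A → f ∈ Ideal.span A := by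
  intro f hf
  have hI : ∀ g ∈ Ideal.span A, grade K w g ∈ (Ideal.span A).map Polynomial.C := by
    intro g hg
    have : Ideal.span A ≤ ((Ideal.span A).map Polynomial.C).comap (grade K w) := by
      rw [Ideal.span_le]
      intro g hg
      obtain ⟨m, hm⟩ := hA g hg
      simp only [SetLike.mem_coe, Ideal.mem_comap]
      rw [hm]
      exact Ideal.mul_mem_right _ _ (Ideal.mem_map_of_mem _ (Ideal.subset_span hg))
    exact this hg
  have h1 := hI _ hf
  rw [map_mul, map_sub, hz, map_one] at h1
  rw [Ideal.mem_map_C_iff] at h1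
  have h2 : ∀ n, (grade K w f).coeff n ∈ Ideal.span A := by
    intro n
    induction n with
    | zero =>
      have := h1 0
      simp [sub_mul, mul_assoc] at this
      simpa using this
    | succ n ih =>
      have := h1 (n + 1)
      rw [sub_mul, one_mul, mul_assoc, Polynomial.coeff_sub, Polynomial.coeff_C_mul,
        Polynomial.coeff_X_mul] at this
      have h3 := (Ideal.span A).sub_mem (Ideal.mul_mem_left _ z ih) this
      rwa [sub_sub_cancel] at h3
  rw [← eval_grade w f, Polynomial.eval_eq_sum]
  exact Ideal.sum_mem _ fun n _ => Ideal.mul_mem_right _ _ (h2 n)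

end B
section B2
open MvPolynomial
variable {K : Type} [Field K] {V : Type}

noncomputable def x (K : Type) [Field K] {V : Type} (v : V) : MvPolynomial (V ⊕ V) K := X (Sum.inl v)
noncomputable def y (K : Type) [Field K] {V : Type} (v : V) : MvPolynomial (V ⊕ V) K := X (Sum.inr v)

def edges (K : Type) [Field K] {V : Type} (G : SimpleGraph V) : Set (MvPolynomial (V ⊕ V) K) :=
  {f | ∃ i j, G.Adj i j ∧ f = x K i * y K j - x K j * y K i}

def gens (K : Type) [Field K] {V : Type} (G : SimpleGraph V) (W W1 : Set V) :
    Set (MvPolynomial (V ⊕ V) K) :=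
  edges K G ∪ {f | ∃ c ∈ W, f = x K c - 1} ∪ {f | ∃ c ∈ W1, f = y K c - 1}

/-- reachability inside a set -/
def RIn (G : SimpleGraph V) (A : Set V) : V → V → Prop :=
  Relation.ReflTransGen fun a b => G.Adj a b ∧ a ∈ A ∧ b ∈ A

theorem RIn.symm {G : SimpleGraph V} {A : Set V} {a b : V} (h : RIn G A a b) : RIn G A b a := by
  have : Std.Symm fun a b => G.Adj a b ∧ a ∈ A ∧ b ∈ A := ⟨fun a b h => ⟨h.1.symm, h.2.2, h.2.1⟩⟩
  exact Relation.ReflTransGen.stdSymm.symm _ _ h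

theorem RIn.mono {G : SimpleGraph V} {A B : Set V} (hAB : A ⊆ B) {a b : V} (h : RIn G A a b) :
    RIn G B a b :=
  Relation.ReflTransGen.mono (fun _ _ h => ⟨h.1, hAB h.2.1, hAB h.2.2⟩) _ _ h

variable {G : SimpleGraph V} {W W1 : Set V}

theorem edge_mem {A : Set (MvPolynomial (V ⊕ V) K)} (hA : edges K G ⊆ A) {i j : V}
    (h : G.Adj i j) : x K i * y K j - x K j * y K i ∈ Ideal.span A :=
  Ideal.subset_span (hA ⟨i, j, h, rfl⟩)

theorem FI_x (hV : Finite V) (h : FI (Ideal.span (edges K G))) (W : Set V) :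
    FI (Ideal.span (gens K G W ∅)) := by
  classical
  induction W, Set.toFinite W using Set.Finite.induction_on with
  | empty => simpa [gens] using h
  | @insert c W hc hW ih =>
    have e : gens K G (insert c W) ∅ = gens K G W ∅ ∪ {x K c - 1} := by
      ext f; simp only [gens, Set.mem_union, Set.mem_ofPred_eq, Set.mem_insert_iff,
        Set.mem_empty_iff_false, Set.mem_singleton_iff]
      constructor
      · rintro ((h | ⟨d, rfl | hd, rfl⟩) | ⟨d, hd, _⟩)
        · exact Or.inl (Or.inl (Or.inl h))
        · exact Or.inr rfl
        · exact Or.inl (Or.inl (Or.inr ⟨d, hd, rfl⟩))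
        · exact hd.elim
      · rintro (((h | ⟨d, hd, rfl⟩) | ⟨d, hd, _⟩) | rfl)
        · exact Or.inl (Or.inl h)
        · exact Or.inl (Or.inr ⟨d, Or.inr hd, rfl⟩)
        · exact hd.elim
        · exact Or.inl (Or.inr ⟨c, Or.inl rfl, rfl⟩)
    rw [e, Ideal.span_union]
    refine FI.mod ih (nzd_of_grade (fun v => v.elim (fun i => if i = c then 1 else 0)
      (fun i => if i = c then 1 else 0)) _ _ ?_ ?_)
    · rintro g ((⟨i, j, hij, rfl⟩ | ⟨d, hd, rfl⟩) | ⟨d, hd, _⟩)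
      · refine ⟨(if i = c then 1 else 0) + (if j = c then 1 else 0), ?_⟩
        simp only [x, y, map_sub, map_mul, grade_X, Sum.elim_inl, Sum.elim_inr, pow_add]
        ring
      · refine ⟨0, ?_⟩
        have : d ≠ c := by rintro rfl; exact hc hd
        simp [x, grade_X, this]
      · exact hd.elim
    · simp [x, grade_X]

theorem FI_y (hV : Finite V) (h : FI (Ideal.span (edges K G))) (W W1 : Set V) (hW : W1 ⊆ W)
    (hr : ∀ c ∈ W1, ∀ d ∈ W1, RIn G Set.univ c d → RIn G W1 c d) :
    FI (Ideal.span (gens K G W W1)) := by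
  classical
  suffices H : ∀ s : Set V, s ⊆ W1 →
      FI (Ideal.span (gens K G W {c | c ∈ W1 ∧ ∃ d ∈ s, RIn G Set.univ d c})) by
    have := H W1 subset_rfl
    convert this using 4
    ext c
    exact ⟨fun hc => ⟨hc, c, hc, Relation.ReflTransGen.refl⟩, fun hc => hc.1⟩
  intro s
  induction s, Set.toFinite s using Set.Finite.induction_on with
  | empty => 
    intro _
    have := FI_x hV h W
    simpa using this
  | @insert w s hw hs ih =>
    intro hsW
    have ih := ih ((Set.subset_insert _ _).trans hsW)
    have hwW : w ∈ W1 := hsW (Set.mem_insert _ _)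
    by_cases hex : ∃ d ∈ s, RIn G Set.univ d w
    · convert ih using 4
      ext c
      constructor
      · rintro ⟨hc, d, rfl | hd, hdc⟩
        · obtain ⟨e, he, hed⟩ := hex
          exact ⟨hc, e, he, hed.trans hdc⟩
        · exact ⟨hc, d, hd, hdc⟩
      · rintro ⟨hc, d, hd, hdc⟩
        exact ⟨hc, d, Or.inr hd, hdc⟩
    · set U := {c | c ∈ W1 ∧ ∃ d ∈ s, RIn G Set.univ d c} with hU
      have e : Ideal.span (gens K G W {c | c ∈ W1 ∧ ∃ d ∈ insert w s, RIn G Set.univ d c}) =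
          Ideal.span (gens K G W U) ⊔ Ideal.span {y K w - 1} := by
        apply le_antisymm
        · rw [Ideal.span_le]
          rintro g ((hg | hg) | ⟨d, ⟨hd, e, he, hed⟩, rfl⟩)
          · exact Ideal.mem_sup_left (Ideal.subset_span (Or.inl (Or.inl hg)))
          · exact Ideal.mem_sup_left (Ideal.subset_span (Or.inl (Or.inr hg)))
          · rcases he with rfl | he
            · have h1 := hr e hwW d hd hed
              clear hed
              simp only [SetLike.mem_coe]
              induction h1 with
              | refl => exact Ideal.mem_sup_right (Ideal.mem_span_singleton_self _)
              | @tail b c hb hbc ih =>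
                have i1 := ih hbc.2.1
                have i2 : x K b * y K c - x K c * y K b ∈ Ideal.span (gens K G W U) :=
                  edge_mem (fun g hg => Or.inl (Or.inl hg)) hbc.1
                have i3 : x K b - 1 ∈ Ideal.span (gens K G W U) :=
                  Ideal.subset_span (Or.inl (Or.inr ⟨b, hW hbc.2.1, rfl⟩))
                have i4 : x K c - 1 ∈ Ideal.span (gens K G W U) :=
                  Ideal.subset_span (Or.inl (Or.inr ⟨c, hW hbc.2.2, rfl⟩))
                have : y K c - 1 = (y K b - 1) + ((x K b * y K c - x K c * y K b)
                  - y K c * (x K b - 1) + y K b * (x K c - 1)) := by ring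
                rw [this]
                refine Ideal.add_mem _ i1 (Ideal.mem_sup_left ?_)
                exact Ideal.add_mem _ (Ideal.sub_mem _ i2 (Ideal.mul_mem_left _ _ i3))
                  (Ideal.mul_mem_left _ _ i4)
            · exact Ideal.mem_sup_left (Ideal.subset_span (Or.inr ⟨d, ⟨hd, e, he, hed⟩, rfl⟩))
        · rw [← Ideal.span_union]
          apply Ideal.span_mono
          rintro g (((hg | hg) | ⟨d, ⟨hd, e, he, hed⟩, rfl⟩) | rfl)
          · exact Or.inl (Or.inl hg)
          · exact Or.inl (Or.inr hg)
          · exact Or.inr ⟨d, ⟨hd, e, Or.inr he, hed⟩, rfl⟩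
          · exact Or.inr ⟨w, ⟨hwW, w, Or.inl rfl, Relation.ReflTransGen.refl⟩, rfl⟩
      rw [e]
      refine FI.mod ih (nzd_of_grade (fun v => v.elim (fun i => 0)
        (fun i => if RIn G Set.univ w i then 1 else 0)) _ _ ?_ ?_)
      · rintro g ((⟨i, j, hij, rfl⟩ | ⟨d, hd, rfl⟩) | ⟨d, ⟨hd, e, he, hed⟩, rfl⟩)
        · refine ⟨(if RIn G Set.univ w i then 1 else 0), ?_⟩
          have : RIn G Set.univ w i ↔ RIn G Set.univ w j :=
            ⟨fun h => h.tail ⟨hij, trivial, trivial⟩, fun h => h.tail ⟨hij.symm, trivial, trivial⟩⟩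
          simp only [x, y, map_sub, map_mul, grade_X, Sum.elim_inl, Sum.elim_inr, pow_zero, this]
          ring
        · exact ⟨0, by simp [x, grade_X]⟩
        · have : ¬ RIn G Set.univ w d := fun h => hex ⟨e, he, hed.trans h.symm⟩
          exact ⟨0, by simp [y, grade_X, this]⟩
      · have : RIn G Set.univ w w := Relation.ReflTransGen.refl
        simp [y, grade_X, this]

end B2
end BEI

namespace BEI
section M
open MvPolynomial
variable {K : Type} [Field K] {V : Type} {G : SimpleGraph V}

theorem kill_gens {D : Type} [CommRing D] [Algebra K D] (φ : MvPolynomial (V ⊕ V) K →ₐ[K] D)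
    {W W1 : Set V} (he : ∀ i j, G.Adj i j → φ (x K i) * φ (y K j) = φ (x K j) * φ (y K i))
    (hx : ∀ c ∈ W, φ (x K c) = 1) (hy : ∀ c ∈ W1, φ (y K c) = 1) :
    ∀ f ∈ Ideal.span (gens K G W W1), φ f = 0 := by
  intro f hf
  have : Ideal.span (gens K G W W1) ≤ RingHom.ker φ := by
    rw [Ideal.span_le]
    rintro g ((⟨i, j, hij, rfl⟩ | ⟨d, hd, rfl⟩) | ⟨d, hd, rfl⟩)
    · simp [RingHom.mem_ker, he i j hij]
    · simp [RingHom.mem_ker, hx d hd]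
    · simp [RingHom.mem_ker, hy d hd]
  exact this hf

theorem kill_sup {D : Type} [CommRing D] [Algebra K D] (φ : MvPolynomial (V ⊕ V) K →ₐ[K] D)
    {I : Ideal (MvPolynomial (V ⊕ V) K)} {g : MvPolynomial (V ⊕ V) K}
    (h : ∀ f ∈ I, φ f = 0) (hg : φ g = 0) : ∀ f ∈ I ⊔ Ideal.span {g}, φ f = 0 := by
  intro f hf
  obtain ⟨b, hb, c, rfl⟩ := mem_sup_span hf
  simp [h b hb, hg]

theorem RIn.mem {A : Set V} {a b : V} (h : RIn G A a b) (ha : a ∈ A) : b ∈ A := by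
  induction h with
  | refl => exact ha
  | tail _ h _ => exact h.2.2

theorem fst_aeval (p : (V ⊕ V) → DualNumber K) (q : (V ⊕ V) → K)
    (h : ∀ v, (p v).fst = q v) (f : MvPolynomial (V ⊕ V) K) : (aeval p f).fst = aeval q f := by
  have : (TrivSqZeroExt.fstHom K K K).comp (aeval p) = aeval q := by
    apply MvPolynomial.algHom_ext
    intro v
    simp [h]
  exact DFunLike.congr_fun this f

theorem lemmaM [Fintype V] (T A0 A : Set V) (hTA0 : ∀ v ∈ T, v ∉ A0) (hTA : ∀ v ∈ T, v ∉ A)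
    (hA0A : ∀ v ∈ A0, v ∉ A) (hA : ∀ i j, G.Adj i j → i ∈ A → j ∈ A ∨ j ∈ T)
    (hA0 : ∀ i j, G.Adj i j → i ∈ A0 → j ∈ A0 ∨ j ∈ T) (w0 : V) (hw0 : w0 ∈ A0)
    (hA0c : ∀ c ∈ A0, RIn G A0 w0 c) (hTA0' : ∀ t ∈ T, ∃ c ∈ A0, G.Adj t c)
    (hTA' : ∀ t ∈ T, ∀ c ∈ A, ∃ c', RIn G A c c' ∧ G.Adj t c') (u : V) (hu : u ∈ T) (c0 : V)
    (hc0 : c0 ∈ A) (κ : K)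
    (hFI : FI (Ideal.span (gens K G Tᶜ (T ∪ A0 ∪ A)ᶜ) ⊔
      Ideal.span {y K w0 - 1 - C κ * x K u}))
    (hcase : (∃ t ∈ T, t ≠ u) ∨ ∃ c1 ∈ A, ¬ RIn G A c0 c1) : False := by
  classical
  set F := Ideal.span (gens K G Tᶜ (T ∪ A0 ∪ A)ᶜ) ⊔ Ideal.span {y K w0 - 1 - C κ * x K u} with hF
  let q := Ideal.Quotient.mk F
  have q0 : ∀ {f}, f ∈ F → q f = 0 := fun h => Ideal.Quotient.eq_zero_iff_mem.2 h
  have qe : ∀ {i j}, G.Adj i j → q (x K i) * q (y K j) = q (x K j) * q (y K i) := by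
    intro i j h
    rw [← sub_eq_zero, ← map_mul, ← map_mul, ← map_sub]
    exact q0 (Ideal.mem_sup_left (edge_mem (fun g hg => Or.inl (Or.inl hg)) h))
  have qx : ∀ {c}, c ∉ T → q (x K c) = 1 := by
    intro c h
    rw [← sub_eq_zero, ← map_one q, ← map_sub]
    exact q0 (Ideal.mem_sup_left (Ideal.subset_span (Or.inl (Or.inr ⟨c, h, rfl⟩))))
  have qy : ∀ {c}, c ∉ T → c ∉ A0 → c ∉ A → q (y K c) = 1 := by
    intro c h h' h''
    rw [← sub_eq_zero, ← map_one q, ← map_sub]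
    exact q0 (Ideal.mem_sup_left (Ideal.subset_span (Or.inr ⟨c, by simp [h, h', h''], rfl⟩)))
  let s : MvPolynomial (V ⊕ V) K := C κ * x K u
  have hAT : ∀ v ∈ A, v ∉ T := fun v h h' => hTA v h' h
  have hA0T : ∀ v ∈ A0, v ∉ T := fun v h h' => hTA0 v h' h
  have qadj : ∀ {i j}, G.Adj i j → i ∉ T → j ∉ T → q (y K i) = q (y K j) := by
    intro i j h hi hj
    have := qe h
    rw [qx hi, qx hj, one_mul, one_mul] at this
    exact this.symm
  have qR : ∀ (B : Set V), (∀ v ∈ B, v ∉ T) → ∀ {c d}, RIn G B c d → q (y K c) = q (y K d) := by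
    intro B hB c d h
    induction h with
    | refl => rfl
    | tail _ h ih => rw [ih]; exact qadj h.1 (hB _ h.2.1) (hB _ h.2.2)
  have qw : q (y K w0) = 1 + q s := by
    have : q (y K w0 - 1 - s) = 0 :=
      q0 (Ideal.mem_sup_right (Ideal.mem_span_singleton_self _))
    rw [map_sub, map_sub, map_one] at this
    linear_combination this
  have qA0 : ∀ {c}, c ∈ A0 → q (y K c) = 1 + q s := by
    intro c hc
    rw [← qw]
    exact (qR A0 hA0T (hA0c c hc)).symm
  have qT : ∀ {t}, t ∈ T → q (y K t) = q (x K t) * (1 + q s) := by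
    intro t ht
    obtain ⟨c, hc, h⟩ := hTA0' t ht
    have := qe h
    rw [qx (hA0T c hc), qA0 hc, one_mul] at this
    exact this.symm
  have W1e : ∀ {i j}, G.Adj i j → i ∉ T → i ∉ A0 → i ∉ A → j ∈ T ∨ (j ∉ T ∧ j ∉ A0 ∧ j ∉ A) := by
    intro i j h h1 h2 h3
    by_cases hj : j ∈ T
    · exact Or.inl hj
    · refine Or.inr ⟨hj, fun h4 => ?_, fun h4 => ?_⟩
      · rcases hA0 _ _ h.symm h4 with h5 | h5
        · exact h2 h5
        · exact h1 h5
      · rcases hA _ _ h.symm h4 with h5 | h5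
        · exact h3 h5
        · exact h1 h5
  -- representatives
  let st : Setoid V := ⟨RIn G A, ⟨fun _ => Relation.ReflTransGen.refl, fun h => h.symm,
    fun h h' => h.trans h'⟩⟩
  let rep : V → V := fun c => (Quotient.mk st c).out
  have hrep : ∀ c, RIn G A c (rep c) := fun c => (Quotient.mk_out (s := st) c).symm
  have hrep2 : ∀ {c d}, RIn G A c d → rep c = rep d := fun {c d} h => by
    have : Quotient.mk st c = Quotient.mk st d := Quotient.sound h
    simp only [rep, this]
  let β := {c : V // c ∈ A ∧ rep c = c}
  let mkβ : ∀ c, c ∈ A → β := fun c hc => ⟨rep c, (hrep c).mem hc, (hrep2 (hrep c)).symm⟩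
  let a : T → MvPolynomial (V ⊕ V) K := fun t => x K t.1
  let b : β → MvPolynomial (V ⊕ V) K := fun c => y K c.1 - 1 - s
  let ev : MvPolynomial (V ⊕ V) K →ₐ[K] K := aeval (Sum.elim (fun c => if c ∈ T then 0 else 1)
    (fun c => if c ∈ T then 0 else 1))
  let Ta : T → (MvPolynomial (V ⊕ V) K →ₐ[K] DualNumber K) := fun t => aeval (Sum.elim
    (fun c => if c = t then DualNumber.eps else if c ∈ T then 0 else 1)
    (fun c => if c = t then DualNumber.eps else if c ∈ T then 0 else
      if (c ∈ A ∨ c ∈ A0) ∧ u = t then 1 + algebraMap K _ κ * DualNumber.eps else 1))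
  let Tb : β → (MvPolynomial (V ⊕ V) K →ₐ[K] DualNumber K) := fun t => aeval (Sum.elim
    (fun c => if c ∈ T then 0 else 1)
    (fun c => if c ∈ T then 0 else if c ∈ A ∧ rep c = t.1 then 1 + DualNumber.eps else 1))
  let ρ : MvPolynomial (V ⊕ V) K →ₐ[K] (MvPolynomial (V ⊕ V) K ⧸ F) := aeval (Sum.elim
    (fun c => if c ∈ T then 0 else 1)
    (fun c => if c ∈ T then 0 else if c ∈ A ∨ c ∈ A0 then q (y K c) - q s else 1))
  have ρx : ∀ c, ρ (x K c) = if c ∈ T then 0 else 1 := fun c => by simp [ρ, x]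
  have ρy : ∀ c, ρ (y K c) = if c ∈ T then 0 else if c ∈ A ∨ c ∈ A0 then q (y K c) - q s else 1 :=
    fun c => by simp [ρ, y]
  have Tax : ∀ t c, Ta t (x K c) = if c = t then DualNumber.eps else if c ∈ T then 0 else 1 :=
    fun t c => by simp [Ta, x]
  have Tay : ∀ t c, Ta t (y K c) = if c = t then DualNumber.eps else if c ∈ T then 0 else
      if (c ∈ A ∨ c ∈ A0) ∧ u = t then 1 + algebraMap K _ κ * DualNumber.eps else 1 :=
    fun t c => by simp [Ta, y]
  have Tbx : ∀ t c, Tb t (x K c) = if c ∈ T then 0 else 1 := fun t c => by simp [Tb, x]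
  have Tby : ∀ t c, Tb t (y K c) = if c ∈ T then 0 else if c ∈ A ∧ rep c = t.1 then
    1 + DualNumber.eps else 1 := fun t c => by simp [Tb, y]
  have evx : ∀ c, ev (x K c) = if c ∈ T then 0 else 1 := fun c => by simp [ev, x]
  have evy : ∀ c, ev (y K c) = if c ∈ T then 0 else 1 := fun c => by simp [ev, y]
  have ee : (DualNumber.eps : DualNumber K) * DualNumber.eps = 0 := DualNumber.eps_mul_eps
  have hkA : ∀ {c}, c ∈ A → (c ∉ T ∧ c ∉ A0) := fun {c} h =>
    ⟨hAT c h, fun h' => hA0A c h' h⟩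
  have Cκ : ∀ {D : Type} [CommRing D] [Algebra K D] (φ : MvPolynomial (V ⊕ V) K →ₐ[K] D),
      φ (C κ) = algebraMap K D κ := fun φ => by
    rw [← MvPolynomial.algebraMap_eq]; exact φ.commutes κ
  have evs : ev s = 0 := by simp [s, evx, hu]
  have clsf : ∀ {i j}, G.Adj i j → i ∉ T → j ∉ T → ((i ∈ A ∨ i ∈ A0) ↔ (j ∈ A ∨ j ∈ A0)) := by
    intro i j h hi hj
    constructor
    · rintro (h1 | h1)
      · exact Or.inl ((hA _ _ h h1).resolve_right hj)
      · exact Or.inr ((hA0 _ _ h h1).resolve_right hj)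
    · rintro (h1 | h1)
      · exact Or.inl ((hA _ _ h.symm h1).resolve_right hi)
      · exact Or.inr ((hA0 _ _ h.symm h1).resolve_right hi)
  have clsA : ∀ {i j}, G.Adj i j → i ∉ T → j ∉ T → ((i ∈ A) ↔ (j ∈ A)) := by
    intro i j h hi hj
    exact ⟨fun h1 => (hA _ _ h h1).resolve_right hj,
      fun h1 => (hA _ _ h.symm h1).resolve_right hi⟩
  refine framework hFI a b ⟨u, hu⟩ (mkβ c0 hc0) ev ?_ ?_ ?_ Ta ?_ ?_ ?_ ?_ Tb ?_ ?_ ?_ ?_ ρ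
    ?_ ?_ ?_ ?_ ?_ ?_
  · intro t; simp [a, evx]
  · intro c; simp [b, evy, evs, hAT c.1 c.2.1]
  · intro t c
    obtain ⟨c', hc', hadj⟩ := hTA' t.1 t.2 c.1 c.2.1
    apply Ideal.Quotient.eq_zero_iff_mem.1
    change q (x K t.1 * (y K c.1 - 1 - s)) = 0
    have h1 := qe hadj
    rw [qx (hAT c' (hc'.mem c.2.1)), qT t.2, ← qR A hAT hc'] at h1
    simp only [map_mul, map_sub, map_one]
    linear_combination h1
  · intro t f
    apply fst_aeval
    rintro (c | c)
    · by_cases h1 : c = t.1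
      · simp [h1]
      · by_cases h2 : c ∈ T <;> simp [h1, h2]
    · by_cases h1 : c = t.1
      · simp [h1]
      · by_cases h2 : c ∈ T
        · simp [h1, h2]
        · by_cases h3 : (c ∈ A ∨ c ∈ A0) ∧ u = t.1 <;> simp only [Sum.elim_inr, h1, h2, h3, if_true, if_false] <;> simp
  · intro t
    apply kill_sup
    · apply kill_gens
      · intro i j hij
        simp only [Tax, Tay]
        by_cases hi : i ∈ T
        · by_cases hj : j ∈ T
          · split_ifs <;> simp [ee]
          · have hj' : j ≠ t.1 := fun h => hj (h ▸ t.2)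
            simp only [hi, hj, hj', if_true, if_false]
            split_ifs <;> simp [mul_add, mul_comm, ← mul_assoc, ee]
        · have hi' : i ≠ t.1 := fun h => hi (h ▸ t.2)
          by_cases hj : j ∈ T
          · simp only [hi, hj, hi', if_true, if_false]
            split_ifs <;> simp [mul_add, mul_comm, ← mul_assoc, ee]
          · have hj' : j ≠ t.1 := fun h => hj (h ▸ t.2)
            simp only [hi, hi', hj, hj', if_false, clsf hij hi hj]
      · intro c hc
        have : c ≠ t.1 := fun h => hc (h ▸ t.2)
        simp only [Tax]
        rw [if_neg this, if_neg hc]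
      · intro c hc
        simp only [Set.mem_compl_iff, Set.mem_union, not_or] at hc
        have : c ≠ t.1 := fun h => hc.1.1 (h ▸ t.2)
        simp [Tay, this, hc.1.1, hc.2, hc.1.2]
    · have h1 : w0 ∉ T := hA0T _ hw0
      have h2 : w0 ≠ t.1 := fun h => h1 (h ▸ t.2)
      simp only [map_sub, map_mul, map_one, Cκ, Tax, Tay, h1, h2, hw0, hu]
      by_cases h3 : u = t.1 <;> simp [h3]
  · intro t; simp [a, Tax]
  · intro t t' h
    have : t'.1 ≠ t.1 := fun h' => h (Subtype.ext h'.symm)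
    simp only [a, Tax]
    rw [if_neg this, if_pos t'.2]
  · intro t f
    apply fst_aeval
    rintro (c | c)
    · by_cases h2 : c ∈ T <;> simp [h2]
    · by_cases h2 : c ∈ T
      · simp [h2]
      · by_cases h3 : c ∈ A ∧ rep c = t.1 <;> simp only [Sum.elim_inr, h2, h3, if_true, if_false] <;> simp
  · intro t
    apply kill_sup
    · apply kill_gens
      · intro i j hij
        simp only [Tbx, Tby]
        by_cases hi : i ∈ T
        · by_cases hj : j ∈ T <;> simp [hi, hj]
        · by_cases hj : j ∈ T
          · simp [hi, hj]
          · simp only [hi, hj, if_false]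
            by_cases hiA : i ∈ A
            · have hjA : j ∈ A := (clsA hij hi hj).1 hiA
              have : rep i = rep j := hrep2 (Relation.ReflTransGen.single ⟨hij, hiA, hjA⟩)
              simp only [hiA, hjA, this]
            · have hjA : j ∉ A := fun h => hiA ((clsA hij hi hj).2 h)
              simp only [hiA, hjA, false_and]
      · intro c hc
        simp only [Tbx]
        rw [if_neg hc]
      · intro c hc
        simp only [Set.mem_compl_iff, Set.mem_union, not_or] at hc
        simp [Tby, hc.1.1, hc.2, hc.1.2]
    · have h1 : w0 ∉ T := hA0T _ hw0
      have h2 : w0 ∉ A := hA0A _ hw0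
      simp [Tbx, Tby, h1, h2, hu]
  · intro c
    simp only [b, map_sub, map_one, Tby, s, map_mul, Tbx, hu, hAT c.1 c.2.1, c.2]
    simp
  · intro c c' h
    have h1 : c'.1 ≠ c.1 := fun h' => h (Subtype.ext h'.symm)
    simp only [b, map_sub, map_one, Tby, s, map_mul, Tbx, hu, hAT c'.1 c'.2.1, c'.2, h1]
    simp
  · apply kill_sup
    · apply kill_gens
      · intro i j hij
        simp only [ρx, ρy]
        by_cases hi : i ∈ T
        · by_cases hj : j ∈ T <;> simp [hi, hj]
        · by_cases hj : j ∈ T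
          · simp [hi, hj]
          · simp only [hi, hj, if_false, clsf hij hi hj, qadj hij hi hj]
      · intro c hc
        rw [ρx, if_neg hc]
      · intro c hc
        simp only [Set.mem_compl_iff, Set.mem_union, not_or] at hc
        simp [ρy, hc.1.1, hc.2, hc.1.2]
    · have h1 : w0 ∉ T := hA0T _ hw0
      simp [ρx, ρy, h1, hw0, hu, qw]
  · intro t
    simp [a, ρx]
  · intro c
    have h1 : c.1 ∉ T := hAT _ c.2.1
    change _ = q _
    simp only [b, map_sub, map_mul, map_one, ρx, ρy, s, h1, c.2.1, hu, if_true, if_false, true_or]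
    simp only [mul_zero]
    ring
  · have hsp : ∀ t : T, q (x K t.1) ∈ Ideal.span (Set.range fun i => Ideal.Quotient.mk F (a i)) :=
      fun t => Ideal.subset_span ⟨t, rfl⟩
    rintro (c | c)
    · change ρ (x K c) - q (x K c) ∈ _
      rw [ρx]
      by_cases h : c ∈ T
      · rw [if_pos h, zero_sub, neg_mem_iff]
        exact hsp ⟨c, h⟩
      · rw [if_neg h, qx h, sub_self]; exact zero_mem _
    · change ρ (y K c) - q (y K c) ∈ _
      rw [ρy]
      by_cases h : c ∈ T
      · rw [if_pos h, zero_sub, neg_mem_iff, qT h]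
        exact Ideal.mul_mem_right _ _ (hsp ⟨c, h⟩)
      · rw [if_neg h]
        by_cases h2 : c ∈ A ∨ c ∈ A0
        · rw [if_pos h2]
          have : q (y K c) - q s - q (y K c) = - (q (C κ) * q (x K u)) := by
            simp only [s, map_mul]; ring
          rw [this, neg_mem_iff]
          exact Ideal.mul_mem_left _ _ (hsp ⟨u, hu⟩)
        · rw [if_neg h2, qy h (fun h3 => h2 (Or.inr h3)) (fun h3 => h2 (Or.inl h3)), sub_self]
          exact zero_mem _
  · rintro (c | c)
    · change ρ (x K c) - algebraMap K _ (ev (x K c)) ∈ _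
      rw [ρx, evx]
      by_cases h : c ∈ T <;> simp [h]
    · change ρ (y K c) - algebraMap K _ (ev (y K c)) ∈ _
      rw [ρy, evy]
      by_cases h : c ∈ T
      · simp [h]
      · by_cases h2 : c ∈ A
        · simp only [h, h2, if_false, true_or, if_true, map_one]
          refine Ideal.subset_span ⟨mkβ c h2, ?_⟩
          change q (y K (rep c) - 1 - s) = _
          simp only [map_sub, map_one]
          rw [qR A hAT (hrep c)]; ring
        · by_cases h3 : c ∈ A0
          · simp [h, h2, h3, qA0]
          · simp [h, h2, h3]
  · right
    rcases hcase with ⟨t, ht, htu⟩ | ⟨c1, hc1, h⟩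
    · exact Or.inl ⟨⟨t, ht⟩, fun h => htu (congrArg Subtype.val h)⟩
    · refine Or.inr ⟨mkβ c1 hc1, fun h' => h ?_⟩
      have : rep c1 = rep c0 := congrArg Subtype.val h'
      exact (hrep c0).trans (this ▸ (hrep c1).symm)
end M
end BEI

namespace BEI
section M2
open MvPolynomial
variable {K : Type} [Field K] {V : Type} {G : SimpleGraph V}

theorem algHom_congr_mod {R : Type} [CommRing R] [Algebra K R] {σ : Type} (I : Ideal R)
    (φ ψ : MvPolynomial σ K →ₐ[K] R) (h : ∀ v, φ (X v) - ψ (X v) ∈ I) (f : MvPolynomial σ K) :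
    φ f - ψ f ∈ I := by
  have : (Ideal.Quotient.mkₐ K I).comp φ = (Ideal.Quotient.mkₐ K I).comp ψ := by
    apply MvPolynomial.algHom_ext
    intro v
    exact Ideal.Quotient.eq.2 (h v)
  exact Ideal.Quotient.eq.1 (DFunLike.congr_fun this f)

theorem nzd_ii (T A0 A : Set V) (hTA0 : ∀ v ∈ T, v ∉ A0) (hTA : ∀ v ∈ T, v ∉ A)
    (hA : ∀ i j, G.Adj i j → i ∈ A → j ∈ A ∨ j ∈ T)
    (hA0 : ∀ i j, G.Adj i j → i ∈ A0 → j ∈ A0 ∨ j ∈ T) (w0 : V) (hw0 : w0 ∈ A0)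
    (u : V) (hu : u ∈ T) (hT : ∀ i j, G.Adj i j → i ∈ T → i ≠ u → j ∈ T ∪ A0 ∪ A)
    (hadj : ∀ v ∈ T ∪ A0 ∪ A, v ≠ u → G.Adj u v) (h2 : V) (hh2 : h2 ∉ T ∪ A0 ∪ A)
    (hh2u : G.Adj u h2) : ∀ f, (y K w0 - 1 - C 1 * x K u) * f ∈
      Ideal.span (gens K G Tᶜ (T ∪ A0 ∪ A)ᶜ) → f ∈ Ideal.span (gens K G Tᶜ (T ∪ A0 ∪ A)ᶜ) := by
  classical
  intro f hf
  rw [C_1, one_mul] at hf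
  set I := Ideal.span (gens K G Tᶜ (T ∪ A0 ∪ A)ᶜ) with hI
  have ie : ∀ {i j}, G.Adj i j → x K i * y K j - x K j * y K i ∈ I := fun h =>
    edge_mem (fun g hg => Or.inl (Or.inl hg)) h
  have ix : ∀ {c}, c ∉ T → x K c - 1 ∈ I := fun {c} h =>
    Ideal.subset_span (Or.inl (Or.inr ⟨c, h, rfl⟩))
  have iy : ∀ {c}, c ∉ T ∪ A0 ∪ A → y K c - 1 ∈ I := fun {c} h =>
    Ideal.subset_span (Or.inr ⟨c, h, rfl⟩)
  have hw0T : w0 ∉ T := fun h => hTA0 _ h hw0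
  have hw0u : w0 ≠ u := fun h => hw0T (h ▸ hu)
  have hh2T : h2 ∉ T := fun h => hh2 (Or.inl (Or.inl h))
  have uy : x K u - y K u ∈ I := by
    have : x K u - y K u = (x K u * y K h2 - x K h2 * y K u) - x K u * (y K h2 - 1) +
      y K u * (x K h2 - 1) := by ring
    rw [this]
    exact I.add_mem (I.sub_mem (ie hh2u) (I.mul_mem_left _ (iy hh2))) (I.mul_mem_left _ (ix hh2T))
  have uc : ∀ c, c ∉ T → G.Adj u c → x K u * (y K c - 1) ∈ I := by
    intro c hc h
    have : x K u * (y K c - 1) = (x K u * y K c - x K c * y K u) + y K u * (x K c - 1)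
      - (x K u - y K u) := by ring
    rw [this]
    exact I.sub_mem (I.add_mem (ie h) (I.mul_mem_left _ (ix hc))) uy
  have uδ : x K u * (y K w0 - 1) ∈ I := uc w0 hw0T (hadj w0 (Or.inl (Or.inr hw0)) hw0u)
  have xiny : ∀ f ∈ Ideal.span {x K u, y K u}, (y K w0 - 1) * f ∈ I := by
    intro f hf
    obtain ⟨a, b, rfl⟩ := Ideal.mem_span_pair.1 hf
    have : (y K w0 - 1) * (a * x K u + b * y K u) = (a + b) * (x K u * (y K w0 - 1))
      - b * (y K w0 - 1) * (x K u - y K u) := by ring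
    rw [this]
    exact I.sub_mem (I.mul_mem_left _ uδ) (I.mul_mem_left _ uy)
  -- step 1
  let ρ : MvPolynomial (V ⊕ V) K →ₐ[K] MvPolynomial (V ⊕ V) K := aeval
    (Sum.elim (fun c => if c = u then 0 else x K c) (fun c => if c = u then 0 else y K c))
  have ρx : ∀ c, ρ (x K c) = if c = u then 0 else x K c := fun c => by simp [ρ, x]
  have ρy : ∀ c, ρ (y K c) = if c = u then 0 else y K c := fun c => by simp [ρ, y]
  have ρI : ∀ g ∈ I, ρ g ∈ I := by
    intro g hg
    have := kill_gens (G := G) (W := Tᶜ) (W1 := (T ∪ A0 ∪ A)ᶜ) ((Ideal.Quotient.mkₐ K I).comp ρ)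
      (fun i j hij => by
        simp only [AlgHom.comp_apply, ρx, ρy]
        by_cases hi : i = u
        · simp [hi]
        · by_cases hj : j = u
          · simp [hj]
          · simp only [hi, hj, if_false]
            rw [← map_mul, ← map_mul]
            exact Ideal.Quotient.eq.2 (ie hij))
      (fun c hc => by
        have : c ≠ u := fun h => hc (h ▸ hu)
        simp only [AlgHom.comp_apply, ρx, this, if_false]
        exact Ideal.Quotient.eq.2 (ix hc))
      (fun c hc => by
        have : c ≠ u := fun h => hc (Or.inl (Or.inl (h ▸ hu)))
        simp only [AlgHom.comp_apply, ρy, this, if_false]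
        exact Ideal.Quotient.eq.2 (iy hc)) g hg
    exact Ideal.Quotient.eq_zero_iff_mem.1 this
  have ρf : ∀ g, g - ρ g ∈ Ideal.span {x K u, y K u} := by
    intro g
    refine algHom_congr_mod _ (AlgHom.id K _) ρ ?_ g
    rintro (c | c)
    · change x K c - ρ (x K c) ∈ _
      rw [ρx]
      by_cases h : c = u
      · subst h; simp only [if_true, sub_zero]; exact Ideal.subset_span (by simp)
      · simp [h]
    · change y K c - ρ (y K c) ∈ _
      rw [ρy]
      by_cases h : c = u
      · subst h; simp only [if_true, sub_zero]; exact Ideal.subset_span (by simp)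
      · simp [h]
  have s1 : (y K w0 - 1) * f ∈ I := by
    have h1 := ρI _ hf
    simp only [map_mul, map_sub, map_one, ρx, ρy, if_true, sub_zero, hw0u, if_false] at h1
    have h3 := I.add_mem h1 (xiny _ (ρf f))
    convert h3 using 1; ring
  have s1' : x K u * f ∈ I := by
    have := I.sub_mem s1 hf
    convert this using 1; ring
  -- step 2
  let E' : Set (MvPolynomial (V ⊕ V) K) := {g | ∃ i j, G.Adj i j ∧ i ≠ u ∧ j ≠ u ∧
    g = x K i * y K j - x K j * y K i} ∪ {g | ∃ c ∉ T, g = x K c - 1} ∪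
    {g | ∃ c ∉ T ∪ A0 ∪ A, g = y K c - 1} ∪ {x K u, y K u}
  have hIE : I ≤ Ideal.span E' := by
    rw [hI, Ideal.span_le]
    have hxu : x K u ∈ Ideal.span E' := Ideal.subset_span (Or.inr (by simp))
    have hyu : y K u ∈ Ideal.span E' := Ideal.subset_span (Or.inr (by simp))
    rintro g ((⟨i, j, hij, rfl⟩ | ⟨d, hd, rfl⟩) | ⟨d, hd, rfl⟩)
    · by_cases hi : i = u
      · subst hi
        exact Ideal.sub_mem _ (Ideal.mul_mem_right _ _ hxu) (Ideal.mul_mem_left _ _ hyu)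
      · by_cases hj : j = u
        · subst hj
          exact Ideal.sub_mem _ (Ideal.mul_mem_left _ _ hyu) (Ideal.mul_mem_right _ _ hxu)
        · exact Ideal.subset_span (Or.inl (Or.inl (Or.inl ⟨i, j, hij, hi, hj, rfl⟩)))
    · exact Ideal.subset_span (Or.inl (Or.inl (Or.inr ⟨d, hd, rfl⟩)))
    · exact Ideal.subset_span (Or.inl (Or.inr ⟨d, hd, rfl⟩))
  have hEI : Ideal.span E' ≤ I ⊔ Ideal.span {x K u} := by
    rw [Ideal.span_le]
    rintro g (((⟨i, j, hij, _, _, rfl⟩ | ⟨d, hd, rfl⟩) | ⟨d, hd, rfl⟩) | h)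
    · exact Ideal.mem_sup_left (ie hij)
    · exact Ideal.mem_sup_left (ix hd)
    · exact Ideal.mem_sup_left (iy hd)
    · have hx : x K u ∈ I ⊔ Ideal.span {x K u} :=
        Ideal.mem_sup_right (Ideal.mem_span_singleton_self _)
      rcases h with rfl | rfl
      · exact hx
      · have huy : x K u - y K u ∈ I ⊔ Ideal.span {x K u} := Ideal.mem_sup_left uy
        have := Ideal.sub_mem _ hx huy
        simpa using this
  have memH : ∀ {i j}, G.Adj i j → i ≠ u → j ≠ u → i ∈ T ∪ A0 ∪ A → j ∈ T ∪ A0 ∪ A := by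
    rintro i j h hi hj ((h1 | h1) | h1)
    · exact hT i j h h1 hi
    · rcases hA0 i j h h1 with h2 | h2
      · exact Or.inl (Or.inr h2)
      · exact Or.inl (Or.inl h2)
    · rcases hA i j h h1 with h2 | h2
      · exact Or.inr h2
      · exact Or.inl (Or.inl h2)
  have s2 : f ∈ Ideal.span E' := by
    refine nzd_of_grade (fun v => v.elim (fun i => 0)
        (fun i => if i ∈ T ∪ A0 ∪ A ∧ i ≠ u then 1 else 0)) _ (y K w0) ?_ ?_ f (hIE s1)
    · rintro g (((⟨i, j, hij, hi, hj, rfl⟩ | ⟨d, hd, rfl⟩) | ⟨d, hd, rfl⟩) | rfl | rfl)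
      · refine ⟨(if i ∈ T ∪ A0 ∪ A ∧ i ≠ u then 1 else 0), ?_⟩
        have : (i ∈ T ∪ A0 ∪ A ∧ i ≠ u) ↔ (j ∈ T ∪ A0 ∪ A ∧ j ≠ u) :=
          ⟨fun h => ⟨memH hij hi hj h.1, hj⟩, fun h => ⟨memH hij.symm hj hi h.1, hi⟩⟩
        simp only [x, y, map_sub, map_mul, grade_X, Sum.elim_inl, Sum.elim_inr, pow_zero, this]
        ring
      · exact ⟨0, by simp [x, grade_X]⟩
      · refine ⟨0, ?_⟩
        simp only [y, map_sub, grade_X, Sum.elim_inr, hd, false_and, if_false]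
        simp
      · exact ⟨0, by simp [x, grade_X]⟩
      · exact ⟨0, by simp [y, grade_X]⟩
    · have : w0 ∈ T ∪ A0 ∪ A ∧ w0 ≠ u := ⟨Or.inl (Or.inr hw0), hw0u⟩
      simp only [y, grade_X, Sum.elim_inr]
      rw [if_pos this, pow_one]
  obtain ⟨b, hb, g, hfg⟩ := mem_sup_span (hEI s2)
  have s3 : x K u * (x K u * g) ∈ I := by
    have := I.sub_mem s1' (I.mul_mem_left (x K u) hb)
    rw [hfg] at this
    convert this using 1; ring
  -- step 3
  let τ : MvPolynomial (V ⊕ V) K →ₐ[K] MvPolynomial V K := aeval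
    (Sum.elim (fun c => if c ∈ T then X c else 1) (fun c => if c ∈ T then X c else 1))
  have τx : ∀ c, τ (x K c) = if c ∈ T then X c else 1 := fun c => by simp [τ, x]
  have τy : ∀ c, τ (y K c) = if c ∈ T then X c else 1 := fun c => by simp [τ, y]
  have τI : ∀ g ∈ I, τ g = 0 := by
    apply kill_gens
    · intro i j _
      rw [τx, τy, τx, τy, mul_comm]
    · intro c hc
      rw [τx, if_neg hc]
    · intro c hc
      rw [τy, if_neg (fun h => hc (Or.inl (Or.inl h)))]
  have τg : τ g = 0 := by
    have := τI _ s3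
    rw [map_mul, map_mul, τx, if_pos hu] at this
    simpa using this
  let ι : MvPolynomial V K →ₐ[K] MvPolynomial (V ⊕ V) K := aeval fun v => x K v
  let Iu : Ideal (MvPolynomial (V ⊕ V) K) :=
    Submodule.comap (LinearMap.lsmul (MvPolynomial (V ⊕ V) K) (MvPolynomial (V ⊕ V) K) (x K u)) I
  have mIu : ∀ g, g ∈ Iu ↔ x K u * g ∈ I := fun g => Iff.rfl
  have key : g - ι (τ g) ∈ Iu := by
    refine algHom_congr_mod Iu (AlgHom.id K _) (ι.comp τ) ?_ g
    rintro (c | c)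
    · change x K c - ι (τ (x K c)) ∈ _
      rw [τx]
      by_cases h : c ∈ T
      · simp [h, ι]
      · simp only [h, if_false, map_one]
        rw [mIu]
        exact I.mul_mem_left _ (ix h)
    · change y K c - ι (τ (y K c)) ∈ _
      rw [τy, mIu]
      by_cases h : c ∈ T
      · simp only [h, if_true, ι, aeval_X]
        by_cases hcu : c = u
        · subst hcu
          have := I.neg_mem (I.mul_mem_left (x K c) uy)
          convert this using 1; ring
        · have h1 := ie (hadj c (Or.inl (Or.inl h)) hcu)
          have := I.sub_mem h1 (I.mul_mem_left (x K c) uy)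
          convert this using 1; ring
      · simp only [h, if_false, map_one]
        by_cases h3 : c ∈ T ∪ A0 ∪ A
        · exact uc c h (hadj c h3 (fun h' => h (h' ▸ hu)))
        · exact I.mul_mem_left _ (iy h3)
  rw [τg, map_zero, sub_zero, mIu] at key
  rw [hfg, mul_comm g]
  exact I.add_mem hb key

/-- Case (i) -/
theorem case_i [Fintype V] (h : FI (Ideal.span (edges K G)))
    (T A0 A : Set V) (hTA0 : ∀ v ∈ T, v ∉ A0) (hTA : ∀ v ∈ T, v ∉ A)
    (hA0A : ∀ v ∈ A0, v ∉ A) (hA : ∀ i j, G.Adj i j → i ∈ A → j ∈ A ∨ j ∈ T)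
    (hA0 : ∀ i j, G.Adj i j → i ∈ A0 → j ∈ A0 ∨ j ∈ T) (w0 : V) (hw0 : w0 ∈ A0)
    (hA0c : ∀ c ∈ A0, RIn G A0 w0 c) (hTA0' : ∀ t ∈ T, ∃ c ∈ A0, G.Adj t c)
    (hTA' : ∀ t ∈ T, ∀ c ∈ A, ∃ c', RIn G A c c' ∧ G.Adj t c') (u : V) (hu : u ∈ T) (c0 : V)
    (hc0 : c0 ∈ A)
    (hT : ∀ i j, G.Adj i j → i ∈ T → j ∈ T ∪ A0 ∪ A)
    (hcase : (∃ t ∈ T, t ≠ u) ∨ ∃ c1 ∈ A, ¬ RIn G A c0 c1) : False := by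
  refine lemmaM (K := K) T A0 A hTA0 hTA hA0A hA hA0 w0 hw0 hA0c hTA0' hTA' u hu c0 hc0 0 ?_ hcase
  have hcl : ∀ i j, G.Adj i j → i ∈ T ∪ A0 ∪ A → j ∈ T ∪ A0 ∪ A := by
    rintro i j h ((h1 | h1) | h1)
    · exact hT i j h h1
    · rcases hA0 i j h h1 with h2 | h2
      · exact Or.inl (Or.inr h2)
      · exact Or.inl (Or.inl h2)
    · rcases hA i j h h1 with h2 | h2
      · exact Or.inr h2
      · exact Or.inl (Or.inl h2)
  have hreach : ∀ c ∈ (T ∪ A0 ∪ A)ᶜ, ∀ d, RIn G Set.univ c d →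
      RIn G (T ∪ A0 ∪ A)ᶜ c d ∧ d ∈ (T ∪ A0 ∪ A)ᶜ := by
    intro c hc d hcd
    induction hcd with
    | refl => exact ⟨Relation.ReflTransGen.refl, hc⟩
    | tail _ h ih =>
      have h2 := fun h' => ih.2 (hcl _ _ h.1.symm h')
      exact ⟨ih.1.tail ⟨h.1, ih.2, h2⟩, h2⟩
  have hw0C : w0 ∈ T ∪ A0 ∪ A := Or.inl (Or.inr hw0)
  have := FI_y (K := K) (Fintype.finite inferInstance) h Tᶜ ((T ∪ A0 ∪ A)ᶜ ∪ {w0}) (by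
    rintro c (hc | rfl)
    · exact fun h' => hc (Or.inl (Or.inl h'))
    · exact fun h' => hTA0 _ h' hw0) (by
    rintro c (hc | rfl) d hd hcd
    · exact (hreach c hc d hcd).1.mono Set.subset_union_left
    · rcases hd with hd | rfl
      · exact ((hreach d hd _ hcd.symm).2 hw0C).elim
      · exact Relation.ReflTransGen.refl)
  convert this using 1
  rw [C_0, zero_mul, sub_zero, ← Ideal.span_union]
  congr 1
  ext f
  constructor
  · rintro ((h | ⟨d, hd, rfl⟩) | rfl)
    · exact Or.inl h
    · exact Or.inr ⟨d, Or.inl hd, rfl⟩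
    · exact Or.inr ⟨w0, Or.inr rfl, rfl⟩
  · rintro (h | ⟨d, hd | rfl, rfl⟩)
    · exact Or.inl (Or.inl h)
    · exact Or.inl (Or.inr ⟨d, hd, rfl⟩)
    · exact Or.inr rfl

/-- Case (ii) -/
theorem case_ii [Fintype V] (h : FI (Ideal.span (edges K G)))
    (T A0 A : Set V) (hTA0 : ∀ v ∈ T, v ∉ A0) (hTA : ∀ v ∈ T, v ∉ A)
    (hA0A : ∀ v ∈ A0, v ∉ A) (hA : ∀ i j, G.Adj i j → i ∈ A → j ∈ A ∨ j ∈ T)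
    (hA0 : ∀ i j, G.Adj i j → i ∈ A0 → j ∈ A0 ∨ j ∈ T) (w0 : V) (hw0 : w0 ∈ A0)
    (hA0c : ∀ c ∈ A0, RIn G A0 w0 c) (hTA0' : ∀ t ∈ T, ∃ c ∈ A0, G.Adj t c)
    (hTA' : ∀ t ∈ T, ∀ c ∈ A, ∃ c', RIn G A c c' ∧ G.Adj t c') (u : V) (hu : u ∈ T) (c0 : V)
    (hc0 : c0 ∈ A)
    (hT : ∀ i j, G.Adj i j → i ∈ T → i ≠ u → j ∈ T ∪ A0 ∪ A)
    (hadj : ∀ v ∈ T ∪ A0 ∪ A, v ≠ u → G.Adj u v) (h2 : V) (hh2 : h2 ∉ T ∪ A0 ∪ A)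
    (hh2u : G.Adj u h2)
    (hr : ∀ c ∈ (T ∪ A0 ∪ A)ᶜ, ∀ d ∈ (T ∪ A0 ∪ A)ᶜ, RIn G Set.univ c d →
      RIn G (T ∪ A0 ∪ A)ᶜ c d)
    (t : V) (ht : t ∈ T) (htu : t ≠ u) : False := by
  refine lemmaM (K := K) T A0 A hTA0 hTA hA0A hA hA0 w0 hw0 hA0c hTA0' hTA' u hu c0 hc0 1 ?_
    (Or.inl ⟨t, ht, htu⟩)
  refine FI.mod (FI_y (K := K) (Fintype.finite inferInstance) h _ _ ?_ hr)
    (nzd_ii T A0 A hTA0 hTA hA hA0 w0 hw0 u hu hT hadj h2 hh2 hh2u)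
  exact fun c hc h' => hc (Or.inl (Or.inl h'))
end M2
end BEI

namespace BEI
section D1
open MvPolynomial
variable {K : Type} [Field K]

theorem basis_mem {P R : Type} [CommRing P] [CommRing R] [Algebra P R] {ι : Type} [Fintype ι]
    (b : Module.Basis ι P R) (𝔞 : Ideal P) (r : R) :
    r ∈ 𝔞.map (algebraMap P R) ↔ ∀ i, b.repr r i ∈ 𝔞 := by
  constructor
  · intro h
    have : 𝔞.map (algebraMap P R) ≤ 𝔞.map (algebraMap P R) := le_rfl
    have h2 : r ∈ (𝔞 • (⊤ : Submodule P R)) := by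
      rw [Ideal.smul_top_eq_map]; exact h
    refine Submodule.smul_induction_on (p := fun r => ∀ i, b.repr r i ∈ 𝔞) h2 ?_ ?_
    · intro a ha n _ i
      rw [map_smul, Finsupp.smul_apply]
      exact Ideal.mul_mem_right _ _ ha
    · intro r r' h h' i
      rw [map_add, Finsupp.add_apply]
      exact 𝔞.add_mem (h i) (h' i)
  · intro h
    rw [← b.sum_repr r]
    refine Ideal.sum_mem _ fun i _ => ?_
    rw [Algebra.smul_def]
    exact Ideal.mul_mem_right _ _ (Ideal.mem_map_of_mem _ (h i))

theorem X_nzd {s : Type} (A : Set s) (k : s) (hk : k ∉ A) (p : MvPolynomial s K)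
    (h : X k * p ∈ Ideal.span (X '' A : Set (MvPolynomial s K))) :
    p ∈ Ideal.span (X '' A : Set (MvPolynomial s K)) := by
  classical
  rw [mem_ideal_span_X_image] at h ⊢
  intro m hm
  have : m + Finsupp.single k 1 ∈ (X k * p).support := by
    rw [mem_support_iff, mul_comm, coeff_mul_X]
    exact mem_support_iff.1 hm
  obtain ⟨i, hi, hmi⟩ := h _ this
  refine ⟨i, hi, ?_⟩
  have hik : k ≠ i := by rintro rfl; exact hk hi
  simpa [Finsupp.single_apply, hik] using hmi

theorem FI_free {S : Type} [CommRing S] {I : Ideal S} (hI : FI I) {s : Type} [Fintype s]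
    (η : MvPolynomial s K →+* S) {ι : Type} [Fintype ι]
    (hb : letI := ((Ideal.Quotient.mk I).comp η).toAlgebra
      Nonempty (Module.Basis ι (MvPolynomial s K) (S ⧸ I))) :
    FI (I ⊔ Ideal.span (Set.range fun k => η (X k))) := by
  classical
  let _ := ((Ideal.Quotient.mk I).comp η).toAlgebra
  obtain ⟨b⟩ := hb
  have key : ∀ (A : Finset s), FI (I ⊔ Ideal.span ((fun k => η (X k)) '' A)) := by
    intro A
    induction A using Finset.induction_on with
    | empty => simpa using hI
    | insert k A hk ih =>
      have e : I ⊔ Ideal.span ((fun k => η (X k)) '' (insert k A : Finset s)) =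
          (I ⊔ Ideal.span ((fun k => η (X k)) '' A)) ⊔ Ideal.span {η (X k)} := by
        rw [Finset.coe_insert, Set.image_insert_eq, Ideal.span_insert, sup_assoc, sup_comm (Ideal.span {_})]
      rw [e]
      refine FI.mod ih ?_
      have hmem : ∀ f : S, f ∈ I ⊔ Ideal.span ((fun k => η (X k)) '' A) ↔
          Ideal.Quotient.mk I f ∈ (Ideal.span (X '' (A : Set s) : Set (MvPolynomial s K))).map
            (algebraMap (MvPolynomial s K) (S ⧸ I)) := by
        intro f
        have : (Ideal.span (X '' (A : Set s) : Set (MvPolynomial s K))).map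
            (algebraMap (MvPolynomial s K) (S ⧸ I)) =
            (Ideal.span ((fun k => η (X k)) '' A)).map (Ideal.Quotient.mk I) := by
          rw [Ideal.map_span, Ideal.map_span]
          congr 1
          rw [Set.image_image, Set.image_image]
          rfl
        rw [this, Ideal.mem_quotient_iff_mem_sup, sup_comm]
      intro f hf
      rw [hmem, basis_mem b] at hf ⊢
      intro i
      have := hf i
      have e2 : Ideal.Quotient.mk I (η (X k) * f) = (X k : MvPolynomial s K) •
          (Ideal.Quotient.mk I f) := by
        rw [Algebra.smul_def, map_mul]; rfl
      rw [e2, map_smul, Finsupp.smul_apply, smul_eq_mul] at this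
      exact X_nzd _ k (by simpa using hk) _ this
  have := key Finset.univ
  rwa [Finset.coe_univ, Set.image_univ] at this

/-- the auxiliary polynomials -/
noncomputable def Yp {P : Type} [CommRing P] (t : ℕ → P) (N : ℕ) : ℕ → Polynomial P
  | 0 => Polynomial.C (t N)
  | m + 1 => Polynomial.C (t (N - (m + 1))) + Polynomial.X * Yp t N m

theorem Yp_degree {P : Type} [CommRing P] [IsDomain P] (t : ℕ → P) (N : ℕ) (h : t N ≠ 0) (m : ℕ) :
    (Yp t N m).degree = m := by
  induction m with
  | zero => simp [Yp, Polynomial.degree_C h]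
  | succ m ih =>
    have h1 : (Polynomial.X * Yp t N m).degree = ((m + 1 : ℕ) : WithBot ℕ) := by
      rw [Polynomial.degree_mul, ih, Polynomial.degree_X, add_comm]; rfl
    have h2 : Yp t N (m + 1) = Polynomial.C (t (N - (m + 1))) + Polynomial.X * Yp t N m := rfl
    rw [h2, Polynomial.degree_add_eq_right_of_degree_lt, h1]
    rw [h1]
    refine lt_of_le_of_lt Polynomial.degree_C_le ?_
    exact_mod_cast Nat.succ_pos m

theorem Yp_indep {P : Type} [CommRing P] [IsDomain P] (t : ℕ → P) (N : ℕ) (h : t N ≠ 0)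
    (p : Fin N → P) (hp : AdjoinRoot.mk (Yp t N N)
      (∑ m : Fin N, Polynomial.C (p m) * (if m.1 = 0 then 1 else Yp t N m.1)) = 0) : p = 0 := by
  rw [AdjoinRoot.mk_eq_zero] at hp
  let sq : Polynomial.Sequence P := ⟨fun m => if m = 0 then 1 else Yp t N m, fun m => by
    by_cases hm : m = 0
    · simp [hm]
    · simp [hm, Yp_degree t N h]⟩
  have hsq : ∀ m, sq m = if m = 0 then 1 else Yp t N m := fun m => rfl
  have hdeg : (∑ m : Fin N, Polynomial.C (p m) * (if m.1 = 0 then 1 else Yp t N m.1)).degree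
      < (Yp t N N).degree := by
    rw [Yp_degree t N h]
    refine lt_of_le_of_lt (Polynomial.degree_sum_le _ _) ?_
    rw [Finset.sup_lt_iff (by exact_mod_cast WithBot.bot_lt_coe N)]
    intro m _
    have : (if m.1 = 0 then 1 else Yp t N m.1) = sq m.1 := rfl
    rw [this]
    refine lt_of_le_of_lt (Polynomial.degree_mul_le _ _) ?_
    rw [sq.degree_eq]
    refine lt_of_le_of_lt (add_le_add_left Polynomial.degree_C_le _) ?_
    rw [zero_add]
    exact_mod_cast m.2
  have h0 := Polynomial.eq_zero_of_dvd_of_degree_lt hp hdeg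
  have hli : LinearIndependent P fun m : Fin N => sq m.1 :=
    sq.linearIndependent.comp _ Fin.val_injective
  rw [Fintype.linearIndependent_iff] at hli
  funext m
  refine hli p ?_ m
  rw [← h0]
  refine Finset.sum_congr rfl fun m _ => ?_
  rw [Polynomial.smul_eq_C_mul]
end D1
end BEI

namespace BEI
section D2
open MvPolynomial
variable {K : Type} [Field K] {V : Type} {G : SimpleGraph V}

structure CD (G : SimpleGraph V) (pos : V → ℕ) (c : ℕ → V) (N : ℕ) (s : Finset ℕ) : Prop where
  hN : 3 ≤ N
  hc : ∀ j, 1 ≤ j → j ≤ N → pos (c j) = j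
  hpos : ∀ v, pos v ≠ 0 → pos v ≤ N ∧ c (pos v) = v
  adj : ∀ u v, pos u ≠ 0 → pos v ≠ 0 → u ≠ v → G.Adj u v
  hs : ∀ j, 1 ≤ j → j ≤ N → j ∈ s
  hs' : ∀ j ∈ s, j ≤ N
  k1 : ∀ i j, G.Adj i j → pos i ≠ 0 → pos j = 0 → pos i = 1 ∧ 0 ∉ s
  k2 : 0 ∉ s → ∃ d, pos d = 0 ∧ G.Adj (c 1) d

noncomputable def zz (K : Type) [Field K] (c : ℕ → V) (j : ℕ) : MvPolynomial (V ⊕ V) K :=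
  if j = 0 then 0 else x K (c j)

noncomputable def th (K : Type) [Field K] (c : ℕ → V) (N j : ℕ) : MvPolynomial (V ⊕ V) K :=
  if j = N then zz K c N else zz K c j - (y K (c (j + 1)) - zz K c (j + 1))

noncomputable def tt (K : Type) [Field K] (s : Finset ℕ) (j : ℕ) : MvPolynomial s K :=
  if h : j ∈ s then X ⟨j, h⟩ else 0

noncomputable def eta (K : Type) [Field K] (c : ℕ → V) (N : ℕ) (s : Finset ℕ) :
    MvPolynomial s K →ₐ[K] MvPolynomial (V ⊕ V) K := aeval fun k => th K c N k.1

variable {pos : V → ℕ} {c : ℕ → V} {N : ℕ} {s : Finset ℕ}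

theorem CD.kill (h : CD G pos c N s) {D : Type} [CommRing D] [Algebra K D]
    (φ : MvPolynomial (V ⊕ V) K →ₐ[K] D)
    (hx : ∀ v, pos v = 0 → φ (x K v) = 1) (hy : ∀ v, pos v = 0 → φ (y K v) = 1)
    (hxy : ∀ i j, 1 ≤ i → i ≤ N → 1 ≤ j → j ≤ N →
      φ (x K (c i)) * φ (y K (c j)) = φ (x K (c j)) * φ (y K (c i)))
    (h1 : 0 ∉ s → φ (x K (c 1)) = φ (y K (c 1))) :
    ∀ f ∈ Ideal.span (gens K G {v | pos v = 0} {v | pos v = 0}), φ f = 0 := by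
  have h2 : ∀ i j, G.Adj i j → pos i ≠ 0 → pos j = 0 → φ (x K i) = φ (y K i) := by
    intro i j hij hi hj
    obtain ⟨h3, h4⟩ := h.k1 i j hij hi hj
    have : c 1 = i := by have := (h.hpos i hi).2; rwa [h3] at this
    rw [← this]; exact h1 h4
  refine kill_gens φ ?_ (fun v hv => hx v hv) (fun v hv => hy v hv)
  intro i j hij
  by_cases hi : pos i = 0
  · by_cases hj : pos j = 0
    · rw [hx i hi, hx j hj, hy i hi, hy j hj]
    · rw [hx i hi, hy i hi, h2 j i hij.symm hj hi]; ring
  · by_cases hj : pos j = 0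
    · rw [hx j hj, hy j hj, h2 i j hij hi hj]; ring
    · have := hxy (pos i) (pos j) (by omega) (h.hpos i hi).1 (by omega) (h.hpos j hj).1
      rwa [(h.hpos i hi).2, (h.hpos j hj).2] at this

theorem prod_mem {P R : Type} [CommRing P] [CommRing R] [Algebra P R] (N : ℕ) (z : ℕ → R)
    (t : ℕ → P) (M : Submodule P R) (z0 : z 0 = 0) (zN : z N = algebraMap P R (t N))
    (rel : ∀ i j, i < N → j < N → z (i + 1) * (z j - algebraMap P R (t j)) =
      z (j + 1) * (z i - algebraMap P R (t i)))
    (hM : ∀ i j, i ≤ N → j ≤ N → t i • z j ∈ M) :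
    ∀ i j, i ≤ N → j ≤ N → z i * z j ∈ M := by
  intro i
  induction i with
  | zero => intro j _ _; rw [z0, zero_mul]; exact M.zero_mem
  | succ i ih =>
    intro j hi hj
    rcases Nat.lt_or_eq_of_le hj with hj | rfl
    · have e : z (i + 1) * z j = t j • z (i + 1) + z i * z (j + 1) - t i • z (j + 1) := by
        have := rel i j (by omega) hj
        rw [Algebra.smul_def, Algebra.smul_def]
        linear_combination this
      rw [e]
      exact M.sub_mem (M.add_mem (hM _ _ (by omega) hi) (ih _ (by omega) (by omega)))
        (hM _ _ (by omega) (by omega))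
    · rw [zN, mul_comm, ← Algebra.smul_def]
      exact hM _ _ le_rfl hi

theorem CD.qrel (h : CD G pos c N s) (I : Ideal (MvPolynomial (V ⊕ V) K))
    (hI : edges K G ⊆ I) (i j : ℕ)
    (hi : i < N) (hj : j < N) :
    Ideal.Quotient.mk I (zz K c (i + 1)) *
      (Ideal.Quotient.mk I (zz K c j) - Ideal.Quotient.mk I (th K c N j)) =
    Ideal.Quotient.mk I (zz K c (j + 1)) *
      (Ideal.Quotient.mk I (zz K c i) - Ideal.Quotient.mk I (th K c N i)) := by
  by_cases hij : i = j
  · rw [hij]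
  · have ha : G.Adj (c (i + 1)) (c (j + 1)) := by
      have e1 := h.hc (i + 1) (by omega) (by omega)
      have e2 := h.hc (j + 1) (by omega) (by omega)
      refine h.adj _ _ (by omega) (by omega) ?_
      intro e; rw [e] at e1; omega
    have : Ideal.Quotient.mk I (x K (c (i + 1)) * y K (c (j + 1)) -
        x K (c (j + 1)) * y K (c (i + 1))) = 0 :=
      Ideal.Quotient.eq_zero_iff_mem.2 (hI ⟨_, _, ha, rfl⟩)
    have e1 : th K c N i = zz K c i - (y K (c (i + 1)) - x K (c (i + 1))) := by
      simp [th, hi.ne, zz]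
    have e2 : th K c N j = zz K c j - (y K (c (j + 1)) - x K (c (j + 1))) := by
      simp [th, hj.ne, zz]
    have e3 : ∀ k, zz K c (k + 1) = x K (c (k + 1)) := fun k => by simp [zz]
    rw [e1, e2, e3, e3]
    simp only [map_sub, map_mul] at this ⊢
    linear_combination this

theorem CD.eta_tt (h : CD G pos c N s) (j : ℕ) (hj : j ≤ N) :
    Ideal.Quotient.mk (Ideal.span (gens K G {v | pos v = 0} {v | pos v = 0}))
      (eta K c N s (tt K s j)) =
    Ideal.Quotient.mk (Ideal.span (gens K G {v | pos v = 0} {v | pos v = 0})) (th K c N j) := by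
  by_cases hjs : j ∈ s
  · simp [tt, hjs, eta]
  · have hj0 : j = 0 := by
      by_contra h0
      exact hjs (h.hs j (by omega) hj)
    subst hj0
    obtain ⟨d, hd, hda⟩ := h.k2 hjs
    have hN := h.hN
    have e1 : th K c N 0 = - y K (c 1) + x K (c 1) := by
      have : (0 : ℕ) ≠ N := by omega
      simp [th, this, zz]; ring
    simp only [tt, hjs, dif_neg, not_false_eq_true, map_zero]
    symm
    rw [Ideal.Quotient.eq_zero_iff_mem, e1]
    have : - y K (c 1) + x K (c 1) = (x K (c 1) * y K d - x K d * y K (c 1)) -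
      x K (c 1) * (y K d - 1) + y K (c 1) * (x K d - 1) := by ring
    rw [this]
    refine Ideal.add_mem _ (Ideal.sub_mem _ ?_ (Ideal.mul_mem_left _ _ ?_))
      (Ideal.mul_mem_left _ _ ?_)
    · exact edge_mem (fun g hg => Or.inl (Or.inl hg)) hda
    · exact Ideal.subset_span (Or.inr ⟨d, hd, rfl⟩)
    · exact Ideal.subset_span (Or.inl (Or.inr ⟨d, hd, rfl⟩))

theorem CD.basis (h : CD G pos c N s) (R : Type) [CommRing R] [Algebra (MvPolynomial s K) R]
    (q : MvPolynomial (V ⊕ V) K →+* R) (hq : Function.Surjective q)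
    (hI : RingHom.ker q = Ideal.span (gens K G {v | pos v = 0} {v | pos v = 0}))
    (halg : ∀ p, algebraMap (MvPolynomial s K) R p = q (eta K c N s p)) :
    Nonempty (Module.Basis (Fin N) (MvPolynomial s K) R) := by
  classical
  have hqq : ∀ a b, Ideal.Quotient.mk (RingHom.ker q) a = Ideal.Quotient.mk (RingHom.ker q) b →
      q a = q b := by
    intro a b hab
    rw [Ideal.Quotient.eq, RingHom.mem_ker, map_sub, sub_eq_zero] at hab
    exact hab
  have hett := h.eta_tt (K := K)
  have hqrel := fun hI => h.qrel (K := K)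
    (Ideal.span (gens K G {v | pos v = 0} {v | pos v = 0})) hI
  have hkill := fun {D : Type} [CommRing D] [Algebra K D] φ => h.kill (K := K) (D := D) φ
  have hin : ∀ g ∈ gens K G {v | pos v = 0} {v | pos v = 0},
    g ∈ Ideal.span (gens K G {v | pos v = 0} {v | pos v = 0}) := fun g hg => Ideal.subset_span hg
  rw [← hI] at hett hqrel hkill hin
  replace hett : ∀ j ≤ N, q (eta K c N s (tt K s j)) = q (th K c N j) :=
    fun j hj => hqq _ _ (hett j hj)
  replace hqrel : ∀ i j, i < N → j < N → q (zz K c (i + 1)) * (q (zz K c j) - q (th K c N j)) =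
      q (zz K c (j + 1)) * (q (zz K c i) - q (th K c N i)) := by
    intro i j hi hj
    have := hqrel (fun g hg => hin g (Or.inl (Or.inl hg))) i j hi hj
    rw [← map_sub, ← map_sub, ← map_mul, ← map_mul] at this
    simpa using hqq _ _ this
  have hin' : ∀ g, g - 1 ∈ gens K G {v | pos v = 0} {v | pos v = 0} → q g = 1 := by
    intro g hg
    have := hin _ hg
    rwa [RingHom.mem_ker, map_sub, map_one, sub_eq_zero] at this
  have hN := h.hN
  let z : ℕ → R := fun j => q (zz K c j)
  let ζ : Fin N → R := fun m => if m.1 = 0 then 1 else z (N - m.1)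
  have z0 : z 0 = 0 := by simp [z, zz]
  have zN : z N = algebraMap _ _ (tt K s N) := by
    rw [halg, hett N le_rfl]; simp [th, z]
  let M := Submodule.span (MvPolynomial s K) (Set.range ζ)
  have M1 : (1 : R) ∈ M :=
    Submodule.subset_span ⟨⟨0, by omega⟩, by simp [ζ]⟩
  have Mz : ∀ j, j ≤ N → z j ∈ M := by
    intro j hj
    by_cases h0 : j = 0
    · rw [h0, z0]; exact M.zero_mem
    by_cases h1 : j = N
    · rw [h1, zN, Algebra.algebraMap_eq_smul_one]; exact M.smul_mem _ M1
    · refine Submodule.subset_span ⟨⟨N - j, by omega⟩, ?_⟩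
      have e : N - (N - j) = j := by omega
      have e' : N - j ≠ 0 := by omega
      simp [ζ, e, e']
  have Mzz : ∀ i j, i ≤ N → j ≤ N → z i * z j ∈ M := by
    refine prod_mem N z (tt K s) M z0 zN ?_ fun i j _ hj => M.smul_mem _ (Mz j hj)
    intro i j hi hj
    rw [halg, halg, hett i hi.le, hett j hj.le]
    exact hqrel i j hi hj
  have mulz : ∀ i, i ≤ N → ∀ m ∈ M, z i * m ∈ M := by
    intro i hi m hm
    induction hm using Submodule.span_induction with
    | mem m hm =>
      obtain ⟨k, rfl⟩ := hm
      by_cases hk : k.1 = 0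
      · simp only [ζ, hk, if_true, mul_one]; exact Mz i hi
      · simp only [ζ, hk, if_false]; exact Mzz _ _ hi (by omega)
    | zero => rw [mul_zero]; exact M.zero_mem
    | add a b _ _ ha hb => rw [mul_add]; exact M.add_mem ha hb
    | smul p a _ ha => rw [mul_smul_comm]; exact M.smul_mem _ ha
  have mulx : ∀ v, ∀ m ∈ M, q (x K v) * m ∈ M := by
    intro v m hm
    by_cases hv : pos v = 0
    · have : q (x K v) = 1 := by
        exact hin' _ (Or.inl (Or.inr ⟨v, hv, rfl⟩))
      rw [this, one_mul]; exact hm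
    · have := mulz (pos v) (h.hpos v hv).1 m hm
      simpa [z, zz, hv, (h.hpos v hv).2] using this
  have muly : ∀ v, ∀ m ∈ M, q (y K v) * m ∈ M := by
    intro v m hm
    by_cases hv : pos v = 0
    · have : q (y K v) = 1 := by
        exact hin' _ (Or.inr ⟨v, hv, rfl⟩)
      rw [this, one_mul]; exact hm
    · obtain ⟨h1, h2⟩ := h.hpos v hv
      obtain ⟨j, hj⟩ : ∃ j, pos v = j + 1 := ⟨pos v - 1, by omega⟩
      rw [hj] at h1 h2
      have e : q (y K v) * m = z (j + 1) * m + z j * m - tt K s j • m := by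
        rw [Algebra.smul_def, halg, hett j (by omega)]
        have : th K c N j = zz K c j - (y K v - zz K c (j + 1)) := by
          have : j ≠ N := by omega
          simp [th, this, h2]
        rw [this]
        simp only [z, map_sub]
        ring
      rw [e]
      exact M.sub_mem (M.add_mem (mulz _ h1 _ hm) (mulz _ (by omega) _ hm)) (M.smul_mem _ hm)
  have hall : ∀ f : MvPolynomial (V ⊕ V) K, ∀ m ∈ M, q f * m ∈ M := by
    intro f
    induction f using MvPolynomial.induction_on with
    | C a =>
      intro m hm
      have : q (C a) = algebraMap (MvPolynomial s K) _ (C a) := by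
        rw [halg]; congr 1
        exact ((eta K c N s).commutes a).symm
      rw [this, ← Algebra.smul_def]; exact M.smul_mem _ hm
    | add p q hp hq => intro m hm; rw [map_add, add_mul]; exact M.add_mem (hp m hm) (hq m hm)
    | mul_X p v hp =>
      intro m hm
      rw [map_mul, mul_assoc]
      refine hp _ ?_
      rcases v with v | v
      · exact mulx v m hm
      · exact muly v m hm
  have htop : ⊤ ≤ M := by
    intro r _
    obtain ⟨f, rfl⟩ := hq r
    simpa using hall f 1 M1
  have hli : LinearIndependent (MvPolynomial s K) ζ := by
    rw [Fintype.linearIndependent_iff]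
    intro g hg i
    let Y := Yp (tt K s) N
    let D := AdjoinRoot (Y N)
    let rt : D := AdjoinRoot.root (Y N)
    let Φ : MvPolynomial (V ⊕ V) K →ₐ[K] D := aeval (Sum.elim
      (fun v => if pos v = 0 then 1 else AdjoinRoot.mk (Y N) (Y (N - pos v)))
      (fun v => if pos v = 0 then 1 else (1 + rt) * AdjoinRoot.mk (Y N) (Y (N - pos v))))
    have Φx : ∀ v, Φ (x K v) = if pos v = 0 then 1 else AdjoinRoot.mk (Y N) (Y (N - pos v)) :=
      fun v => by simp [Φ, x]
    have Φy : ∀ v, Φ (y K v) = if pos v = 0 then 1 else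
      (1 + rt) * AdjoinRoot.mk (Y N) (Y (N - pos v)) := fun v => by simp [Φ, y]
    have Φxc : ∀ j, 1 ≤ j → j ≤ N → Φ (x K (c j)) = AdjoinRoot.mk (Y N) (Y (N - j)) := by
      intro j h1 h2
      rw [Φx, h.hc j h1 h2, if_neg (by omega)]
    have Φyc : ∀ j, 1 ≤ j → j ≤ N → Φ (y K (c j)) = (1 + rt) * AdjoinRoot.mk (Y N) (Y (N - j)) := by
      intro j h1 h2
      rw [Φy, h.hc j h1 h2, if_neg (by omega)]
    have Φz : ∀ j, j ≤ N → Φ (zz K c j) = AdjoinRoot.mk (Y N) (Y (N - j)) := by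
      intro j h2
      by_cases h0 : j = 0
      · simp [h0, zz]
      · simp only [zz, h0, if_false]; exact Φxc j (by omega) h2
    have Ysucc : ∀ j, j < N → AdjoinRoot.mk (Y N) (Y (N - j)) =
        AdjoinRoot.of (Y N) (tt K s j) + rt * AdjoinRoot.mk (Y N) (Y (N - (j + 1))) := by
      intro j hj
      obtain ⟨m, hm⟩ : ∃ m, N - j = m + 1 := ⟨N - j - 1, by omega⟩
      have e1 : N - (j + 1) = m := by omega
      have e2 : Y (m + 1) = Polynomial.C (tt K s (N - (m + 1))) + Polynomial.X * Y m := rfl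
      have e3 : N - (m + 1) = j := by omega
      rw [e1, hm, e2, e3, map_add, map_mul, AdjoinRoot.mk_C, AdjoinRoot.mk_X]
    have Φth : ∀ j, j ≤ N → Φ (th K c N j) = AdjoinRoot.of (Y N) (tt K s j) := by
      intro j hj
      by_cases h1 : j = N
      · simp only [th, h1, if_true]
        rw [Φz N le_rfl, Nat.sub_self]
        rfl
      · simp only [th, h1, if_false]
        rw [map_sub, map_sub, Φz j hj, Φz (j + 1) (by omega), Φyc (j + 1) (by omega) (by omega),
          Ysucc j (by omega)]
        ring
    have ΦI : ∀ f ∈ RingHom.ker q, Φ f = 0 := by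
      refine hkill Φ (fun v hv => by rw [Φx, if_pos hv]) (fun v hv => by rw [Φy, if_pos hv]) ?_ ?_
      · intro i j h1 h2 h3 h4
        rw [Φxc i h1 h2, Φxc j h3 h4, Φyc i h1 h2, Φyc j h3 h4]; ring
      · intro h0
        have := Ysucc 0 (by omega)
        rw [Nat.sub_zero, AdjoinRoot.mk_self] at this
        simp only [tt, h0, dif_neg, not_false_eq_true, map_zero, zero_add] at this
        rw [Φxc 1 le_rfl (by omega), Φyc 1 le_rfl (by omega)]
        linear_combination this
    have Φeta : ∀ p, Φ (eta K c N s p) = AdjoinRoot.of (Y N) p := by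
      intro p
      have : Φ.comp (eta K c N s) = (Algebra.ofId (MvPolynomial s K) D).restrictScalars K := by
        apply MvPolynomial.algHom_ext
        intro k
        have e := Φth k.1 (h.hs' _ k.2)
        have e2 : tt K s k.1 = X k := by simp [tt]
        rw [e2] at e
        simp only [AlgHom.comp_apply, eta, aeval_X]
        exact e
      exact DFunLike.congr_fun this p
    have hlift : ∑ m : Fin N, AdjoinRoot.of (Y N) (g m) *
        (if m.1 = 0 then 1 else AdjoinRoot.mk (Y N) (Y m.1)) = 0 := by
      let Ψ : R →+* D := RingHom.liftOfSurjective q hq ⟨Φ.toRingHom, ΦI⟩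
      have hΨ : ∀ f, Ψ (q f) = Φ f := fun f =>
        RingHom.liftOfRightInverse_comp_apply q _ _ ⟨Φ.toRingHom, ΦI⟩ f
      have := congrArg Ψ hg
      rw [map_sum, map_zero] at this
      rw [← this]
      refine Finset.sum_congr rfl fun m _ => ?_
      rw [Algebra.smul_def, map_mul, halg, hΨ, Φeta]
      congr 1
      by_cases hm : m.1 = 0
      · simp [ζ, hm]
      · simp only [ζ, hm, if_false, z]
        rw [hΨ, Φz _ (by omega)]
        congr 2
        omega
    have htN : tt K s N ≠ 0 := by
      have : N ∈ s := h.hs N (by omega) le_rfl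
      simp [tt, this]
    have := Yp_indep (tt K s) N htN g (by
      rw [map_sum, ← hlift]
      refine Finset.sum_congr rfl fun m _ => ?_
      rw [map_mul, AdjoinRoot.mk_C]
      congr 1
      by_cases hm : m.1 = 0
      · simp [hm]
      · simp only [hm, if_false]; rfl)
    exact congrFun this i
  exact ⟨Module.Basis.mk hli htop⟩
end D2
end BEI

namespace BEI
section D3
open MvPolynomial
variable {K : Type} [Field K] {V : Type} {G : SimpleGraph V}
variable {pos : V → ℕ} {c : ℕ → V} {N : ℕ} {s : Finset ℕ}

theorem CD.FI' (h : CD G pos c N s)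
    (hFI : FI (Ideal.span (gens K G {v | pos v = 0} {v | pos v = 0}))) :
    FI (Ideal.span (gens K G {v | pos v = 0} {v | pos v = 0}) ⊔
      Ideal.span (Set.range fun k : s => th K c N k.1)) := by
  have := FI_free hFI (eta K c N s).toRingHom (ι := Fin N) (by
    let alg : Algebra (MvPolynomial s K) (MvPolynomial (V ⊕ V) K ⧸
      (Ideal.span (gens K G {v | pos v = 0} {v | pos v = 0}))) :=
        RingHom.toAlgebra ((Ideal.Quotient.mk _).comp (eta K c N s).toRingHom)
    exact @CD.basis K _ V G pos c N s h _ _ alg (Ideal.Quotient.mk _)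
      Ideal.Quotient.mk_surjective Ideal.mk_ker (fun p => rfl))
  convert this using 5
  simp [eta]

theorem CD.false [Fintype V] (h : CD G pos c N s)
    (hFI : FI (Ideal.span (gens K G {v | pos v = 0} {v | pos v = 0}))) : False := by
  classical
  have hFI' := h.FI' hFI
  have hkill := fun {D : Type} [CommRing D] [Algebra K D] φ => h.kill (K := K) (D := D) φ
  have hett := h.eta_tt (K := K)
  have hN := h.hN
  set I := Ideal.span (gens K G {v | pos v = 0} {v | pos v = 0}) with hI
  set J := I ⊔ Ideal.span (Set.range fun k : s => th K c N k.1) with hJ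
  have killJ : ∀ {D : Type} [CommRing D] [Algebra K D] (φ : MvPolynomial (V ⊕ V) K →ₐ[K] D),
    (∀ f ∈ I, φ f = 0) → (∀ j ≤ N, φ (th K c N j) = 0) → ∀ f ∈ J, φ f = 0 := by
    intro D _ _ φ h1 h2
    have : J ≤ RingHom.ker φ := by
      rw [hJ, sup_le_iff]
      refine ⟨h1, ?_⟩
      rw [Ideal.span_le]
      rintro _ ⟨k, rfl⟩
      exact h2 _ (h.hs' _ k.2)
    exact this
  let q := Ideal.Quotient.mk J
  have qth : ∀ j ≤ N, q (th K c N j) = 0 := by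
    intro j hj
    have h1 := hett j hj
    rw [Ideal.Quotient.eq] at h1
    have h2 : eta K c N s (tt K s j) ∈ J := by
      by_cases hjs : j ∈ s
      · simp only [tt, hjs, dif_pos, eta, aeval_X]
        exact Ideal.mem_sup_right (Ideal.subset_span ⟨⟨j, hjs⟩, rfl⟩)
      · simp [tt, hjs]
    have h3 := J.sub_mem h2 (Ideal.mem_sup_left h1 : _ ∈ J)
    rw [sub_sub_cancel] at h3
    exact Ideal.Quotient.eq_zero_iff_mem.2 h3
  have zN : q (zz K c N) = 0 := by simpa [th] using qth N le_rfl
  have z0 : q (zz K c 0) = 0 := by simp [zz]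
  have q1 : ∀ g, g - 1 ∈ gens K G {v | pos v = 0} {v | pos v = 0} → q g = 1 := by
    intro g hg
    have : q (g - 1) = 0 := Ideal.Quotient.eq_zero_iff_mem.2
      (Ideal.mem_sup_left (Ideal.subset_span hg))
    rwa [map_sub, map_one, sub_eq_zero] at this
  have zz0 : ∀ i j, i ≤ N → j ≤ N → q (zz K c i) * q (zz K c j) = 0 := by
    intro i j hi hj
    have := prod_mem (P := MvPolynomial (V ⊕ V) K ⧸ J) N (fun j => q (zz K c j)) 0 ⊥ z0
      (by simpa using zN) (by
        intro i j hi hj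
        have := h.qrel J (fun g hg => Ideal.mem_sup_left
          (Ideal.subset_span (Or.inl (Or.inl hg)))) i j hi hj
        change _ * (_ - q _) = _ * (_ - q _) at this
        rw [qth i hi.le, qth j hj.le] at this
        simpa using this) (by simp) i j hi hj
    simpa using this
  have hxz : ∀ j, 1 ≤ j → x K (c j) = zz K c j := fun j hj => by
    have : j ≠ 0 := by omega
    simp [zz, this]
  have qy : ∀ j, j < N → q (y K (c (j + 1))) = q (zz K c (j + 1)) + q (zz K c j) := by
    intro j hj
    have := qth j hj.le
    simp only [th, hj.ne, if_false, map_sub] at this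
    linear_combination -this
  -- tangent vectors
  let T : ℕ → MvPolynomial (V ⊕ V) K →ₐ[K] DualNumber K := fun k => aeval (Sum.elim
    (fun v => if pos v = 0 then 1 else if pos v = k then DualNumber.eps else 0)
    (fun v => if pos v = 0 then 1 else if pos v = k ∨ pos v = k + 1 then DualNumber.eps else 0))
  have Tx : ∀ k v, T k (x K v) = if pos v = 0 then 1 else if pos v = k then DualNumber.eps else 0 :=
    fun k v => by simp [T, x]
  have Ty : ∀ k v, T k (y K v) = if pos v = 0 then 1 else
    if pos v = k ∨ pos v = k + 1 then DualNumber.eps else 0 := fun k v => by simp [T, y]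
  have Txc : ∀ k j, 1 ≤ j → j ≤ N → T k (x K (c j)) = if j = k then DualNumber.eps else 0 := by
    intro k j h1 h2
    rw [Tx, h.hc j h1 h2, if_neg (by omega)]
  have Tyc : ∀ k j, 1 ≤ j → j ≤ N → T k (y K (c j)) =
      if j = k ∨ j = k + 1 then DualNumber.eps else 0 := by
    intro k j h1 h2
    rw [Ty, h.hc j h1 h2, if_neg (by omega)]
  have Tz : ∀ k j, 1 ≤ k → j ≤ N → T k (zz K c j) = if j = k then DualNumber.eps else 0 := by
    intro k j hk h2
    by_cases h0 : j = 0
    · have : (0 : ℕ) ≠ k := by omega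
      simp [h0, zz, this]
    · rw [← hxz j (by omega), Txc k j (by omega) h2]
  have TJ : ∀ k, 1 ≤ k → k < N → ∀ f ∈ J, T k f = 0 := by
    intro k hk hkN
    refine killJ (T k) (hkill (T k) ?_ ?_ ?_ ?_) ?_
    · intro v hv; rw [Tx, if_pos hv]
    · intro v hv; rw [Ty, if_pos hv]
    · intro i j h1 h2 h3 h4
      rw [Txc k i h1 h2, Txc k j h3 h4, Tyc k i h1 h2, Tyc k j h3 h4]
      split_ifs <;> simp
    · intro _
      rw [Txc k 1 le_rfl (by omega), Tyc k 1 le_rfl (by omega)]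
      have : ¬ (k = 0) := by omega
      simp [this]
    · intro j hj
      by_cases h1 : j = N
      · simp only [th, h1, if_true]
        rw [Tz k N hk le_rfl, if_neg (by omega)]
      · simp only [th, h1, if_false, map_sub]
        rw [Tz k j hk hj, Tz k (j + 1) hk (by omega), Tyc k (j + 1) (by omega) (by omega)]
        by_cases e1 : j = k
        · have : ¬ (k + 1 = k) := by omega
          simp [e1]
        · simp only [e1, if_false, Nat.add_right_cancel_iff, or_false, sub_self]
  let B : ℕ → MvPolynomial (V ⊕ V) K ⧸ J := fun j =>
    if 2 ≤ j ∧ j < N then q (zz K c j) else 0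
  have BB : ∀ i j, B i * B j = 0 := by
    intro i j
    simp only [B]
    split_ifs with h1 h2
    · exact zz0 i j h1.2.le h2.2.le
    all_goals simp
  let ρ : MvPolynomial (V ⊕ V) K →ₐ[K] (MvPolynomial (V ⊕ V) K ⧸ J) := aeval (Sum.elim
    (fun v => if pos v = 0 then 1 else B (pos v))
    (fun v => if pos v = 0 then 1 else B (pos v) + B (pos v - 1)))
  have ρx : ∀ v, ρ (x K v) = if pos v = 0 then 1 else B (pos v) := fun v => by simp [ρ, x]
  have ρy : ∀ v, ρ (y K v) = if pos v = 0 then 1 else B (pos v) + B (pos v - 1) :=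
    fun v => by simp [ρ, y]
  have ρxc : ∀ j, 1 ≤ j → j ≤ N → ρ (x K (c j)) = B j := by
    intro j h1 h2
    rw [ρx, h.hc j h1 h2, if_neg (by omega)]
  have ρyc : ∀ j, 1 ≤ j → j ≤ N → ρ (y K (c j)) = B j + B (j - 1) := by
    intro j h1 h2
    rw [ρy, h.hc j h1 h2, if_neg (by omega)]
  have B0 : B 0 = 0 := by simp [B]
  have B1 : B 1 = 0 := by simp [B]
  have BN : B N = 0 := by simp [B]
  have ρz : ∀ j, j ≤ N → ρ (zz K c j) = B j := by
    intro j hj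
    by_cases h0 : j = 0
    · simp [h0, zz, B0]
    · rw [← hxz j (by omega), ρxc j (by omega) hj]
  have hspa : ∀ j, j ≤ N → B j - q (zz K c j) ∈
      Ideal.span (Set.range fun _ : Unit => q (zz K c 1)) := by
    intro j hj
    by_cases hj2 : 2 ≤ j ∧ j < N
    · simp [B, hj2]
    · simp only [B, hj2, if_false, zero_sub, neg_mem_iff]
      have : j = 0 ∨ j = 1 ∨ j = N := by omega
      rcases this with rfl | rfl | rfl
      · rw [z0]; exact Ideal.zero_mem _
      · exact Ideal.subset_span ⟨(), rfl⟩
      · rw [zN]; exact Ideal.zero_mem _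
  have hspb : ∀ j, B j ∈
      Ideal.span (Set.range fun k : Fin (N - 2) => q (zz K c (k.1 + 2))) := by
    intro j
    by_cases hj2 : 2 ≤ j ∧ j < N
    · simp only [B, hj2, and_self, if_true]
      refine Ideal.subset_span ⟨⟨j - 2, by omega⟩, ?_⟩
      have : j - 2 + 2 = j := by omega
      simp [this]
    · simp [B, hj2]
  have vcase : ∀ v, pos v = 0 ∨ ∃ j, j < N ∧ c (j + 1) = v ∧ pos v = j + 1 := by
    intro v
    by_cases hv : pos v = 0
    · exact Or.inl hv
    · obtain ⟨j, hj⟩ : ∃ j, pos v = j + 1 := ⟨pos v - 1, by omega⟩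
      have := h.hpos v hv
      rw [hj] at this
      exact Or.inr ⟨j, by omega, this.2, hj⟩
  let ev : MvPolynomial (V ⊕ V) K →ₐ[K] K := aeval (Sum.elim
    (fun v => if pos v = 0 then 1 else 0) (fun v => if pos v = 0 then 1 else 0))
  have evx : ∀ v, ev (x K v) = if pos v = 0 then 1 else 0 := fun v => by simp [ev, x]
  have evy : ∀ v, ev (y K v) = if pos v = 0 then 1 else 0 := fun v => by simp [ev, y]
  have evz : ∀ j, 1 ≤ j → j ≤ N → ev (zz K c j) = 0 := by
    intro j h1 h2
    rw [← hxz j h1, evx, h.hc j h1 h2, if_neg (by omega)]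
  have Tf : ∀ k f, (T k f).fst = ev f := by
    intro k f
    refine fst_aeval _ _ ?_ f
    rintro (v | v)
    · simp only [Sum.elim_inl]; split_ifs <;> simp
    · simp only [Sum.elim_inr]; split_ifs <;> simp
  refine framework hFI' (α := Unit) (β := Fin (N - 2)) (fun _ => zz K c 1)
    (fun k => zz K c (k.1 + 2)) () ⟨0, by omega⟩ ev (fun _ => evz 1 le_rfl (by omega))
    (fun k => evz _ (by omega) (by omega)) ?_ (fun _ => T 1) (fun _ => Tf 1)
    (fun _ => TJ 1 le_rfl (by omega)) ?_ ?_ (fun k => T (k.1 + 2)) (fun k => Tf _)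
    (fun k => TJ _ (by omega) (by omega)) ?_ ?_ ρ ?_ ?_ ?_ ?_ ?_ (Or.inl ?_)
  · intro _ k
    rw [← Ideal.Quotient.eq_zero_iff_mem, map_mul]
    exact zz0 _ _ (by omega) (by omega)
  · intro _
    rw [Tz 1 1 le_rfl (by omega), if_pos rfl]
  · intro i j hij; exact (hij rfl).elim
  · intro k
    rw [Tz _ _ (by omega) (by omega), if_pos rfl]
  · intro i j hij
    rw [Tz _ _ (by omega) (by omega), if_neg]
    intro e; exact hij (Fin.ext (by omega))
  · refine killJ ρ (hkill ρ ?_ ?_ ?_ ?_) ?_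
    · intro v hv; rw [ρx, if_pos hv]
    · intro v hv; rw [ρy, if_pos hv]
    · intro i j h1 h2 h3 h4
      rw [ρxc i h1 h2, ρxc j h3 h4, ρyc i h1 h2, ρyc j h3 h4]
      simp only [mul_add, BB]
    · intro _
      rw [ρxc 1 le_rfl (by omega), ρyc 1 le_rfl (by omega), B1, Nat.sub_self, B0, add_zero]
    · intro j hj
      by_cases h1 : j = N
      · simp only [th, h1, if_true]
        rw [ρz N le_rfl, BN]
      · simp only [th, h1, if_false, map_sub]
        rw [ρz j hj, ρz (j + 1) (by omega), ρyc (j + 1) (by omega) (by omega), Nat.add_sub_cancel]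
        ring
  · intro _
    rw [ρz 1 (by omega), B1]
  · intro k
    rw [ρz _ (by omega)]
    have : k.1 + 2 < N := by omega
    simp only [B, this, and_true]
    rw [if_pos (by omega)]
  · rintro (v | v)
    · change ρ (x K v) - q (x K v) ∈ _
      rcases vcase v with hv | ⟨j, hj, hv, hp⟩
      · rw [ρx, if_pos hv, q1 _ (Or.inl (Or.inr ⟨v, hv, rfl⟩)), sub_self]; exact Ideal.zero_mem _
      · rw [← hv, ρxc _ (by omega) (by omega), hxz _ (by omega)]
        exact hspa _ hj
    · change ρ (y K v) - q (y K v) ∈ _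
      rcases vcase v with hv | ⟨j, hj, hv, hp⟩
      · rw [ρy, if_pos hv, q1 _ (Or.inr ⟨v, hv, rfl⟩), sub_self]; exact Ideal.zero_mem _
      · rw [← hv, ρyc _ (by omega) (by omega), qy j hj, Nat.add_sub_cancel]
        have := Ideal.add_mem _ (hspa (j + 1) hj) (hspa j hj.le)
        convert this using 1
        ring
  · rintro (v | v)
    · change ρ (x K v) - algebraMap K _ (ev (x K v)) ∈ _
      rcases vcase v with hv | ⟨j, hj, hv, hp⟩
      · rw [ρx, evx, if_pos hv, if_pos hv, map_one, sub_self]; exact Ideal.zero_mem _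
      · rw [ρx, evx, if_neg (by omega), if_neg (by omega), map_zero, sub_zero]
        exact hspb _
    · change ρ (y K v) - algebraMap K _ (ev (y K v)) ∈ _
      rcases vcase v with hv | ⟨j, hj, hv, hp⟩
      · rw [ρy, evy, if_pos hv, if_pos hv, map_one, sub_self]; exact Ideal.zero_mem _
      · rw [ρy, evy, if_neg (by omega), if_neg (by omega), map_zero, sub_zero]
        exact Ideal.add_mem _ (hspb _) (hspb _)
  · rw [← Ideal.Quotient.eq_zero_iff_mem, map_mul]
    exact zz0 _ _ (by omega) (by omega)
end D3
end BEI

namespace BEI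
section C1
open MvPolynomial
variable {K : Type} [Field K] {σ : Type}

theorem sum_deg (d : σ →₀ ℕ) : (d.sum fun _ e => (e : ℤ)) = ((d.degree : ℕ) : ℤ) := by
  simp [Finsupp.sum, Finsupp.degree_apply]

theorem isHomZ_nat {p : MvPolynomial σ K} {k : ℕ} : IsHomZ p (k : ℤ) ↔ p.IsHomogeneous k := by
  constructor
  · intro h d hd
    have := h d (mem_support_iff.2 hd)
    rw [sum_deg] at this
    change Finsupp.weight (fun _ => 1) d = k
    rw [← Finsupp.degree_eq_weight_one]
    exact_mod_cast this
  · intro h d hd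
    have := h (mem_support_iff.1 hd)
    rw [sum_deg]
    change Finsupp.weight (fun _ => 1) d = k at this
    rw [← Finsupp.degree_eq_weight_one] at this
    exact_mod_cast this

theorem isHomZ_cases {p : MvPolynomial σ K} {z : ℤ} (h : IsHomZ p z) :
    p = 0 ∨ ∃ k : ℕ, z = k ∧ p.IsHomogeneous k := by
  by_cases hp : p = 0
  · exact Or.inl hp
  · right
    obtain ⟨d, hd⟩ := MvPolynomial.support_nonempty.2 hp
    have := h d hd
    rw [sum_deg] at this
    refine ⟨d.degree, this.symm, ?_⟩
    rw [← isHomZ_nat, this]; exact h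

theorem isHomZ_zero (z : ℤ) : IsHomZ (0 : MvPolynomial σ K) z := (polyGr K σ z).zero_mem
theorem hom_add {p q : MvPolynomial σ K} {z : ℤ} (hp : IsHomZ p z) (hq : IsHomZ q z) :
    IsHomZ (p + q) z := (polyGr K σ z).add_mem hp hq
theorem hom_sub {p q : MvPolynomial σ K} {z : ℤ} (hp : IsHomZ p z) (hq : IsHomZ q z) :
    IsHomZ (p - q) z := (polyGr K σ z).sub_mem hp hq

theorem hom_mul {p q : MvPolynomial σ K} {a b : ℤ} (hp : IsHomZ p a) (hq : IsHomZ q b) :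
    IsHomZ (p * q) (a + b) := by
  rcases isHomZ_cases hp with rfl | ⟨k, rfl, hk⟩
  · rw [zero_mul]; exact isHomZ_zero _
  rcases isHomZ_cases hq with rfl | ⟨l, rfl, hl⟩
  · rw [mul_zero]; exact isHomZ_zero _
  rw [← Nat.cast_add, isHomZ_nat]
  exact hk.mul hl

/-- projection to a degree -/
noncomputable def pr (d : ℤ) : MvPolynomial σ K →+ MvPolynomial σ K :=
  if 0 ≤ d then (homogeneousComponent d.toNat).toAddMonoidHom else 0

theorem pr_hom (d : ℤ) (p : MvPolynomial σ K) : IsHomZ (pr d p) d := by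
  unfold pr
  split_ifs with h
  · obtain ⟨k, rfl⟩ := Int.eq_ofNat_of_zero_le h
    rw [isHomZ_nat]
    exact homogeneousComponent_isHomogeneous k p
  · exact isHomZ_zero _

theorem pr_of_hom {d e : ℤ} {p : MvPolynomial σ K} (h : IsHomZ p e) :
    pr d p = if d = e then p else 0 := by
  rcases isHomZ_cases h with rfl | ⟨k, rfl, hk⟩
  · simp
  · unfold pr
    by_cases h0 : 0 ≤ d
    · obtain ⟨l, rfl⟩ := Int.eq_ofNat_of_zero_le h0
      rw [if_pos h0]
      change homogeneousComponent l p = _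
      rw [homogeneousComponent_of_mem (n := k) hk]
      simp
    · rw [if_neg h0, if_neg (by omega)]; rfl

theorem pr_mul {e : ℤ} {q : MvPolynomial σ K} (hq : IsHomZ q e) (d : ℤ) (p : MvPolynomial σ K) :
    pr (d + e) (p * q) = pr d p * q := by
  induction p using MvPolynomial.monomial_add_induction_on with
  | C a =>
    have h : IsHomZ (C a : MvPolynomial σ K) 0 := by
      have := isHomZ_nat.2 (isHomogeneous_C σ a); simpa using this
    rw [pr_of_hom h, pr_of_hom (hom_mul h hq)]
    by_cases hd : d = 0
    · simp [hd]
    · rw [if_neg (by omega), if_neg hd, zero_mul]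
  | monomial_add a b f _ _ ih =>
    have h : IsHomZ (monomial a b) ((a.degree : ℕ) : ℤ) :=
      isHomZ_nat.2 (isHomogeneous_monomial b rfl)
    rw [add_mul, map_add, map_add, add_mul, ih, pr_of_hom h, pr_of_hom (hom_mul h hq)]
    congr 1
    by_cases hd : d = ((a.degree : ℕ) : ℤ)
    · simp [hd]
    · rw [if_neg (by omega), if_neg hd, zero_mul]

variable {B : Type}

noncomputable def cmp (dg : B → ℤ) (z : ℤ) : (B →₀ MvPolynomial σ K) →+ (B →₀ MvPolynomial σ K) :=
  Finsupp.liftAddHom fun b => (Finsupp.singleAddHom b).comp (pr (z - dg b))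

theorem cmp_single (dg : B → ℤ) (z : ℤ) (b : B) (p : MvPolynomial σ K) :
    cmp dg z (Finsupp.single b p) = Finsupp.single b (pr (z - dg b) p) := by
  simp [cmp]

theorem cmp_hom (dg : B → ℤ) (z : ℤ) (v : B →₀ MvPolynomial σ K) :
    FinsuppHomog dg (cmp dg z v) z := by
  classical
  induction v using Finsupp.induction_linear with
  | zero => intro b; simpa using isHomZ_zero _
  | add f g hf hg => intro b; rw [map_add]; exact hom_add (hf b) (hg b)
  | single b p =>
    intro b'
    rw [cmp_single, Finsupp.single_apply]
    split_ifs with h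
    · subst h; exact pr_hom _ _
    · exact isHomZ_zero _

theorem pr_lin (dg : B → ℤ) (z k : ℤ) (l : (B →₀ MvPolynomial σ K) →ₗ[MvPolynomial σ K] MvPolynomial σ K)
    (hl : ∀ b, IsHomZ (l (Finsupp.single b 1)) (dg b + k)) (v : B →₀ MvPolynomial σ K) :
    l (cmp dg z v) = pr (z + k) (l v) := by
  induction v using Finsupp.induction_linear with
  | zero => simp
  | add f g hf hg => simp only [map_add, hf, hg]
  | single b p =>
    rw [cmp_single]
    have e : ∀ p : MvPolynomial σ K, l (Finsupp.single b p) = p * l (Finsupp.single b 1) := by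
      intro p
      have : Finsupp.single b p = p • Finsupp.single b (1 : MvPolynomial σ K) := by simp
      rw [this, map_smul, smul_eq_mul]
    rw [e, e p]
    have := pr_mul (hl b) (z - dg b) p
    rw [← this]
    congr 2
    ring

theorem lift_hom {B' : Type} (dg : B → ℤ) (dg' : B' → ℤ)
    (φ : (B →₀ MvPolynomial σ K) →ₗ[MvPolynomial σ K] (B' →₀ MvPolynomial σ K))
    (hφ : ∀ b, FinsuppHomog dg' (φ (Finsupp.single b 1)) (dg b)) (z : ℤ)
    (v : B →₀ MvPolynomial σ K) (hw : FinsuppHomog dg' (φ v) z) :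
    ∃ v', φ v' = φ v ∧ FinsuppHomog dg v' z := by
  refine ⟨cmp dg z v, ?_, cmp_hom _ _ _⟩
  ext1 b'
  have := pr_lin dg z (- dg' b') ((Finsupp.lapply b').comp φ)
    (fun b => by have := hφ b b'; rwa [sub_eq_add_neg] at this) v
  simp only [LinearMap.comp_apply, Finsupp.lapply_apply] at this
  rw [this, pr_of_hom (hw b'), if_pos (by ring)]

theorem fh_smul {dg : B → ℤ} {v : B →₀ MvPolynomial σ K} {z e : ℤ}
    {p : MvPolynomial σ K} (hp : IsHomZ p e) (hv : FinsuppHomog dg v z) :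
    FinsuppHomog dg (p • v) (e + z) := by
  intro b
  have := hom_mul hp (hv b)
  rw [Finsupp.smul_apply, smul_eq_mul]
  convert this using 1
  ring

theorem fh_sub {dg : B → ℤ} {v w : B →₀ MvPolynomial σ K} {z : ℤ}
    (hv : FinsuppHomog dg v z) (hw : FinsuppHomog dg w z) : FinsuppHomog dg (v - w) z :=
  fun b => hom_sub (hv b) (hw b)

theorem fh_add {dg : B → ℤ} {v w : B →₀ MvPolynomial σ K} {z : ℤ}
    (hv : FinsuppHomog dg v z) (hw : FinsuppHomog dg w z) : FinsuppHomog dg (v + w) z :=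
  fun b => hom_add (hv b) (hw b)

end C1
end BEI

namespace BEI
section C2
open MvPolynomial
variable {K : Type} [Field K] {σ : Type}

theorem koszul_false (J : Ideal (MvPolynomial σ K)) (F : GradedFreeResolution (K := K) (σ := σ) (idealGr J))
    (hF : ∀ i b, F.dg i b ≤ 3 + i) {R : Type} [CommRing R] [Algebra (MvPolynomial σ K) R]
    (ε : R →+* K) (hε : ∀ p : MvPolynomial σ K, ∀ z : ℤ, 1 ≤ z → IsHomZ p z →
      ε (algebraMap _ R p) = 0)
    (g1 g2 g3 : R) (f1 f2 f3 : J)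
    (hf1 : IsHomZ f1.1 2) (hf2 : IsHomZ f2.1 2) (hf3 : IsHomZ f3.1 2)
    (hg1 : algebraMap _ R f1.1 = g1) (hg2 : algebraMap _ R f2.1 = g2)
    (hg3 : algebraMap _ R f3.1 = g3)
    (hJ : ∀ f ∈ J, ∃ a b c, algebraMap _ R f = g1 * a + g2 * b + g3 * c)
    (r1 : ∀ a, g1 * a = 0 → a = 0) (r2 : ∀ a b, g2 * a = g1 * b → ∃ c, a = g1 * c)
    (r3 : ∀ a b c, g3 * a = g1 * b + g2 * c → ∃ u v, a = g1 * u + g2 * v) : False := by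
  classical
  have E1 : ∀ a b c, g1 * a + g2 * b + g3 * c = 0 → ∃ p q r, a = - p * g2 - q * g3 ∧
      b = p * g1 - r * g3 ∧ c = q * g1 + r * g2 := by
    intro a b c h
    obtain ⟨q, r, hc⟩ := r3 c (-a) (-b) (by linear_combination h)
    obtain ⟨p, hp⟩ := r2 (b + r * g3) (-(a + q * g3)) (by rw [hc] at h; linear_combination h)
    have := r1 (a + q * g3 + g2 * p) (by
      rw [hc] at h; linear_combination h - g2 * hp)
    exact ⟨p, q, r, by linear_combination this, by linear_combination hp,
      by linear_combination hc⟩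
  have E2 : ∀ p q r, - p * g2 - q * g3 = 0 → p * g1 - r * g3 = 0 → q * g1 + r * g2 = 0 →
      ∃ h, p = h * g3 ∧ q = - h * g2 ∧ r = h * g1 := by
    intro p q r e1 e2 e3
    obtain ⟨h, hr⟩ := r2 r (-q) (by linear_combination e3)
    have hq := r1 (q + h * g2) (by rw [hr] at e3; linear_combination e3)
    have hp := r1 (p - h * g3) (by rw [hr] at e2; linear_combination e2)
    exact ⟨h, by linear_combination hp, by linear_combination hq, by linear_combination hr⟩
  -- chain map
  choose a0 b0 c0 h0 using fun b => hJ _ (F.π (Finsupp.single b 1)).2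
  let ψ0 : (F.B 0 →₀ MvPolynomial σ K) →ₗ[MvPolynomial σ K] R × R × R :=
    Finsupp.linearCombination _ fun b => (a0 b, b0 b, c0 b)
  have C0 : ∀ v, g1 * (ψ0 v).1 + g2 * (ψ0 v).2.1 + g3 * (ψ0 v).2.2 =
      algebraMap _ R (F.π v : MvPolynomial σ K) := by
    intro v
    induction v using Finsupp.induction_linear with
    | zero => simp
    | add f g hf hg =>
      simp only [map_add, Prod.fst_add, Prod.snd_add, Submodule.coe_add]
      linear_combination hf + hg
    | single b p =>
      have e : Finsupp.single b p = p • Finsupp.single b (1 : MvPolynomial σ K) := by simp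
      have e2 : ψ0 (Finsupp.single b p) = p • (a0 b, b0 b, c0 b) := by simp [ψ0]
      rw [e2, e, map_smul]
      simp only [Prod.smul_fst, Prod.smul_snd, Submodule.coe_smul]
      rw [smul_eq_mul, map_mul, h0]
      simp only [Algebra.smul_def]
      ring
  have D0 : ∀ v, F.π (F.φ 0 v) = 0 := fun v => (F.exact0 _).2 ⟨v, rfl⟩
  have D1 : ∀ v, F.φ 0 (F.φ 1 v) = 0 := fun v => (F.exact 0 _).2 ⟨v, rfl⟩
  choose a1 b1 c1 h1 h1' h1'' using fun b => E1 _ _ _ (by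
    have := C0 (F.φ 0 (Finsupp.single b 1))
    rw [D0] at this
    simpa using this)
  let ψ1 : (F.B 1 →₀ MvPolynomial σ K) →ₗ[MvPolynomial σ K] R × R × R :=
    Finsupp.linearCombination _ fun b => (a1 b, b1 b, c1 b)
  have C1 : ∀ v, (ψ0 (F.φ 0 v)).1 = - (ψ1 v).1 * g2 - (ψ1 v).2.1 * g3 ∧
      (ψ0 (F.φ 0 v)).2.1 = (ψ1 v).1 * g1 - (ψ1 v).2.2 * g3 ∧
      (ψ0 (F.φ 0 v)).2.2 = (ψ1 v).2.1 * g1 + (ψ1 v).2.2 * g2 := by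
    intro v
    induction v using Finsupp.induction_linear with
    | zero => simp
    | add f g hf hg =>
      obtain ⟨x1, x2, x3⟩ := hf
      obtain ⟨y1, y2, y3⟩ := hg
      simp only [map_add, Prod.fst_add, Prod.snd_add]
      exact ⟨by linear_combination x1 + y1, by linear_combination x2 + y2,
        by linear_combination x3 + y3⟩
    | single b p =>
      have e : Finsupp.single b p = p • Finsupp.single b (1 : MvPolynomial σ K) := by simp
      have e2 : ψ1 (Finsupp.single b p) = p • (a1 b, b1 b, c1 b) := by simp [ψ1]
      rw [e2, e, map_smul, map_smul]
      simp only [Prod.smul_fst, Prod.smul_snd]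
      simp only [Algebra.smul_def]
      refine ⟨?_, ?_, ?_⟩
      · linear_combination (algebraMap _ R p) * h1 b
      · linear_combination (algebraMap _ R p) * h1' b
      · linear_combination (algebraMap _ R p) * h1'' b
  choose a2 h2 h2' h2'' using fun b => E2 _ _ _
    (by have := (C1 (F.φ 1 (Finsupp.single b 1))).1
        rw [D1] at this
        simpa using this.symm)
    (by have := (C1 (F.φ 1 (Finsupp.single b 1))).2.1
        rw [D1] at this
        simpa using this.symm)
    (by have := (C1 (F.φ 1 (Finsupp.single b 1))).2.2
        rw [D1] at this
        simpa using this.symm)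
  let ψ2 : (F.B 2 →₀ MvPolynomial σ K) →ₗ[MvPolynomial σ K] R :=
    Finsupp.linearCombination _ fun b => a2 b
  have C2 : ∀ v, (ψ1 (F.φ 1 v)).2.2 = ψ2 v * g1 := by
    intro v
    induction v using Finsupp.induction_linear with
    | zero => simp
    | add f g hf hg =>
      simp only [map_add, Prod.snd_add]
      linear_combination hf + hg
    | single b p =>
      have e : Finsupp.single b p = p • Finsupp.single b (1 : MvPolynomial σ K) := by simp
      have e2 : ψ2 (Finsupp.single b p) = p • (a2 b) := by simp [ψ2]
      rw [e2, e, map_smul, map_smul]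
      simp only [Prod.smul_snd]
      simp only [Algebra.smul_def]
      linear_combination (algebraMap _ R p) * h2'' b
  -- lifts
  have L0 : ∀ f : J, IsHomZ f.1 2 → ∃ e, F.π e = f ∧ FinsuppHomog (F.dg 0) e 2 := by
    intro f hf
    obtain ⟨v, hv⟩ := F.π_surj f
    refine ⟨cmp (F.dg 0) 2 v, ?_, cmp_hom _ _ _⟩
    apply Subtype.ext
    have := pr_lin (F.dg 0) 2 0 (J.subtype.comp F.π) (fun b => by
      have := F.π_graded b
      rw [add_zero]; exact this) v
    simp only [LinearMap.comp_apply, Submodule.subtype_apply] at this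
    rw [this, hv, pr_of_hom hf, if_pos (by ring)]
  obtain ⟨e1, he1, H1⟩ := L0 f1 hf1
  obtain ⟨e2, he2, H2⟩ := L0 f2 hf2
  obtain ⟨e3, he3, H3⟩ := L0 f3 hf3
  have U : ∀ (e : F.B 0 →₀ MvPolynomial σ K) (u1 u2 u3 : R),
      algebraMap _ R (F.π e : MvPolynomial σ K) = g1 * u1 + g2 * u2 + g3 * u3 →
      ∃ p q r, (ψ0 e).1 = u1 - p * g2 - q * g3 ∧
      (ψ0 e).2.1 = u2 + p * g1 - r * g3 ∧ (ψ0 e).2.2 = u3 + q * g1 + r * g2 := by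
    intro e u1 u2 u3 h
    obtain ⟨p, q, r, x1, x2, x3⟩ := E1 ((ψ0 e).1 - u1) ((ψ0 e).2.1 - u2) ((ψ0 e).2.2 - u3)
      (by linear_combination C0 e + h)
    exact ⟨p, q, r, by linear_combination x1, by linear_combination x2, by linear_combination x3⟩
  obtain ⟨p1, q1, s1, u1, u1', u1''⟩ := U e1 1 0 0 (by rw [he1, hg1]; ring)
  obtain ⟨p2, q2, s2, u2, u2', u2''⟩ := U e2 0 1 0 (by rw [he2, hg2]; ring)
  obtain ⟨p3, q3, s3, u3, u3', u3''⟩ := U e3 0 0 1 (by rw [he3, hg3]; ring)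
  have L1 : ∀ (f f' : J) e e', IsHomZ f.1 2 → IsHomZ f'.1 2 → F.π e = f → F.π e' = f' →
      FinsuppHomog (F.dg 0) e 2 → FinsuppHomog (F.dg 0) e' 2 →
      ∃ v, F.φ 0 v = f.1 • e' - f'.1 • e ∧ FinsuppHomog (F.dg 1) v 4 := by
    intro f f' e e' hf hf' he he' H H'
    obtain ⟨v, hv⟩ := (F.exact0 (f.1 • e' - f'.1 • e)).1 (by
      rw [map_sub, map_smul, map_smul, he, he']
      apply Subtype.ext
      simp [mul_comm])
    obtain ⟨v', h3, h4⟩ := lift_hom (F.dg 1) (F.dg 0) (F.φ 0) (F.φ_graded 0) 4 v (by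
      rw [hv]
      exact fh_sub (fh_smul hf H') (fh_smul hf' H))
    exact ⟨v', h3.trans hv, h4⟩
  obtain ⟨v12, w12, G12⟩ := L1 f1 f2 e1 e2 hf1 hf2 he1 he2 H1 H2
  obtain ⟨v13, w13, G13⟩ := L1 f1 f3 e1 e3 hf1 hf3 he1 he3 H1 H3
  obtain ⟨v23, w23, G23⟩ := L1 f2 f3 e2 e3 hf2 hf3 he2 he3 H2 H3
  obtain ⟨h', hh'⟩ := (F.exact 0 (f3.1 • v12 - f2.1 • v13 + f1.1 • v23)).1 (by
    rw [map_add, map_sub, map_smul, map_smul, map_smul, w12, w13, w23]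
    simp only [smul_sub, smul_smul]
    rw [mul_comm f3.1 f1.1, mul_comm f3.1 f2.1, mul_comm f2.1 f1.1]
    abel)
  obtain ⟨h, hh, Hh⟩ := lift_hom (F.dg 2) (F.dg 1) (F.φ 1) (F.φ_graded 1) 6 h' (by
    rw [hh']
    exact fh_add (fh_sub (fh_smul hf3 G12) (fh_smul hf2 G13)) (fh_smul hf1 G23))
  rw [hh'] at hh
  -- the last components
  have Q : ∀ (v : F.B 1 →₀ MvPolynomial σ K) (p q r : R),
      (ψ0 (F.φ 0 v)).1 = - p * g2 - q * g3 → (ψ0 (F.φ 0 v)).2.1 = p * g1 - r * g3 →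
      (ψ0 (F.φ 0 v)).2.2 = q * g1 + r * g2 → ∃ t, (ψ1 v).2.2 = r + t * g1 := by
    intro v p q r x1 x2 x3
    obtain ⟨y1, y2, y3⟩ := C1 v
    obtain ⟨t, z1, z2, z3⟩ := E2 ((ψ1 v).1 - p) ((ψ1 v).2.1 - q) ((ψ1 v).2.2 - r)
      (by linear_combination x1 - y1) (by linear_combination x2 - y2)
      (by linear_combination x3 - y3)
    exact ⟨t, by linear_combination z3⟩
  have ψs : ∀ (f f' : J) e e', ψ0 (f.1 • e' - f'.1 • e) =
      (algebraMap _ R f.1 * (ψ0 e').1 - algebraMap _ R f'.1 * (ψ0 e).1,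
       algebraMap _ R f.1 * (ψ0 e').2.1 - algebraMap _ R f'.1 * (ψ0 e).2.1,
       algebraMap _ R f.1 * (ψ0 e').2.2 - algebraMap _ R f'.1 * (ψ0 e).2.2) := by
    intro f f' e e'
    rw [map_sub, map_smul, map_smul]
    ext <;> simp [Algebra.smul_def]
  obtain ⟨t12, ht12⟩ := Q v12 (1 + g1 * p2 - g2 * p1) (g1 * q2 - g2 * q1) (g1 * s2 - g2 * s1)
    (by rw [w12, ψs, hg1, hg2]; simp only; rw [u1, u2]; ring)
    (by rw [w12, ψs, hg1, hg2]; simp only; rw [u1', u2']; ring)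
    (by rw [w12, ψs, hg1, hg2]; simp only; rw [u1'', u2'']; ring)
  obtain ⟨t13, ht13⟩ := Q v13 (g1 * p3 - g3 * p1) (1 + g1 * q3 - g3 * q1) (g1 * s3 - g3 * s1)
    (by rw [w13, ψs, hg1, hg3]; simp only; rw [u1, u3]; ring)
    (by rw [w13, ψs, hg1, hg3]; simp only; rw [u1', u3']; ring)
    (by rw [w13, ψs, hg1, hg3]; simp only; rw [u1'', u3'']; ring)
  obtain ⟨t23, ht23⟩ := Q v23 (g2 * p3 - g3 * p2) (g2 * q3 - g3 * q2) (1 + g2 * s3 - g3 * s2)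
    (by rw [w23, ψs, hg2, hg3]; simp only; rw [u2, u3]; ring)
    (by rw [w23, ψs, hg2, hg3]; simp only; rw [u2', u3']; ring)
    (by rw [w23, ψs, hg2, hg3]; simp only; rw [u2'', u3'']; ring)
  have key := C2 h
  rw [hh, map_add, map_sub, map_smul, map_smul, map_smul] at key
  simp only [Prod.snd_add, Prod.snd_sub, Prod.smul_snd] at key
  simp only [Algebra.smul_def, hg1, hg2, hg3] at key
  rw [ht12, ht13, ht23] at key
  have fin := r1 (1 + g3 * t12 - g2 * t13 + g1 * t23 - ψ2 h) (by linear_combination key)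
  have εg1 : ε g1 = 0 := by rw [← hg1]; exact hε _ 2 (by norm_num) hf1
  have εg2 : ε g2 = 0 := by rw [← hg2]; exact hε _ 2 (by norm_num) hf2
  have εg3 : ε g3 = 0 := by rw [← hg3]; exact hε _ 2 (by norm_num) hf3
  have εh : ε (ψ2 h) = 0 := by
    simp only [ψ2, Finsupp.linearCombination_apply, Finsupp.sum, map_sum]
    refine Finset.sum_eq_zero fun b _ => ?_
    rw [Algebra.smul_def, map_mul, hε _ (6 - F.dg 2 b) ?_ (Hh b), zero_mul]
    have := hF 2 b
    push_cast at this
    linarith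
  have := congrArg ε fin
  simp [εg1, εg2, εg3, εh] at this

end C2
end BEI

namespace BEI
section C3
open MvPolynomial
variable {K : Type} [Field K]

theorem nzd_mon {τ : Type} (A : Set (τ →₀ ℕ)) (i : τ) (k : ℕ) (hA : ∀ s ∈ A, s i = 0)
    (a : MvPolynomial τ K)
    (h : X i ^ k * a ∈ Ideal.span ((fun s => monomial s (1 : K)) '' A)) :
    a ∈ Ideal.span ((fun s => monomial s (1 : K)) '' A) := by
  classical
  rw [mem_ideal_span_monomial_image] at h ⊢
  intro m hm
  obtain ⟨s, hs, hle⟩ := h (Finsupp.single i k + m) (by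
    rw [mem_support_iff, X_pow_eq_monomial, coeff_monomial_mul, one_mul]
    exact mem_support_iff.1 hm)
  refine ⟨s, hs, fun j => ?_⟩
  by_cases hj : j = i
  · subst hj; rw [hA s hs]; exact Nat.zero_le _
  · have := hle j
    simpa [Finsupp.single_apply, Ne.symm hj] using this

theorem reg2 (a b : MvPolynomial (Fin 3) K) (h : X 2 ^ 2 * a = X 0 ^ 2 * b) :
    ∃ c, a = X 0 ^ 2 * c := by
  have e : (fun s => monomial s (1 : K)) '' {Finsupp.single (0 : Fin 3) 2} = {X 0 ^ 2} := by
    simp [X_pow_eq_monomial]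
  have := nzd_mon (K := K) {Finsupp.single (0 : Fin 3) 2} 2 2 (by simp) a (by
    rw [e, Ideal.mem_span_singleton]; exact ⟨b, h⟩)
  rw [e, Ideal.mem_span_singleton] at this
  exact this

theorem reg3 (e : K) (a b c : MvPolynomial (Fin 3) K)
    (h : (X 1 ^ 2 - C e * X 0 * X 2) * a = X 0 ^ 2 * b + X 2 ^ 2 * c) :
    ∃ u v, a = X 0 ^ 2 * u + X 2 ^ 2 * v := by
  have e' : (fun s => monomial s (1 : K)) '' {Finsupp.single (0 : Fin 3) 2, Finsupp.single 2 2}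
      = {X 0 ^ 2, X 2 ^ 2} := by
    simp [X_pow_eq_monomial, Set.image_insert_eq]
  have := nzd_mon (K := K) {Finsupp.single (0 : Fin 3) 2, Finsupp.single 2 2} 1 4
    (by simp) a (by
      rw [e', Ideal.mem_span_pair]
      refine ⟨(X 1 ^ 2 + C e * X 0 * X 2) * b + C e ^ 2 * X 2 ^ 2 * a,
        (X 1 ^ 2 + C e * X 0 * X 2) * c, ?_⟩
      linear_combination (X 1 ^ 2 + C e * X 0 * X 2) * (-h))
  rw [e', Ideal.mem_span_pair] at this
  obtain ⟨u, v, h⟩ := this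
  exact ⟨u, v, by rw [← h]; ring⟩

theorem regfalse {V : Type} {G : SimpleGraph V}
    (F : GradedFreeResolution (K := K) (σ := V ⊕ V) (idealGr (Ideal.span (edges K G))))
    (hF : ∀ i b, F.dg i b ≤ 3 + i) (px py : V → MvPolynomial (Fin 3) K)
    (hx : ∀ v, constantCoeff (px v) = 0) (hy : ∀ v, constantCoeff (py v) = 0) (e : K)
    (a1 b1 a2 b2 a3 b3 : V) (h1 : G.Adj a1 b1) (h2 : G.Adj a2 b2) (h3 : G.Adj a3 b3)
    (e1 : px a1 * py b1 - px b1 * py a1 = X 0 ^ 2)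
    (e2 : px a2 * py b2 - px b2 * py a2 = X 2 ^ 2)
    (e3 : px a3 * py b3 - px b3 * py a3 = X 1 ^ 2 - C e * X 0 * X 2)
    (H : ∀ i j, G.Adj i j → px i * py j - px j * py i ∈
      Ideal.span {X 0 ^ 2, X 2 ^ 2, X 1 ^ 2 - C e * X 0 * X 2}) : False := by
  let Φ : MvPolynomial (V ⊕ V) K →ₐ[K] MvPolynomial (Fin 3) K := aeval (Sum.elim px py)
  have hΦx : ∀ v, Φ (x K v) = px v := fun v => by simp [Φ, x]
  have hΦy : ∀ v, Φ (y K v) = py v := fun v => by simp [Φ, y]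
  have hΦ : ∀ i j, Φ (x K i * y K j - x K j * y K i) = px i * py j - px j * py i := by
    intro i j; rw [map_sub, map_mul, map_mul, hΦx, hΦx, hΦy, hΦy]
  have hhom : ∀ i j : V, IsHomZ (x K i * y K j - x K j * y K i) 2 := by
    intro i j
    refine (isHomZ_nat (k := 2)).2 ?_
    exact ((isHomogeneous_X _ _).mul (isHomogeneous_X _ _)).sub
      ((isHomogeneous_X _ _).mul (isHomogeneous_X _ _))
  have hm : ∀ i j : V, G.Adj i j → x K i * y K j - x K j * y K i ∈ Ideal.span (edges K G) :=
    fun i j h => Ideal.subset_span ⟨i, j, h, rfl⟩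
  letI : Algebra (MvPolynomial (V ⊕ V) K) (MvPolynomial (Fin 3) K) := Φ.toRingHom.toAlgebra
  refine koszul_false (Ideal.span (edges K G)) F hF (R := MvPolynomial (Fin 3) K)
    constantCoeff ?_ (X 0 ^ 2) (X 2 ^ 2) (X 1 ^ 2 - C e * X 0 * X 2)
    ⟨_, hm _ _ h1⟩ ⟨_, hm _ _ h2⟩ ⟨_, hm _ _ h3⟩ (hhom _ _) (hhom _ _) (hhom _ _)
    ((hΦ _ _).trans e1) ((hΦ _ _).trans e2) ((hΦ _ _).trans e3) ?_ ?_ reg2 (reg3 e)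
  · intro p z hz hp
    have : ∀ p, constantCoeff (Φ p) = constantCoeff p := by
      intro p
      have : (constantCoeff (R := K) (σ := Fin 3)).comp Φ.toRingHom = constantCoeff := by
        apply MvPolynomial.ringHom_ext
        · intro r; simp [Φ]
        · rintro (v | v) <;> simp [Φ, hx, hy]
      exact DFunLike.congr_fun this p
    change constantCoeff (Φ p) = 0
    rw [this]
    rcases isHomZ_cases hp with rfl | ⟨k, rfl, hk⟩
    · simp
    · rw [constantCoeff_eq]
      refine hk.coeff_eq_zero ?_
      simp; omega
  · intro f hf
    change ∃ a b c, Φ f = _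
    have : Ideal.span (edges K G) ≤ (Ideal.span
        {X 0 ^ 2, X 2 ^ 2, X 1 ^ 2 - C e * X 0 * X 2}).comap Φ := by
      rw [Ideal.span_le]
      rintro f ⟨i, j, h, rfl⟩
      have := H i j h
      rw [← hΦ] at this
      exact this
    have := this hf
    rw [Ideal.mem_comap, Ideal.mem_span_insert] at this
    obtain ⟨a, z, hz, h⟩ := this
    obtain ⟨b, c, hbc⟩ := Ideal.mem_span_pair.1 hz
    exact ⟨a, b, c, by rw [h, ← hbc]; ring⟩
  · intro a h
    rcases mul_eq_zero.1 h with h | h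
    · exact absurd h (pow_ne_zero _ (X_ne_zero _))
    · exact h

end C3
end BEI

namespace BEI
section C4
open MvPolynomial
variable {K : Type} [Field K] {V : Type} {G : SimpleGraph V}

def F3 (K : Type) [Field K] {V : Type} (G : SimpleGraph V) : Prop :=
  ∃ F : GradedFreeResolution (K := K) (σ := V ⊕ V) (idealGr (Ideal.span (edges K G))),
    ∀ i b, F.dg i b ≤ 3 + i

theorem mem3 {R : Type} [CommRing R] {a b c f : R}
    (h : f = 0 ∨ f = a ∨ f = - a ∨ f = b ∨ f = - b ∨ f = c ∨ f = - c) :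
    f ∈ Ideal.span {a, b, c} := by
  have ha : a ∈ Ideal.span {a, b, c} := Ideal.subset_span (by simp)
  have hb : b ∈ Ideal.span {a, b, c} := Ideal.subset_span (by simp)
  have hc : c ∈ Ideal.span {a, b, c} := Ideal.subset_span (by simp)
  rcases h with rfl | rfl | rfl | rfl | rfl | rfl | rfl
  · exact Ideal.zero_mem _
  · exact ha
  · exact neg_mem ha
  · exact hb
  · exact neg_mem hb
  · exact hc
  · exact neg_mem hc

theorem noP4 (h : F3 K G) {a b c d : V} (ab : G.Adj a b) (bc : G.Adj b c) (cd : G.Adj c d)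
    (nac : a ≠ c) (nad : a ≠ d) (nbd : b ≠ d)
    (ac : ¬ G.Adj a c) (ad : ¬ G.Adj a d) (bd : ¬ G.Adj b d) : False := by
  classical
  obtain ⟨F, hF⟩ := h
  have nab := ab.ne
  have nbc := bc.ne
  have ncd := cd.ne
  have ca := fun h => ac (G.adj_symm h)
  have da := fun h => ad (G.adj_symm h)
  have db := fun h => bd (G.adj_symm h)
  obtain ⟨px, pa, pb, pc, pd, p0⟩ : ∃ px : V → MvPolynomial (Fin 3) K, px a = X 0 ∧ px b = X 1 ∧
      px c = X 2 ∧ px d = 0 ∧ ∀ v, v ≠ a → v ≠ b → v ≠ c → v ≠ d → px v = 0 :=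
    ⟨fun v => if v = a then X 0 else if v = b then X 1 else if v = c then X 2 else 0,
      by simp, by simp [nab.symm], by simp [nac.symm, nbc.symm],
      by simp [nad.symm, nbd.symm, ncd.symm], fun v h1 h2 h3 h4 => by simp [h1, h2, h3]⟩
  obtain ⟨py, qa, qb, qc, qd, q0⟩ : ∃ px : V → MvPolynomial (Fin 3) K, px a = 0 ∧ px b = X 0 ∧
      px c = X 1 ∧ px d = X 2 ∧ ∀ v, v ≠ a → v ≠ b → v ≠ c → v ≠ d → px v = 0 :=
    ⟨fun v => if v = b then X 0 else if v = c then X 1 else if v = d then X 2 else 0,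
      by simp [nab, nac, nad], by simp, by simp [nbc.symm],
      by simp [nbd.symm, ncd.symm], fun v h1 h2 h3 h4 => by simp [h4, h2, h3]⟩
  have cs : ∀ v, v = a ∨ v = b ∨ v = c ∨ v = d ∨ (px v = 0 ∧ py v = 0) := by
    intro v
    by_cases h1 : v = a; · simp [h1]
    by_cases h2 : v = b; · simp [h2]
    by_cases h3 : v = c; · simp [h3]
    by_cases h4 : v = d; · simp [h4]
    simp [p0 v h1 h2 h3 h4, q0 v h1 h2 h3 h4]
  refine regfalse F hF px py ?_ ?_ 1 a b c d b c ab cd bc ?_ ?_ ?_ ?_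
  · intro v; rcases cs v with rfl | rfl | rfl | rfl | ⟨h, h'⟩ <;> simp [*]
  · intro v; rcases cs v with rfl | rfl | rfl | rfl | ⟨h, h'⟩ <;> simp [*]
  · rw [pa, pb, qa, qb]; ring
  · rw [pc, pd, qc, qd]; ring
  · rw [pb, pc, qb, qc, C_1]; ring
  · intro i j hij
    apply mem3
    rw [C_1]
    rcases cs i with rfl | rfl | rfl | rfl | ⟨h, h'⟩ <;>
    rcases cs j with rfl | rfl | rfl | rfl | ⟨k, k'⟩ <;>
    first
    | exact (G.irrefl hij).elim
    | contradiction
    | (simp only [*]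
       first
       | (left; ring1) | (right; left; ring1) | (right; right; left; ring1)
       | (right; right; right; left; ring1) | (right; right; right; right; left; ring1)
       | (right; right; right; right; right; left; ring1)
       | (right; right; right; right; right; right; ring1))

theorem noP3K2 (h : F3 K G) {a b c d e : V} (ab : G.Adj a b) (bc : G.Adj b c) (de : G.Adj d e)
    (nac : a ≠ c) (nad : a ≠ d) (nae : a ≠ e) (nbd : b ≠ d) (nbe : b ≠ e) (ncd : c ≠ d)
    (nce : c ≠ e) (ac : ¬ G.Adj a c) (ad : ¬ G.Adj a d) (ae : ¬ G.Adj a e) (bd : ¬ G.Adj b d)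
    (be : ¬ G.Adj b e) (cd : ¬ G.Adj c d) (ce : ¬ G.Adj c e) : False := by
  classical
  obtain ⟨F, hF⟩ := h
  have nab := ab.ne
  have nbc := bc.ne
  have nde := de.ne
  have ca := fun h => ac (G.adj_symm h)
  have da := fun h => ad (G.adj_symm h)
  have ea := fun h => ae (G.adj_symm h)
  have db := fun h => bd (G.adj_symm h)
  have eb := fun h => be (G.adj_symm h)
  have dc := fun h => cd (G.adj_symm h)
  have ec := fun h => ce (G.adj_symm h)
  obtain ⟨px, pa, pb, pc, pd, pe, p0⟩ : ∃ px : V → MvPolynomial (Fin 3) K, px a = X 0 ∧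
      px b = X 1 ∧ px c = 0 ∧ px d = X 2 ∧ px e = 0 ∧
      ∀ v, v ≠ a → v ≠ b → v ≠ c → v ≠ d → v ≠ e → px v = 0 :=
    ⟨fun v => if v = a then X 0 else if v = b then X 1 else if v = d then X 2 else 0,
      by simp, by simp [nab.symm], by simp [nac.symm, nbc.symm, ncd],
      by simp [nad.symm, nbd.symm], by simp [nae.symm, nbe.symm, nde.symm],
      fun v h1 h2 h3 h4 h5 => by simp [h1, h2, h4]⟩
  obtain ⟨py, qa, qb, qc, qd, qe, q0⟩ : ∃ px : V → MvPolynomial (Fin 3) K, px a = 0 ∧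
      px b = X 0 ∧ px c = X 1 ∧ px d = 0 ∧ px e = X 2 ∧
      ∀ v, v ≠ a → v ≠ b → v ≠ c → v ≠ d → v ≠ e → px v = 0 :=
    ⟨fun v => if v = b then X 0 else if v = c then X 1 else if v = e then X 2 else 0,
      by simp [nab, nac, nae], by simp, by simp [nbc.symm],
      by simp [nbd.symm, ncd.symm, nde], by simp [nbe.symm, nce.symm],
      fun v h1 h2 h3 h4 h5 => by simp [h5, h2, h3]⟩
  have cs : ∀ v, v = a ∨ v = b ∨ v = c ∨ v = d ∨ v = e ∨ (px v = 0 ∧ py v = 0) := by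
    intro v
    by_cases h1 : v = a; · simp [h1]
    by_cases h2 : v = b; · simp [h2]
    by_cases h3 : v = c; · simp [h3]
    by_cases h4 : v = d; · simp [h4]
    by_cases h5 : v = e; · simp [h5]
    simp [p0 v h1 h2 h3 h4 h5, q0 v h1 h2 h3 h4 h5]
  refine regfalse F hF px py ?_ ?_ 0 a b d e b c ab de bc ?_ ?_ ?_ ?_
  · intro v; rcases cs v with rfl | rfl | rfl | rfl | rfl | ⟨h, h'⟩ <;> simp [*]
  · intro v; rcases cs v with rfl | rfl | rfl | rfl | rfl | ⟨h, h'⟩ <;> simp [*]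
  · rw [pa, pb, qa, qb]; ring
  · rw [pd, pe, qd, qe]; ring
  · rw [pb, pc, qb, qc, C_0]; ring
  · intro i j hij
    apply mem3
    rw [C_0]
    rcases cs i with rfl | rfl | rfl | rfl | rfl | ⟨h, h'⟩ <;>
    rcases cs j with rfl | rfl | rfl | rfl | rfl | ⟨k, k'⟩ <;>
    first
    | exact (G.irrefl hij).elim
    | contradiction
    | (simp only [*]
       first
       | (left; ring1) | (right; left; ring1) | (right; right; left; ring1)
       | (right; right; right; left; ring1) | (right; right; right; right; left; ring1)
       | (right; right; right; right; right; left; ring1)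
       | (right; right; right; right; right; right; ring1))

theorem no3K2 (h : F3 K G) {a b c d e f : V} (ab : G.Adj a b) (cd : G.Adj c d) (ef : G.Adj e f)
    (nac : a ≠ c) (nad : a ≠ d) (nae : a ≠ e) (naf : a ≠ f) (nbc : b ≠ c) (nbd : b ≠ d)
    (nbe : b ≠ e) (nbf : b ≠ f) (nce : c ≠ e) (ncf : c ≠ f) (nde : d ≠ e) (ndf : d ≠ f)
    (ac : ¬ G.Adj a c) (ad : ¬ G.Adj a d) (ae : ¬ G.Adj a e) (af : ¬ G.Adj a f)
    (bc : ¬ G.Adj b c) (bd : ¬ G.Adj b d) (be : ¬ G.Adj b e) (bf : ¬ G.Adj b f)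
    (ce : ¬ G.Adj c e) (cf : ¬ G.Adj c f) (de : ¬ G.Adj d e) (df : ¬ G.Adj d f) : False := by
  classical
  obtain ⟨F, hF⟩ := h
  have nab := ab.ne
  have ncd := cd.ne
  have nef := ef.ne
  have ca := fun h => ac (G.adj_symm h)
  have da := fun h => ad (G.adj_symm h)
  have ea := fun h => ae (G.adj_symm h)
  have fa := fun h => af (G.adj_symm h)
  have cb := fun h => bc (G.adj_symm h)
  have db := fun h => bd (G.adj_symm h)
  have eb := fun h => be (G.adj_symm h)
  have fb := fun h => bf (G.adj_symm h)
  have ec := fun h => ce (G.adj_symm h)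
  have fc := fun h => cf (G.adj_symm h)
  have ed := fun h => de (G.adj_symm h)
  have fd := fun h => df (G.adj_symm h)
  obtain ⟨px, pa, pb, pc, pd, pe, pf, p0⟩ : ∃ px : V → MvPolynomial (Fin 3) K, px a = X 0 ∧
      px b = 0 ∧ px c = X 1 ∧ px d = 0 ∧ px e = X 2 ∧ px f = 0 ∧
      ∀ v, v ≠ a → v ≠ b → v ≠ c → v ≠ d → v ≠ e → v ≠ f → px v = 0 :=
    ⟨fun v => if v = a then X 0 else if v = c then X 1 else if v = e then X 2 else 0,
      by simp, by simp [nab.symm, nbc, nbe], by simp [nac.symm],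
      by simp [nad.symm, ncd.symm, nde], by simp [nae.symm, nce.symm],
      by simp [naf.symm, ncf.symm, nef.symm],
      fun v h1 h2 h3 h4 h5 h6 => by simp [h1, h3, h5]⟩
  obtain ⟨py, qa, qb, qc, qd, qe, qf, q0⟩ : ∃ px : V → MvPolynomial (Fin 3) K, px a = 0 ∧
      px b = X 0 ∧ px c = 0 ∧ px d = X 1 ∧ px e = 0 ∧ px f = X 2 ∧
      ∀ v, v ≠ a → v ≠ b → v ≠ c → v ≠ d → v ≠ e → v ≠ f → px v = 0 :=
    ⟨fun v => if v = b then X 0 else if v = d then X 1 else if v = f then X 2 else 0,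
      by simp [nab, nad, naf], by simp, by simp [nbc.symm, ncd, ncf],
      by simp [nbd.symm], by simp [nbe.symm, nde.symm, nef], by simp [nbf.symm, ndf.symm],
      fun v h1 h2 h3 h4 h5 h6 => by simp [h6, h2, h4]⟩
  have cs : ∀ v, v = a ∨ v = b ∨ v = c ∨ v = d ∨ v = e ∨ v = f ∨ (px v = 0 ∧ py v = 0) := by
    intro v
    by_cases h1 : v = a; · simp [h1]
    by_cases h2 : v = b; · simp [h2]
    by_cases h3 : v = c; · simp [h3]
    by_cases h4 : v = d; · simp [h4]
    by_cases h5 : v = e; · simp [h5]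
    by_cases h6 : v = f; · simp [h6]
    simp [p0 v h1 h2 h3 h4 h5 h6, q0 v h1 h2 h3 h4 h5 h6]
  refine regfalse F hF px py ?_ ?_ 0 a b e f c d ab ef cd ?_ ?_ ?_ ?_
  · intro v; rcases cs v with rfl | rfl | rfl | rfl | rfl | rfl | ⟨h, h'⟩ <;> simp [*]
  · intro v; rcases cs v with rfl | rfl | rfl | rfl | rfl | rfl | ⟨h, h'⟩ <;> simp [*]
  · rw [pa, pb, qa, qb]; ring
  · rw [pe, pf, qe, qf]; ring
  · rw [pc, pd, qc, qd, C_0]; ring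
  · intro i j hij
    apply mem3
    rw [C_0]
    rcases cs i with rfl | rfl | rfl | rfl | rfl | rfl | ⟨h, h'⟩ <;>
    rcases cs j with rfl | rfl | rfl | rfl | rfl | rfl | ⟨k, k'⟩ <;>
    first
    | exact (G.irrefl hij).elim
    | contradiction
    | (simp only [*]
       first
       | (left; ring1) | (right; left; ring1) | (right; right; left; ring1)
       | (right; right; right; left; ring1) | (right; right; right; right; left; ring1)
       | (right; right; right; right; right; left; ring1)
       | (right; right; right; right; right; right; ring1))
end C4
section C5
open MvPolynomial
variable {K : Type} [Field K] {σ : Type}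

theorem F3_of_reg {V : Type} {G : SimpleGraph V}
    (h : idealReg (Ideal.span (edges K G)) = 3) : F3 K G := by
  unfold idealReg moduleReg at h
  generalize hT : {r : ℤ | ∃ F : GradedFreeResolution (K := K) (σ := V ⊕ V)
    (idealGr (Ideal.span (edges K G))), ∀ i b, F.dg i b ≤ r + i} = T at h
  have h1 : T.Nonempty := by
    by_contra h'
    rw [Set.not_nonempty_iff_eq_empty] at h'
    rw [h', Int.csInf_empty] at h
    norm_num at h
  have h2 : BddBelow T := by
    by_contra h'
    rw [Int.csInf_of_not_bddBelow h'] at h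
    norm_num at h
  have := Int.csInf_mem h1 h2
  rw [h, ← hT] at this
  exact this

/-- a free ideal with generators of degree two has regularity at most two (or is zero) -/
theorem reg_ne (J : Ideal (MvPolynomial σ K)) (B : Type)
    (p : (B →₀ MvPolynomial σ K) →ₗ[MvPolynomial σ K] J) (hp : Function.Bijective p)
    (hd : ∀ b, IsHomZ (p (Finsupp.single b 1)).1 2) : idealReg J ≠ 3 := by
  intro h
  unfold idealReg moduleReg at h
  generalize hT : {r : ℤ | ∃ F : GradedFreeResolution (K := K) (σ := σ)
    (idealGr J), ∀ i b, F.dg i b ≤ r + i} = T at h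
  have h2 : BddBelow T := by
    by_contra h'
    rw [Int.csInf_of_not_bddBelow h'] at h
    norm_num at h
  have : (2 : ℤ) ∈ T := by
    rw [← hT]
    refine ⟨⟨fun i => Nat.casesOn i B fun _ => Empty, fun i => Nat.casesOn i (fun _ => 2)
      fun _ b => b.elim, fun _ => 0, p, fun i b => b.elim, hd, hp.2, ?_, ?_⟩, ?_⟩
    · intro v
      constructor
      · intro hv
        exact ⟨0, by rw [map_zero]; exact (hp.1 (hv.trans (map_zero p).symm)).symm⟩
      · rintro ⟨w, rfl⟩
        simp
    · intro i v
      have : v = 0 := Finsupp.ext fun b => b.elim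
      subst this
      exact ⟨fun _ => ⟨0, map_zero _⟩, fun _ => map_zero _⟩
    · rintro (_ | i) b
      · simp
      · exact b.elim
  have := csInf_le h2 this
  omega
end C5
end BEI

namespace BEI
section E1
variable {K : Type} [Field K] {V : Type} {G : SimpleGraph V}

theorem rin_closed {Y A : Set V} (hcl : ∀ i j, G.Adj i j → i ∈ A → j ∈ Y → j ∈ A) {c d : V}
    (hc : c ∈ A) (h : RIn G Y c d) : RIn G A c d := by
  induction h with
  | refl => exact Relation.ReflTransGen.refl
  | tail _ h ih =>
    have := RIn.mem ih hc
    exact Relation.ReflTransGen.tail ih ⟨h.1, this, hcl _ _ h.1 this h.2.2⟩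

theorem rin_step {Y : Set V} {a b : V} (h : G.Adj a b) (ha : a ∈ Y) (hb : b ∈ Y) : RIn G Y a b :=
  Relation.ReflTransGen.single ⟨h, ha, hb⟩

theorem clique_false [Fintype V] (hFI : FI (Ideal.span (edges K G))) (Q : Finset V) (u : V)
    (hu : u ∈ Q) (hQ : 3 ≤ Q.card) (hcl : ∀ a ∈ Q, ∀ b ∈ Q, a ≠ b → G.Adj a b)
    (h : (∀ i j, G.Adj i j → i ∈ Q → j ∈ Q) ∨
      ((∀ i j, G.Adj i j → i ∈ Q → j ∉ Q → i = u) ∧ ∃ d, d ∉ Q ∧ G.Adj u d))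
    (hr : ∀ c, c ∉ Q → ∀ d, d ∉ Q → RIn G Set.univ c d → RIn G {v | v ∉ Q} c d) : False := by
  classical
  let l := u :: (Q.erase u).toList
  have hmem : ∀ v, v ∈ l ↔ v ∈ Q := by
    intro v
    by_cases hv : v = u
    · subst hv; simp [l, hu]
    · simp [l, hv]
  have hnd : l.Nodup := by
    simp [l, Finset.nodup_toList]
  have hlen : l.length = Q.card := by
    rw [← List.toFinset_card_of_nodup hnd]
    congr 1
    ext v
    simp [hmem]
  let pos : V → ℕ := fun v => if v ∈ l then l.idxOf v + 1 else 0
  let c : ℕ → V := fun j => l.getD (j - 1) u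
  have hp0 : ∀ v, pos v = 0 ↔ v ∉ Q := by
    intro v
    by_cases hv : v ∈ Q <;> simp [pos, hmem, hv]
  have hp1 : ∀ v, pos v ≠ 0 ↔ v ∈ Q := by
    intro v
    rw [ne_eq, hp0, not_not]
  have hpc : ∀ j, 1 ≤ j → j ≤ l.length → pos (c j) = j := by
    intro j h1 h2
    have hj : j - 1 < l.length := by omega
    have e : c j = l[j - 1] := by simp [c, List.getD_eq_getElem, hj]
    rw [e]
    simp only [pos]
    rw [if_pos (List.getElem_mem _), hnd.idxOf_getElem]
    omega
  have hcp : ∀ v, pos v ≠ 0 → pos v ≤ l.length ∧ c (pos v) = v := by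
    intro v hv
    have hv' := (hmem v).2 ((hp1 v).1 hv)
    have : l.idxOf v < l.length := List.idxOf_lt_length_of_mem hv'
    simp only [pos, if_pos hv']
    refine ⟨by omega, ?_⟩
    simp only [c, Nat.add_sub_cancel]
    rw [List.getD_eq_getElem _ _ this, List.getElem_idxOf]
  have hpu : pos u = 1 := by simp [pos, l]
  have hc1 : c 1 = u := by simp [c, l]
  have hFI' : FI (Ideal.span (gens K G {v | pos v = 0} {v | pos v = 0})) := by
    refine FI_y (Fintype.finite inferInstance) hFI _ _ le_rfl ?_
    intro a ha b hb hab
    refine RIn.mono ?_ (hr a ((hp0 _).1 ha) b ((hp0 _).1 hb) hab)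
    intro v hv
    exact (hp0 v).2 hv
  rcases h with h | ⟨h, d, hd, hud⟩
  · refine CD.false (K := K) (G := G) (pos := pos) (c := c) (N := l.length)
      (s := Finset.range (l.length + 1)) ?_ hFI'
    refine ⟨by omega, hpc, hcp, ?_, ?_, ?_, ?_, ?_⟩
    · intro u v hu hv; exact hcl _ ((hp1 _).1 hu) _ ((hp1 _).1 hv)
    · intro j _ h; simp; omega
    · intro j h; simp at h; omega
    · intro i j hij hi hj
      exact absurd (h i j hij ((hp1 _).1 hi)) ((hp0 _).1 hj)
    · intro h; simp at h
  · refine CD.false (K := K) (G := G) (pos := pos) (c := c) (N := l.length)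
      (s := Finset.Icc 1 l.length) ?_ hFI'
    refine ⟨by omega, hpc, hcp, ?_, ?_, ?_, ?_, ?_⟩
    · intro u v hu hv; exact hcl _ ((hp1 _).1 hu) _ ((hp1 _).1 hv)
    · intro j h1 h; simp; omega
    · intro j h; simp at h; omega
    · intro i j hij hi hj
      rw [h i j hij ((hp1 _).1 hi) ((hp0 _).1 hj)]
      exact ⟨hpu, by simp⟩
    · intro _
      rw [hc1]
      exact ⟨d, (hp0 _).2 hd, hud⟩

theorem minsep [Fintype V] (X : Set V) (hconn : ∀ a ∈ X, ∀ b ∈ X, RIn G X a b)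
    (hnc : ∃ a ∈ X, ∃ b ∈ X, a ≠ b ∧ ¬ G.Adj a b) :
    ∃ T : Set V, T ⊆ X ∧ T.Nonempty ∧ (∃ a ∈ X \ T, ∃ b ∈ X \ T, ¬ RIn G (X \ T) a b) ∧
      ∀ t ∈ T, ∀ c ∈ X \ T, ∃ c', RIn G (X \ T) c c' ∧ G.Adj t c' := by
  classical
  let P : Set (Set V) := {T | T ⊆ X ∧ ∃ a ∈ X \ T, ∃ b ∈ X \ T, ¬ RIn G (X \ T) a b}
  have hP : P.Nonempty := by
    obtain ⟨a, ha, b, hb, hab, hadj⟩ := hnc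
    refine ⟨X \ {a, b}, Set.diff_subset, a, ⟨ha, by simp⟩, b, ⟨hb, by simp⟩, ?_⟩
    have e : X \ (X \ {a, b}) = {a, b} := by
      rw [Set.diff_diff_cancel_left]
      rintro v (rfl | rfl)
      · exact ha
      · exact hb
    rw [e]
    intro h
    have := rin_closed (A := {a}) (by
      rintro i j hij rfl (rfl | rfl)
      · rfl
      · exact absurd hij hadj) rfl h
    exact hab (RIn.mem this rfl).symm
  obtain ⟨T, hT⟩ := P.toFinite.exists_minimal hP
  obtain ⟨hTX, a, ha, b, hb, hab⟩ := hT.prop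
  refine ⟨T, hTX, ?_, ⟨a, ha, b, hb, hab⟩, ?_⟩
  · rw [Set.nonempty_iff_ne_empty]
    rintro rfl
    rw [Set.diff_empty] at *
    exact hab (hconn a ha b hb)
  · intro t ht c hc
    have hnot : T \ {t} ∉ P := by
      intro h
      have := hT.le_of_le h Set.diff_subset ht
      exact this.2 rfl
    have hr : RIn G (X \ (T \ {t})) c t := by
      by_contra h
      exact hnot ⟨Set.diff_subset.trans hTX, c, ⟨hc.1, fun h => hc.2 h.1⟩, t,
        ⟨hTX ht, fun h => h.2 rfl⟩, h⟩
    have gen : ∀ d, RIn G (X \ (T \ {t})) c d →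
        RIn G (X \ T) c d ∨ ∃ c', RIn G (X \ T) c c' ∧ G.Adj t c' := by
      intro d hd
      induction hd with
      | refl => exact Or.inl Relation.ReflTransGen.refl
      | @tail p q _ h ih =>
        rcases ih with ih | ih
        · have hp := RIn.mem ih hc
          by_cases hq : q = t
          · subst hq
            exact Or.inr ⟨p, ih, h.1.symm⟩
          · refine Or.inl (Relation.ReflTransGen.tail ih ⟨h.1, hp, h.2.2.1, fun h' => ?_⟩)
            exact h.2.2.2 ⟨h', hq⟩
        · exact Or.inr ih
    rcases gen t hr with h | h
    · exact absurd ht (RIn.mem h hc).2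
    · exact h
end E1
end BEI

namespace BEI
section E2
variable {K : Type} [Field K] {V : Type} {G : SimpleGraph V}

structure Split (G : SimpleGraph V) (u : V) (H1 H2 : Set V) : Prop where
  u1 : u ∉ H1
  u2 : u ∉ H2
  disj : ∀ v ∈ H1, v ∉ H2
  c1 : ∀ i j, G.Adj i j → i ∈ H1 → j ∈ H1 ∨ j = u
  c2 : ∀ i j, G.Adj i j → i ∈ H2 → j ∈ H2 ∨ j = u
  cu : ∀ j, G.Adj u j → j ∈ H1 ∨ j ∈ H2
  k1 : ∀ a ∈ H1, ∀ b ∈ H1, RIn G H1 a b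
  k2 : ∀ a ∈ H2, ∀ b ∈ H2, RIn G H2 a b
  n1 : ∃ c ∈ H1, G.Adj u c
  n2 : ∃ c ∈ H2, G.Adj u c

variable {u : V} {H1 H2 : Set V}

theorem Split.swap (h : Split G u H1 H2) : Split G u H2 H1 :=
  ⟨h.u2, h.u1, fun v h2 h1 => h.disj v h1 h2, h.c2, h.c1, fun j hj => (h.cu j hj).symm,
    h.k2, h.k1, h.n2, h.n1⟩

theorem Split.all (h : Split G u H1 H2) (hF : F3 K G) : ∀ v ∈ H1, G.Adj u v := by
  obtain ⟨c, hc, huc⟩ := h.n1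
  obtain ⟨d, hd, hud⟩ := h.n2
  intro v hv
  have := h.k1 c hc v hv
  clear hv
  have gen : v ∈ H1 ∧ G.Adj u v := by
    induction this with
    | refl => exact ⟨hc, huc⟩
    | @tail p q _ hpq ih =>
      refine ⟨hpq.2.2, ?_⟩
      by_contra hq
      have hdq : ∀ w ∈ H1, ¬ G.Adj d w := by
        intro w hw hdw
        rcases h.c2 _ _ hdw hd with h' | h'
        · exact h.disj w hw h'
        · exact h.u1 (h' ▸ hw)
      have hne : ∀ w ∈ H1, d ≠ w := by
        rintro w hw rfl
        exact h.disj _ hw hd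
      exact noP4 hF hud.symm ih.2 hpq.1 (hne _ ih.1) (hne _ hpq.2.2)
        (fun e => h.u1 (e ▸ hpq.2.2)) (hdq _ ih.1) (hdq _ hpq.2.2) hq
  exact gen.2

theorem Split.reach (h : Split G u H1 H2) : ∀ c, c ∉ insert u H1 → ∀ d, d ∉ insert u H1 →
    RIn G Set.univ c d → RIn G (insert u H1)ᶜ c d := by
  intro c hc d hd hcd
  have hcl : ∀ i j, G.Adj i j → i ∈ insert u (H1 ∪ H2) → j ∈ insert u (H1 ∪ H2) := by
    rintro i j hij (rfl | hi | hi)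
    · exact Or.inr (h.cu j hij)
    · rcases h.c1 _ _ hij hi with h' | h'
      · exact Or.inr (Or.inl h')
      · exact Or.inl h'
    · rcases h.c2 _ _ hij hi with h' | h'
      · exact Or.inr (Or.inr h')
      · exact Or.inl h'
  by_cases h2 : c ∈ H2
  · have : RIn G (insert u (H1 ∪ H2)) c d :=
      rin_closed (fun i j hij hi _ => hcl i j hij hi) (Or.inr (Or.inr h2)) hcd
    have := RIn.mem this (Or.inr (Or.inr h2))
    have hd2 : d ∈ H2 := by
      rcases this with h' | h' | h'
      · exact absurd (Or.inl h') hd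
      · exact absurd (Or.inr h') hd
      · exact h'
    refine RIn.mono ?_ (h.k2 c h2 d hd2)
    rintro v hv (h' | h')
    · exact h.u2 (h' ▸ hv)
    · exact h.disj v h' hv
  · have hc' : c ∈ (insert u (H1 ∪ H2))ᶜ := by
      rintro (h' | h' | h')
      · exact hc (Or.inl h')
      · exact hc (Or.inr h')
      · exact h2 h'
    have : RIn G (insert u (H1 ∪ H2))ᶜ c d :=
      rin_closed (A := (insert u (H1 ∪ H2))ᶜ) (Y := Set.univ)
        (fun i j hij hi _ h' => hi (hcl j i hij.symm h')) hc' hcd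
    refine RIn.mono ?_ this
    rintro v hv (h' | h')
    · exact hv (Or.inl h')
    · exact hv (Or.inr (Or.inl h'))

theorem Split.clique [Fintype V] (h : Split G u H1 H2) (hF : F3 K G)
    (hFI : FI (Ideal.span (edges K G))) : ∀ a ∈ H1, ∀ b ∈ H1, a ≠ b → G.Adj a b := by
  classical
  by_contra hnc
  push Not at hnc
  obtain ⟨T, hTX, ⟨t, ht⟩, ⟨a, ha, b, hb, hab⟩, hsep⟩ := minsep H1 h.k1 hnc
  have hall := h.all hF
  obtain ⟨d, hd, hud⟩ := h.n2
  let A0 : Set V := {v | RIn G (H1 \ T) a v}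
  have hA0 : A0 ⊆ H1 \ T := fun v hv => RIn.mem hv ha
  have clA0 : ∀ i j, G.Adj i j → i ∈ A0 → j ∈ H1 \ T → j ∈ A0 := fun i j hij hi hj =>
    Relation.ReflTransGen.tail hi ⟨hij, hA0 hi, hj⟩
  have clA : ∀ i j, G.Adj i j → i ∈ (H1 \ T) \ A0 → j ∈ H1 \ T → j ∈ (H1 \ T) \ A0 :=
    fun i j hij hi hj => ⟨hj, fun h' => hi.2 (clA0 _ _ hij.symm h' hi.1)⟩
  have ha0 : a ∈ A0 := Relation.ReflTransGen.refl
  have hU : insert u T ∪ A0 ∪ ((H1 \ T) \ A0) = insert u H1 := by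
    ext v
    constructor
    · rintro (((h' | h') | h') | h')
      · exact Or.inl h'
      · exact Or.inr (hTX h')
      · exact Or.inr (hA0 h').1
      · exact Or.inr h'.1.1
    · rintro (h' | h')
      · exact Or.inl (Or.inl (Or.inl h'))
      · by_cases h1 : v ∈ T
        · exact Or.inl (Or.inl (Or.inr h1))
        · by_cases h2 : v ∈ A0
          · exact Or.inl (Or.inr h2)
          · exact Or.inr ⟨⟨h', h1⟩, h2⟩
  have key : ∀ i j, G.Adj i j → i ∈ H1 → j ∈ H1 \ T ∨ j ∈ insert u T := by
    intro i j hij hi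
    rcases h.c1 i j hij hi with h' | h'
    · by_cases h1 : j ∈ T
      · exact Or.inr (Or.inr h1)
      · exact Or.inl ⟨h', h1⟩
    · exact Or.inr (Or.inl h')
  refine case_ii (K := K) hFI (insert u T) A0 ((H1 \ T) \ A0) ?_ ?_ ?_ ?_ ?_ a ha0 ?_ ?_ ?_ u
    (Or.inl rfl) b ⟨hb, hab⟩ ?_ ?_ d ?_ hud ?_ t (Or.inr ht) ?_
  · rintro v (rfl | hv) h'
    · exact h.u1 (hA0 h').1
    · exact (hA0 h').2 hv
  · rintro v (rfl | hv) h'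
    · exact h.u1 h'.1.1
    · exact h'.1.2 hv
  · intro v hv h'; exact h'.2 hv
  · intro i j hij hi
    rcases key i j hij hi.1.1 with h' | h'
    · exact Or.inl (clA _ _ hij hi h')
    · exact Or.inr h'
  · intro i j hij hi
    rcases key i j hij (hA0 hi).1 with h' | h'
    · exact Or.inl (clA0 _ _ hij hi h')
    · exact Or.inr h'
  · intro c hc
    exact rin_closed clA0 ha0 hc
  · rintro t (rfl | ht)
    · exact ⟨a, ha0, hall a ha.1⟩
    · exact hsep t ht a ha
  · rintro t (rfl | ht) c hc
    · exact ⟨c, Relation.ReflTransGen.refl, hall c hc.1.1⟩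
    · obtain ⟨c', h1, h2⟩ := hsep t ht c hc.1
      exact ⟨c', rin_closed clA hc h1, h2⟩
  · rintro i j hij (hi | hi) hne
    · exact absurd hi hne
    · rw [hU]
      exact (h.c1 i j hij (hTX hi)).symm
  · rw [hU]
    rintro v (hv | hv) hne
    · exact absurd hv hne
    · exact hall v hv
  · rw [hU]
    rintro (h' | h')
    · exact h.u2 (h' ▸ hd)
    · exact h.disj _ h' hd
  · rw [hU]
    intro c hc d hd
    exact h.reach c hc d hd
  · rintro rfl
    exact h.u1 (hTX ht)

theorem Split.single [Fintype V] (h : Split G u H1 H2) (hF : F3 K G)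
    (hFI : FI (Ideal.span (edges K G))) : ∃ a, H1 = {a} := by
  classical
  obtain ⟨a, ha, hua⟩ := h.n1
  refine ⟨a, ?_⟩
  by_contra hne
  obtain ⟨b, hb, hba⟩ : ∃ b ∈ H1, b ≠ a := by
    by_contra h'
    push Not at h'
    exact hne (Set.Subset.antisymm h' (by rintro _ rfl; exact ha))
  have hcl := h.clique hF hFI
  have hall := h.all hF
  obtain ⟨d, hd, hud⟩ := h.n2
  have hmem : ∀ v, v ∈ (insert u H1).toFinset ↔ v ∈ insert u H1 := fun v => Set.mem_toFinset
  refine clique_false (K := K) hFI (insert u H1).toFinset u ?_ ?_ ?_ (Or.inr ⟨?_, d, ?_, hud⟩) ?_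
  · rw [hmem]; exact Or.inl rfl
  · have h3 : ({u, a, b} : Finset V).card = 3 := by
      refine Finset.card_eq_three.2 ⟨u, a, b, ?_, ?_, hba.symm, rfl⟩
      · exact hua.ne
      · exact (hall b hb).ne
    rw [← h3]
    apply Finset.card_le_card
    intro v hv
    rw [hmem]
    simp only [Finset.mem_insert, Finset.mem_singleton] at hv
    rcases hv with rfl | rfl | rfl
    · exact Or.inl rfl
    · exact Or.inr ha
    · exact Or.inr hb
  · intro p hp q hq hpq
    rw [hmem] at hp hq
    rcases hp with rfl | hp <;> rcases hq with rfl | hq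
    · exact absurd rfl hpq
    · exact hall _ hq
    · exact (hall _ hp).symm
    · exact hcl _ hp _ hq hpq
  · intro i j hij hi hj
    rw [hmem] at hi hj
    rcases hi with hi | hi
    · exact hi
    · exact absurd (h.c1 i j hij hi).symm hj
  · rw [hmem]
    rintro (h' | h')
    · exact h.u2 (h' ▸ hd)
    · exact h.disj _ h' hd
  · intro c hc d hd hcd
    rw [hmem] at hc hd
    refine RIn.mono ?_ (h.reach c hc d hd hcd)
    intro v hv h'
    exact hv ((hmem v).1 h')

/-- the structure of a component -/
theorem comp_struct [Fintype V] (hF : F3 K G) (hFI : FI (Ideal.span (edges K G)))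
    (hiso : ∀ v, ∃ w, G.Adj v w) (v0 : V) :
    (∃ w, G.Adj v0 w ∧ (∀ j, G.Adj v0 j → j = w) ∧ ∀ j, G.Adj w j → j = v0) ∨
    ∃ a u b, a ≠ b ∧ G.Adj a u ∧ G.Adj u b ∧ (∀ j, G.Adj a j → j = u) ∧
      (∀ j, G.Adj b j → j = u) ∧ ∀ j, G.Adj u j → j = a ∨ j = b := by
  classical
  let C : Set V := {v | RIn G Set.univ v0 v}
  have clC : ∀ i j, G.Adj i j → i ∈ C → j ∈ C := fun i j hij hi =>
    Relation.ReflTransGen.tail hi ⟨hij, trivial, trivial⟩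
  have hv0 : v0 ∈ C := Relation.ReflTransGen.refl
  have hconn : ∀ a ∈ C, ∀ b ∈ C, RIn G C a b := fun a ha b hb =>
    rin_closed (fun i j hij hi _ => clC i j hij hi) ha
      (Relation.ReflTransGen.trans (RIn.symm ha) hb)
  by_cases hcl : ∀ a ∈ C, ∀ b ∈ C, a ≠ b → G.Adj a b
  · left
    obtain ⟨w, hw⟩ := hiso v0
    have hwC := clC _ _ hw hv0
    have hC : ∀ v ∈ C, v = v0 ∨ v = w := by
      by_contra h'
      push Not at h'
      obtain ⟨v, hv, h1, h2⟩ := h'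
      have hmem : ∀ v, v ∈ C.toFinset ↔ v ∈ C := fun v => Set.mem_toFinset
      refine clique_false (K := K) hFI C.toFinset v0 ((hmem _).2 hv0) ?_ ?_ (Or.inl ?_) ?_
      · have h3 : ({v0, w, v} : Finset V).card = 3 :=
          Finset.card_eq_three.2 ⟨v0, w, v, hw.ne, h1.symm, h2.symm, rfl⟩
        rw [← h3]
        apply Finset.card_le_card
        intro v hv
        rw [hmem]
        simp only [Finset.mem_insert, Finset.mem_singleton] at hv
        rcases hv with rfl | rfl | rfl <;> assumption
      · intro a ha b hb
        exact hcl a ((hmem _).1 ha) b ((hmem _).1 hb)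
      · intro i j hij hi
        exact (hmem _).2 (clC _ _ hij ((hmem _).1 hi))
      · intro c hc d hd hcd
        refine rin_closed ?_ hc hcd
        intro i j hij hi _ hj
        exact hi ((hmem _).2 (clC _ _ hij.symm ((hmem _).1 hj)))
    refine ⟨w, hw, fun j hj => ?_, fun j hj => ?_⟩
    · exact (hC j (clC _ _ hj hv0)).resolve_left hj.ne.symm
    · exact (hC j (clC _ _ hj hwC)).resolve_right hj.ne.symm
  · right
    push Not at hcl
    obtain ⟨T, hTX, ⟨u, hu⟩, ⟨a, ha, b, hb, hab⟩, hsep⟩ := minsep C hconn hcl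
    let A0 : Set V := {v | RIn G (C \ T) a v}
    have hA0 : A0 ⊆ C \ T := fun v hv => RIn.mem hv ha
    have clA0 : ∀ i j, G.Adj i j → i ∈ A0 → j ∈ C \ T → j ∈ A0 := fun i j hij hi hj =>
      Relation.ReflTransGen.tail hi ⟨hij, hA0 hi, hj⟩
    have clA : ∀ i j, G.Adj i j → i ∈ (C \ T) \ A0 → j ∈ C \ T → j ∈ (C \ T) \ A0 :=
      fun i j hij hi hj => ⟨hj, fun h' => hi.2 (clA0 _ _ hij.symm h' hi.1)⟩
    have ha0 : a ∈ A0 := Relation.ReflTransGen.refl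
    have key : ∀ i j, G.Adj i j → i ∈ C → j ∈ C \ T ∨ j ∈ T := by
      intro i j hij hi
      by_cases h1 : j ∈ T
      · exact Or.inr h1
      · exact Or.inl ⟨clC _ _ hij hi, h1⟩
    have hA' : ∀ i j, G.Adj i j → i ∈ (C \ T) \ A0 → j ∈ (C \ T) \ A0 ∨ j ∈ T := by
      intro i j hij hi
      rcases key i j hij hi.1.1 with h' | h'
      · exact Or.inl (clA _ _ hij hi h')
      · exact Or.inr h'
    have hA0' : ∀ i j, G.Adj i j → i ∈ A0 → j ∈ A0 ∨ j ∈ T := by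
      intro i j hij hi
      rcases key i j hij (hA0 hi).1 with h' | h'
      · exact Or.inl (clA0 _ _ hij hi h')
      · exact Or.inr h'
    have hTA' : ∀ t ∈ T, ∀ c ∈ (C \ T) \ A0, ∃ c', RIn G ((C \ T) \ A0) c c' ∧ G.Adj t c' := by
      rintro t ht c hc
      obtain ⟨c', h1, h2⟩ := hsep t ht c hc.1
      exact ⟨c', rin_closed clA hc h1, h2⟩
    have hTA0' : ∀ t ∈ T, ∃ c ∈ A0, G.Adj t c := fun t ht => hsep t ht a ha
    have hT' : ∀ i j, G.Adj i j → i ∈ T → j ∈ T ∪ A0 ∪ (C \ T) \ A0 := by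
      intro i j hij hi
      rcases key i j hij (hTX hi) with h' | h'
      · by_cases h2 : j ∈ A0
        · exact Or.inl (Or.inr h2)
        · exact Or.inr ⟨h', h2⟩
      · exact Or.inl (Or.inl h')
    have hbA : b ∈ (C \ T) \ A0 := ⟨hb, hab⟩
    have hno : ¬ ((∃ t ∈ T, t ≠ u) ∨ ∃ c1 ∈ (C \ T) \ A0, ¬ RIn G ((C \ T) \ A0) b c1) := by
      intro hcase
      exact case_i (K := K) hFI T A0 ((C \ T) \ A0) (fun v hv h' => (hA0 h').2 hv)
        (fun v hv h' => h'.1.2 hv) (fun v hv h' => h'.2 hv) hA' hA0' a ha0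
        (fun c hc => rin_closed clA0 ha0 hc) hTA0' hTA' u hu b hbA hT' hcase
    push Not at hno
    obtain ⟨hTu, hbc⟩ := hno
    have hs : Split G u A0 ((C \ T) \ A0) := by
      refine ⟨fun h' => (hA0 h').2 hu, fun h' => h'.1.2 hu, fun v hv h' => h'.2 hv, ?_, ?_, ?_,
        ?_, ?_, hTA0' u hu, ?_⟩
      · intro i j hij hi
        exact (hA0' i j hij hi).imp id (hTu j)
      · intro i j hij hi
        exact (hA' i j hij hi).imp id (hTu j)
      · intro j hj
        rcases hT' u j hj hu with (h' | h') | h'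
        · exact absurd (hTu j h') hj.ne.symm
        · exact Or.inl h'
        · exact Or.inr h'
      · intro p hp q hq
        exact Relation.ReflTransGen.trans (RIn.symm (rin_closed clA0 ha0 hp))
          (rin_closed clA0 ha0 hq)
      · intro p hp q hq
        exact Relation.ReflTransGen.trans (RIn.symm (hbc p hp)) (hbc q hq)
      · obtain ⟨c', h1, h2⟩ := hTA' u hu b hbA
        exact ⟨c', RIn.mem h1 hbA, h2⟩
    obtain ⟨p, hp⟩ := hs.single hF hFI
    obtain ⟨q, hq⟩ := hs.swap.single hF hFI
    generalize (C \ T) \ A0 = H2 at *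
    generalize A0 = H1 at *
    subst hp hq
    have hp := hs.all hF p rfl
    have hq := hs.swap.all hF q rfl
    refine ⟨p, u, q, fun e => hs.disj p rfl e, hp.symm, hq, ?_, ?_, hs.cu⟩
    · intro j hj
      exact (hs.c1 p j hj rfl).resolve_left hj.ne.symm
    · intro j hj
      exact (hs.c2 q j hj rfl).resolve_left hj.ne.symm
end E2
end BEI

namespace BEI
section E3
open MvPolynomial
variable {K : Type} [Field K]

theorem reg_edge {V : Type} {G : SimpleGraph V} (a b : V) (hab : G.Adj a b)
    (hall : ∀ v, v = a ∨ v = b) : idealReg (Ideal.span (edges K G)) ≠ 3 := by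
  classical
  have hne := hab.ne
  let f : MvPolynomial (V ⊕ V) K := x K a * y K b - x K b * y K a
  have hf : f ∈ Ideal.span (edges K G) := Ideal.subset_span ⟨a, b, hab, rfl⟩
  have hf0 : f ≠ 0 := by
    intro h
    have := congrArg (eval (Sum.elim (fun v => if v = a then (1 : K) else 0)
      (fun v => if v = b then (1 : K) else 0))) h
    simp [f, x, y, hne.symm] at this
  have hle : Ideal.span (edges K G) ≤ Ideal.span {f} := by
    rw [Ideal.span_le]
    rintro g ⟨i, j, hij, rfl⟩
    rw [SetLike.mem_coe, Ideal.mem_span_singleton]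
    rcases hall i with rfl | rfl <;> rcases hall j with rfl | rfl
    · exact absurd hij (G.irrefl)
    · exact dvd_rfl
    · exact ⟨-1, by simp only [f]; ring⟩
    · exact absurd hij (G.irrefl)
  refine reg_ne _ Unit (Finsupp.linearCombination _ fun _ => ⟨f, hf⟩) ⟨?_, ?_⟩ ?_
  · rw [injective_iff_map_eq_zero]
    intro v hv
    have := congrArg Subtype.val hv
    rw [Finsupp.linearCombination_unique] at this
    simp only [Submodule.coe_smul, smul_eq_mul, ZeroMemClass.coe_zero] at this
    ext1
    exact (mul_eq_zero.1 this).resolve_right hf0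
  · rintro ⟨g, hg⟩
    obtain ⟨c, hc⟩ := Ideal.mem_span_singleton.1 (hle hg)
    refine ⟨Finsupp.single () c, ?_⟩
    apply Subtype.ext
    rw [Finsupp.linearCombination_single]
    simp [hc, mul_comm]
  · intro b'
    rw [Finsupp.linearCombination_single, one_smul]
    refine (isHomZ_nat (k := 2)).2 ?_
    exact ((isHomogeneous_X _ _).mul (isHomogeneous_X _ _)).sub
      ((isHomogeneous_X _ _).mul (isHomogeneous_X _ _))

theorem reg_empty {V : Type} {G : SimpleGraph V} (h : IsEmpty V) :
    idealReg (Ideal.span (edges K G)) ≠ 3 := by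
  have : Ideal.span (edges K G) = ⊥ := by
    rw [Ideal.span_eq_bot]
    rintro f ⟨i, _⟩
    exact h.elim i
  refine reg_ne _ Empty 0 ⟨?_, ?_⟩ ?_
  · intro a b _
    ext1 b; exact b.elim
  · rintro ⟨g, hg⟩
    refine ⟨0, Subtype.ext ?_⟩
    rw [this] at hg
    exact ((Submodule.mem_bot _).1 hg).symm
  · intro b; exact b.elim

theorem main {n : ℕ} {G : SimpleGraph (Fin n)}
    (hiso : ∀ v : Fin n, ∃ w : Fin n, G.Adj v w)
    (hgor : IsGorensteinRing (MvPolynomial (Fin n ⊕ Fin n) K ⧸ Ideal.span (edges K G)))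
    (hreg : idealReg (Ideal.span (edges K G)) = 3) :
    (n = 4 ∧ ∃ a b c d : Fin n,
      ({a, b, c, d} : Finset (Fin n)) = Finset.univ ∧
      a ≠ b ∧ a ≠ c ∧ a ≠ d ∧ b ≠ c ∧ b ≠ d ∧ c ≠ d ∧
      (∀ x y : Fin n, G.Adj x y ↔
        ((x = a ∧ y = b) ∨ (x = b ∧ y = a) ∨ (x = c ∧ y = d) ∨ (x = d ∧ y = c)))) ∨
    (n = 3 ∧ ∃ a b c : Fin n,
      ({a, b, c} : Finset (Fin n)) = Finset.univ ∧
      a ≠ b ∧ a ≠ c ∧ b ≠ c ∧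
      (∀ x y : Fin n, G.Adj x y ↔
        ((x = a ∧ y = b) ∨ (x = b ∧ y = a) ∨ (x = b ∧ y = c) ∨ (x = c ∧ y = b)))) := by
  have hF := F3_of_reg hreg
  have hFI := FI_of_gor hgor
  have hst := comp_struct hF hFI hiso
  by_cases hP : ∃ a u b, a ≠ b ∧ G.Adj a u ∧ G.Adj u b ∧ (∀ j, G.Adj a j → j = u) ∧
      (∀ j, G.Adj b j → j = u) ∧ ∀ j, G.Adj u j → j = a ∨ j = b
  · right
    obtain ⟨a, u, b, nab, au, ub, ha, hb, hu⟩ := hP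
    have hall : ∀ d, d = a ∨ d = u ∨ d = b := by
      by_contra h'
      push Not at h'
      obtain ⟨d, da, du, db⟩ := h'
      obtain ⟨e, de⟩ := hiso d
      have ad : ¬ G.Adj a d := fun h => du (ha _ h)
      have bd : ¬ G.Adj b d := fun h => du (hb _ h)
      have ud : ¬ G.Adj u d := fun h => (hu _ h).elim da db
      have nae : a ≠ e := by rintro rfl; exact ad de.symm
      have nbe : b ≠ e := by rintro rfl; exact bd de.symm
      have nue : u ≠ e := by rintro rfl; exact ud de.symm
      exact noP3K2 hF au ub de nab da.symm nae du.symm nue db.symm nbe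
        (fun h => ub.ne (ha _ h).symm) ad (fun h => nue (ha _ h).symm) ud
        (fun h => (hu _ h).elim nae.symm nbe.symm) bd (fun h => nue (hb _ h).symm)
    have huniv : ({a, u, b} : Finset (Fin n)) = Finset.univ := by
      ext v; simpa using hall v
    refine ⟨?_, a, u, b, huniv, au.ne, nab, ub.ne, ?_⟩
    · have := congrArg Finset.card huniv
      rw [Finset.card_fin] at this
      rw [← this]
      exact Finset.card_eq_three.2 ⟨a, u, b, au.ne, nab, ub.ne, rfl⟩
    · intro p q
      constructor
      · intro h
        rcases hall p with rfl | rfl | rfl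
        · exact Or.inl ⟨rfl, ha _ h⟩
        · rcases hu _ h with h' | h'
          · exact Or.inr (Or.inl ⟨rfl, h'⟩)
          · exact Or.inr (Or.inr (Or.inl ⟨rfl, h'⟩))
        · exact Or.inr (Or.inr (Or.inr ⟨rfl, hb _ h⟩))
      · rintro (⟨rfl, rfl⟩ | ⟨rfl, rfl⟩ | ⟨rfl, rfl⟩ | ⟨rfl, rfl⟩)
        · exact au
        · exact au.symm
        · exact ub
        · exact ub.symm
  · left
    have hE := fun v => (hst v).resolve_right hP
    rcases isEmpty_or_nonempty (Fin n) with hn | ⟨⟨a⟩⟩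
    · exact absurd hreg (reg_empty hn)
    obtain ⟨b, ab, ha, hb⟩ := hE a
    by_cases h2 : ∀ v, v = a ∨ v = b
    · exact absurd hreg (reg_edge a b ab h2)
    push Not at h2
    obtain ⟨c, ca, cb⟩ := h2
    obtain ⟨d, cd, hc, hd⟩ := hE c
    have nda : d ≠ a := by rintro rfl; exact cb (ha _ cd.symm)
    have ndb : d ≠ b := by rintro rfl; exact ca (hb _ cd.symm)
    have hall : ∀ v, v = a ∨ v = b ∨ v = c ∨ v = d := by
      by_contra h'
      push Not at h'
      obtain ⟨e, ea, eb, ec, ed⟩ := h'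
      obtain ⟨f, ef⟩ := hiso e
      have nfa : f ≠ a := by rintro rfl; exact eb (ha _ ef.symm)
      have nfb : f ≠ b := by rintro rfl; exact ea (hb _ ef.symm)
      have nfc : f ≠ c := by rintro rfl; exact ed (hc _ ef.symm)
      have nfd : f ≠ d := by rintro rfl; exact ec (hd _ ef.symm)
      exact no3K2 hF ab cd ef ca.symm nda.symm ea.symm nfa.symm cb.symm ndb.symm eb.symm nfb.symm
        ec.symm nfc.symm ed.symm nfd.symm
        (fun h => cb (ha _ h)) (fun h => ndb (ha _ h)) (fun h => eb (ha _ h))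
        (fun h => nfb (ha _ h)) (fun h => ca (hb _ h)) (fun h => nda (hb _ h))
        (fun h => ea (hb _ h)) (fun h => nfa (hb _ h)) (fun h => ed (hc _ h))
        (fun h => nfd (hc _ h)) (fun h => ec (hd _ h)) (fun h => nfc (hd _ h))
    have huniv : ({a, b, c, d} : Finset (Fin n)) = Finset.univ := by
      ext v; simpa using hall v
    refine ⟨?_, a, b, c, d, huniv, ab.ne, ca.symm, nda.symm, cb.symm, ndb.symm, cd.ne, ?_⟩
    · have := congrArg Finset.card huniv
      rw [Finset.card_fin] at this
      rw [← this]
      rw [Finset.card_insert_of_notMem (by simp [ab.ne, ca.symm, nda.symm]),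
        Finset.card_eq_three.2 ⟨b, c, d, cb.symm, ndb.symm, cd.ne, rfl⟩]
    · intro p q
      constructor
      · intro h
        rcases hall p with rfl | rfl | rfl | rfl
        · exact Or.inl ⟨rfl, ha _ h⟩
        · exact Or.inr (Or.inl ⟨rfl, hb _ h⟩)
        · exact Or.inr (Or.inr (Or.inl ⟨rfl, hc _ h⟩))
        · exact Or.inr (Or.inr (Or.inr ⟨rfl, hd _ h⟩))
      · rintro (⟨rfl, rfl⟩ | ⟨rfl, rfl⟩ | ⟨rfl, rfl⟩ | ⟨rfl, rfl⟩)
        · exact ab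
        · exact ab.symm
        · exact cd
        · exact cd.symm
end E3
end BEI


theorem stmt18 (K : Type) [Field K] (n : ℕ) (G : SimpleGraph (Fin n))
    (hiso : ∀ v : Fin n, ∃ w : Fin n, G.Adj v w)
    (hdeg2 : ∃ T : Set (MvPolynomial (Fin n ⊕ Fin n) K),
      (∀ f ∈ T, f.IsHomogeneous 2) ∧ Ideal.span T = beIdeal K G)
    (hgor : IsGorensteinRing (MvPolynomial (Fin n ⊕ Fin n) K ⧸ beIdeal K G))
    (hreg : idealReg (beIdeal K G) = 3) :
    (n = 4 ∧ ∃ a b c d : Fin n,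
      ({a, b, c, d} : Finset (Fin n)) = Finset.univ ∧
      a ≠ b ∧ a ≠ c ∧ a ≠ d ∧ b ≠ c ∧ b ≠ d ∧ c ≠ d ∧
      (∀ x y : Fin n, G.Adj x y ↔
        ((x = a ∧ y = b) ∨ (x = b ∧ y = a) ∨ (x = c ∧ y = d) ∨ (x = d ∧ y = c)))) ∨
    (n = 3 ∧ ∃ a b c : Fin n,
      ({a, b, c} : Finset (Fin n)) = Finset.univ ∧
      a ≠ b ∧ a ≠ c ∧ b ≠ c ∧
      (∀ x y : Fin n, G.Adj x y ↔
        ((x = a ∧ y = b) ∨ (x = b ∧ y = a) ∨ (x = b ∧ y = c) ∨ (x = c ∧ y = b)))) := by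
  exact BEI.main hiso hgor hreg
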